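/- arXiv:2509.09231 — 3 statements merged into one kernel-verified Lean document; each statement's English description precedes it below -/
import Mathlib

section
/- Suppose there exists a real constant C₄ such that for all sufficiently small ε > 0 one has (1/2)∫_Ω (|∇u_ε|² + |∇v_ε|²) dx ≥ C₄ > (1/2)∫_Ω (|∇u₀|² + |∇v₀|²) dx. Then the quantity ε⁻² ∫_Ω [(2 − |u_ε|² − |v_ε|²)² + (1 − |u_ε|²)²] dx does not converge to 0 as ε → 0⁺. -/
open MeasureTheory Filter Topology

noncomputable section

/-- Points of the plane, viewed as the Euclidean space `ℝ²`. -/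
abbrev Pt : Type := EuclideanSpace ℝ (Fin 2)

/-- The `i`-th partial derivative of a complex-valued function. -/
def pd (u : Pt → ℂ) (x : Pt) (i : Fin 2) : ℂ :=
  fderiv ℝ u x (EuclideanSpace.single i 1)

/-- Squared Hilbert–Schmidt norm of the derivative, `|∇u|²`. -/
def gradSq (u : Pt → ℂ) (x : Pt) : ℝ :=
  ∑ i, ‖pd u x i‖ ^ 2

/-- `|∇u − ∇v|²`. -/
def gradDiffSq (u v : Pt → ℂ) (x : Pt) : ℝ :=
  ∑ i, ‖pd u x i - pd v x i‖ ^ 2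

/-- Laplacian of a complex-valued function. -/
def lap (u : Pt → ℂ) (x : Pt) : ℂ :=
  ∑ i, fderiv ℝ (fun y => pd u y i) x (EuclideanSpace.single i 1)

/-- The `i`-th partial derivative of a real-valued function. -/
def pdR (f : Pt → ℝ) (x : Pt) (i : Fin 2) : ℝ :=
  fderiv ℝ f x (EuclideanSpace.single i 1)

/-- `|∇f|²` for a real-valued function `f`. -/
def gradSqR (f : Pt → ℝ) (x : Pt) : ℝ :=
  ∑ i, (pdR f x i) ^ 2

/-- Laplacian of a real-valued function. -/
def lapR (f : Pt → ℝ) (x : Pt) : ℝ :=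
  ∑ i, fderiv ℝ (fun y => pdR f y i) x (EuclideanSpace.single i 1)

/-- The `i`-th standard basis vector of the plane. -/
abbrev unitVec (i : Fin 2) : Pt := EuclideanSpace.single i 1

/-- `g` is differentiable near `0` and its derivative has derivative `m` at `0`. -/
def HasSecondDerivAtZero (g : ℝ → ℝ) (m : ℝ) : Prop :=
  ∃ g' : ℝ → ℝ, (∀ᶠ t in 𝓝 0, HasDerivAt g (g' t) t) ∧ HasDerivAt g' m 0

namespace HasSecondDerivAtZero

variable {g h : ℝ → ℝ} {m n : ℝ}

theorem add (hg : HasSecondDerivAtZero g m) (hh : HasSecondDerivAtZero h n) :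
    HasSecondDerivAtZero (fun t => g t + h t) (m + n) := by
  obtain ⟨g', h1, h2⟩ := hg
  obtain ⟨h', h3, h4⟩ := hh
  refine ⟨fun t => g' t + h' t, ?_, h2.add h4⟩
  filter_upwards [h1, h3] with t a b using a.add b

theorem const_mul (c : ℝ) (hg : HasSecondDerivAtZero g m) :
    HasSecondDerivAtZero (fun t => c * g t) (c * m) := by
  obtain ⟨g', h1, h2⟩ := hg
  refine ⟨fun t => c * g' t, ?_, h2.const_mul c⟩
  filter_upwards [h1] with t a using a.const_mul c

theorem comp_neg (hg : HasSecondDerivAtZero g m) :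
    HasSecondDerivAtZero (fun t => g (-t)) m := by
  obtain ⟨g', h1, h2⟩ := hg
  have hneg : Tendsto (fun t : ℝ => -t) (𝓝 0) (𝓝 0) := by
    simpa using (continuous_neg (G := ℝ)).tendsto 0
  refine ⟨fun t => -g' (-t), ?_, ?_⟩
  · filter_upwards [hneg.eventually h1] with t a
    exact (a.scomp t (hasDerivAt_neg t)).congr_deriv (by simp)
  · have h2' : HasDerivAt g' m (-0) := by simpa using h2
    exact (h2'.scomp (0 : ℝ) (hasDerivAt_neg (0 : ℝ))).neg.congr_deriv (by simp)

theorem nonpos_of_isLocalMax (hg : HasSecondDerivAtZero g m) (hmax : IsLocalMax g 0) :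
    m ≤ 0 := by
  obtain ⟨g', h1, h2⟩ := hg
  by_contra! hm
  have hd : deriv g =ᶠ[𝓝 0] g' := h1.mono fun t ht => ht.deriv
  have h0 : deriv g 0 = 0 := hmax.deriv_eq_zero
  have hdd : deriv (deriv g) 0 = m := (h2.congr_of_eventuallyEq hd).deriv
  have hmin : IsLocalMin g 0 :=
    isLocalMin_of_deriv_deriv_pos (by rw [hdd]; exact hm) h0 h1.self_of_nhds.continuousAt
  have hconst : g =ᶠ[𝓝 0] fun _ => g 0 := by
    filter_upwards [hmin, hmax] with t a b using le_antisymm b a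
  have : deriv (deriv g) 0 = 0 := by
    have h3 : deriv g =ᶠ[𝓝 0] fun _ => 0 := by
      filter_upwards [hconst.eventuallyEq_nhds] with t ht
      rw [ht.deriv_eq]; simp
    rw [h3.deriv_eq]; simp
  linarith

end HasSecondDerivAtZero

/-- The sum of the second derivatives of `f` along the coordinate lines through `x` is `L`. -/
def HasLineLaplacian (f : Pt → ℝ) (L : ℝ) (x : Pt) : Prop :=
  ∃ m : Fin 2 → ℝ, (∀ i, HasSecondDerivAtZero (fun t => f (x + t • unitVec i)) (m i)) ∧
    ∑ i, m i = L

namespace HasLineLaplacian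

variable {f g : Pt → ℝ} {L M : ℝ} {x : Pt}

theorem add (hf : HasLineLaplacian f L x) (hg : HasLineLaplacian g M x) :
    HasLineLaplacian (fun y => f y + g y) (L + M) x := by
  obtain ⟨m, h1, h2⟩ := hf
  obtain ⟨n, h3, h4⟩ := hg
  exact ⟨fun i => m i + n i, fun i => (h1 i).add (h3 i), by rw [Finset.sum_add_distrib, h2, h4]⟩

theorem const_mul (c : ℝ) (hf : HasLineLaplacian f L x) :
    HasLineLaplacian (fun y => c * f y) (c * L) x := by
  obtain ⟨m, h1, h2⟩ := hf
  exact ⟨fun i => c * m i, fun i => (h1 i).const_mul c, by rw [← Finset.mul_sum, h2]⟩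

theorem neg (hf : HasLineLaplacian f L x) : HasLineLaplacian (fun y => -f y) (-L) x := by
  simpa using hf.const_mul (-1)

theorem nonpos_of_isLocalMax (hf : HasLineLaplacian f L x) (hmax : IsLocalMax f x) : L ≤ 0 := by
  obtain ⟨m, h1, rfl⟩ := hf
  refine Finset.sum_nonpos fun i _ => (h1 i).nonpos_of_isLocalMax ?_
  have hc : Tendsto (fun t : ℝ => x + t • unitVec i) (𝓝 0) (𝓝 x) := by
    have : Continuous (fun t : ℝ => x + t • unitVec i) := by fun_prop
    simpa using this.tendsto 0
  filter_upwards [hc.eventually hmax] with t ht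
  simpa using ht

theorem const (c : ℝ) (x : Pt) : HasLineLaplacian (fun _ => c) 0 x :=
  ⟨fun _ => 0, fun _ => ⟨fun _ => 0, .of_forall fun t => hasDerivAt_const t c,
    hasDerivAt_const _ _⟩, by simp⟩

theorem sq_coord_sub (j : Fin 2) (a : ℝ) (x : Pt) :
    HasLineLaplacian (fun y => (y j - a) ^ 2) 2 x := by
  refine ⟨fun i => if i = j then 2 else 0, fun i => ?_, by simp⟩
  by_cases hij : i = j
  · subst hij
    simp only [if_true]
    refine ⟨fun t => 2 * (x i + t - a), .of_forall fun t => ?_, ?_⟩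
    · have := (((hasDerivAt_id t).const_add (x i)).sub_const a).pow 2
      have h' : (fun t : ℝ => ((x + t • unitVec i) i - a) ^ 2) = (fun t => x i + id t - a) ^ 2 := by
        ext t; simp
      rw [h']
      exact this.congr_deriv (by simp)
    · simpa using (((hasDerivAt_id (0 : ℝ)).const_add (x i)).sub_const a).const_mul 2
  · simp only [hij, if_false]
    refine ⟨fun _ => 0, .of_forall fun t => ?_, hasDerivAt_const _ _⟩
    have : (fun t : ℝ => ((x + t • unitVec i) j - a) ^ 2) = fun _ => (x j - a) ^ 2 := by
      ext t; simp [Ne.symm hij]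
    rw [this]
    exact hasDerivAt_const _ _

theorem coord (j : Fin 2) (x : Pt) : HasLineLaplacian (fun y => y j) 0 x := by
  refine ⟨fun _ => 0, fun i => ⟨fun _ => unitVec i j, .of_forall fun t => ?_,
    hasDerivAt_const _ _⟩, by simp⟩
  simpa using ((hasDerivAt_id t).mul_const (unitVec i j)).const_add (x j)

theorem of_complex {u : Pt → ℂ} (hu : ContDiffAt ℝ 2 u x) (c : ℂ) :
    HasLineLaplacian (fun y => (c * u y).re) (c * lap u x).re x := by
  refine ⟨fun i => (c * fderiv ℝ (fun y => pd u y i) x (unitVec i)).re, fun i =>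
    ⟨fun t => (c * pd u (x + t • unitVec i) i).re, ?_, ?_⟩, ?_⟩
  · have hc : Tendsto (fun t : ℝ => x + t • unitVec i) (𝓝 0) (𝓝 x) := by
      have : Continuous (fun t : ℝ => x + t • unitVec i) := by fun_prop
      simpa using this.tendsto 0
    have hev : ∀ᶠ y in 𝓝 x, ContDiffAt ℝ 2 u y := hu.eventually (by simp)
    filter_upwards [hc.eventually hev] with t ht
    have h1 : HasFDerivAt u (fderiv ℝ u (x + t • unitVec i)) (x + t • unitVec i) :=
      (ht.differentiableAt (by norm_num)).hasFDerivAt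
    have h2 : HasDerivAt (fun t : ℝ => x + t • unitVec i) (unitVec i) t := by
      simpa using ((hasDerivAt_id t).smul_const (unitVec i)).const_add x
    have h3 := (h1.comp_hasDerivAt t h2).const_mul c
    exact Complex.reCLM.hasFDerivAt.comp_hasDerivAt t h3
  · have hd : DifferentiableAt ℝ (fun y => pd u y i) x := by
      have : ContDiffAt ℝ 1 (fderiv ℝ u) x := hu.fderiv_right (by norm_num)
      exact (this.differentiableAt (by norm_num)).clm_apply (differentiableAt_const _)
    have h1 : HasFDerivAt (fun y => pd u y i) (fderiv ℝ (fun y => pd u y i) x)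
        (x + (0 : ℝ) • unitVec i) := by simpa using hd.hasFDerivAt
    have h2 : HasDerivAt (fun t : ℝ => x + t • unitVec i) (unitVec i) 0 := by
      simpa using ((hasDerivAt_id (0 : ℝ)).smul_const (unitVec i)).const_add x
    have h3 := (h1.comp_hasDerivAt (0 : ℝ) h2).const_mul c
    exact Complex.reCLM.hasFDerivAt.comp_hasDerivAt (0 : ℝ) h3
  · simp only [lap, Finset.mul_sum, Complex.re_sum]

end HasLineLaplacian

/-- Weak maximum principle for functions with positive Laplacian. -/
theorem nonpos_of_hasLineLaplacian_pos {D : Set Pt} (hD : Bornology.IsBounded D) (hDo : IsOpen D)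
    {F : Pt → ℝ} (hF : ContinuousOn F (closure D)) (hb : ∀ x ∈ closure D, x ∉ D → F x ≤ 0)
    (hL : ∀ x ∈ D, ∃ L > 0, HasLineLaplacian F L x) {x : Pt} (hx : x ∈ D) : F x ≤ 0 := by
  obtain ⟨z, hz, hmax⟩ := hD.isCompact_closure.exists_isMaxOn ⟨x, subset_closure hx⟩ hF
  refine (hmax (subset_closure hx)).trans ?_
  by_cases hzD : z ∈ D
  · obtain ⟨L, hLpos, hLz⟩ := hL z hzD
    have : IsLocalMax F z := by
      filter_upwards [hDo.mem_nhds hzD] with y hy using hmax (subset_closure hy)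
    exact absurd (hLz.nonpos_of_isLocalMax this) (not_le.2 hLpos)
  · exact hb z hz hzD

theorem norm_sub_sq_eq_coord (x y : Pt) :
    ‖x - y‖ ^ 2 = (x 0 - y 0) ^ 2 + (x 1 - y 1) ^ 2 := by
  simp [EuclideanSpace.norm_sq_eq, Fin.sum_univ_two]

theorem abs_coord_sub_le (x y : Pt) (i : Fin 2) : |x i - y i| ≤ ‖x - y‖ := by
  simpa using PiLp.norm_apply_le (x - y) i

/-- Reflection of the plane in the line `x i = y i`. -/
def reflectCoord (y : Pt) (i : Fin 2) (x : Pt) : Pt := x - (2 * (x i - y i)) • unitVec i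

theorem norm_reflectCoord_sub (y : Pt) (i : Fin 2) (x : Pt) :
    ‖reflectCoord y i x - y‖ = ‖x - y‖ := by
  rw [← sq_eq_sq₀ (norm_nonneg _) (norm_nonneg _), norm_sub_sq_eq_coord, norm_sub_sq_eq_coord]
  fin_cases i <;> simp [reflectCoord] <;> ring

theorem continuous_reflectCoord (y : Pt) (i : Fin 2) : Continuous (reflectCoord y i) := by
  unfold reflectCoord; fun_prop

theorem HasLineLaplacian.comp_reflectCoord {f : Pt → ℝ} {L : ℝ} {x y : Pt} {i : Fin 2}
    (hf : HasLineLaplacian f L (reflectCoord y i x)) :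
    HasLineLaplacian (fun z => f (reflectCoord y i z)) L x := by
  obtain ⟨m, h1, h2⟩ := hf
  refine ⟨m, fun j => ?_, h2⟩
  by_cases hij : j = i
  · subst hij
    have key : (fun t : ℝ => f (reflectCoord y j (x + t • unitVec j))) =
        fun t => f (reflectCoord y j x + (-t) • unitVec j) := by
      ext t
      congr 1
      simp only [reflectCoord, PiLp.add_apply, PiLp.smul_apply, unitVec]
      simp
      module
    rw [key]
    exact (h1 j).comp_neg
  · have key : (fun t : ℝ => f (reflectCoord y i (x + t • unitVec j))) =
        fun t => f (reflectCoord y i x + t • unitVec j) := by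
      ext t
      congr 1
      simp only [reflectCoord, PiLp.add_apply, PiLp.smul_apply, unitVec]
      simp [Ne.symm hij]
      module
    rw [key]
    exact h1 j

/-- Interior estimate for a symmetric difference of a function with bounded Laplacian. -/
theorem sub_le_of_abs_laplacian_le {C E d t : ℝ} (hd : 0 < d) (hC : 0 ≤ C) (hE : 0 < E)
    {f : Pt → ℝ} {y : Pt} (i : Fin 2) (hc : ContinuousOn f (Metric.closedBall y d))
    (hL : ∀ x ∈ Metric.ball y d, ∃ L, |L| ≤ E ∧ HasLineLaplacian f L x)
    (hb : ∀ x ∈ Metric.closedBall y d, |f x| ≤ C) (ht0 : 0 ≤ t) (htd : t < d) :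
    f (y + t • unitVec i) - f (y - t • unitVec i) ≤ t * (10 * C / d + 4 * E * d) := by
  have hnorm1 : ‖unitVec i‖ = 1 := by simp
  rcases ht0.eq_or_lt with rfl | ht0
  · simp
  set K : ℝ := 2 * E + 4 * C / d ^ 2 with hK
  have hKpos : 0 < K := by positivity
  set D : Set Pt := Metric.ball y d ∩ {x | y i < x i} with hDdef
  have hcoord : Continuous fun x : Pt => x i := by fun_prop
  have hDo : IsOpen D := Metric.isOpen_ball.inter (isOpen_lt continuous_const hcoord)
  have hcl : closure D ⊆ Metric.closedBall y d ∩ {x | y i ≤ x i} :=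
    closure_minimal (Set.inter_subset_inter Metric.ball_subset_closedBall
      fun x (hx : y i < x i) => hx.le)
      (Metric.isClosed_closedBall.inter (isClosed_le continuous_const hcoord))
  have hR : ∀ r x, x ∈ Metric.closedBall y r → reflectCoord y i x ∈ Metric.closedBall y r := by
    intro r x hx
    rw [mem_closedBall_iff_norm] at hx ⊢
    rwa [norm_reflectCoord_sub]
  have hRb : ∀ x ∈ Metric.ball y d, reflectCoord y i x ∈ Metric.ball y d := by
    intro x hx
    rw [mem_ball_iff_norm] at hx ⊢
    rwa [norm_reflectCoord_sub]
  let F : Pt → ℝ := fun x => f x + -f (reflectCoord y i x) +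
    (-(2 * C / d ^ 2) * (x 0 - y 0) ^ 2 + -(2 * C / d ^ 2) * (x 1 - y 1) ^ 2) +
    (K * (x i - y i) ^ 2 + -(2 * d * K) * x i + 2 * d * K * y i)
  have hFeq : ∀ x, F x = f x - f (reflectCoord y i x) - 2 * C / d ^ 2 * ‖x - y‖ ^ 2 -
      K * (x i - y i) * (2 * d - (x i - y i)) := by
    intro x; simp only [F, norm_sub_sq_eq_coord]; ring
  have hFc : ContinuousOn F (closure D) := by
    have h1 : ContinuousOn f (closure D) := hc.mono fun x hx => (hcl hx).1
    have h2 : ContinuousOn (fun x => f (reflectCoord y i x)) (closure D) :=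
      hc.comp (continuous_reflectCoord y i).continuousOn fun x hx => hR d x (hcl hx).1
    exact ((h1.add h2.neg).add (by fun_prop)).add (by fun_prop)
  have hFL : ∀ x ∈ D, ∃ L > 0, HasLineLaplacian F L x := by
    intro x hx
    obtain ⟨L1, hL1, h1⟩ := hL x hx.1
    obtain ⟨L2, hL2, h2⟩ := hL _ (hRb x hx.1)
    refine ⟨_, ?_, ((h1.add h2.comp_reflectCoord.neg).add
      (((HasLineLaplacian.sq_coord_sub 0 (y 0) x).const_mul _).add
        ((HasLineLaplacian.sq_coord_sub 1 (y 1) x).const_mul _))).add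
      ((((HasLineLaplacian.sq_coord_sub i (y i) x).const_mul K).add
        ((HasLineLaplacian.coord i x).const_mul _)).add (HasLineLaplacian.const _ x))⟩
    have e1 := (abs_le.1 hL1).1
    have e2 := (abs_le.1 hL2).2
    have e3 : K = 2 * E + 2 * (2 * C / d ^ 2) := by rw [hK]; ring
    rw [e3]
    nlinarith
  have hFb : ∀ x ∈ closure D, x ∉ D → F x ≤ 0 := by
    intro x hx hxD
    have hxb := (hcl hx).1
    have hxi : y i ≤ x i := (hcl hx).2
    have hxd : ‖x - y‖ ≤ d := mem_closedBall_iff_norm.1 hxb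
    have hsd : x i - y i ≤ d := (le_abs_self _).trans ((abs_coord_sub_le x y i).trans hxd)
    have hpos : 0 ≤ K * (x i - y i) * (2 * d - (x i - y i)) := by
      apply mul_nonneg (mul_nonneg hKpos.le (by linarith)) (by linarith)
    rw [hFeq]
    by_cases hlt : ‖x - y‖ < d
    · have hxi' : x i = y i := by
        by_contra hne
        exact hxD ⟨mem_ball_iff_norm.2 hlt, lt_of_le_of_ne hxi (Ne.symm hne)⟩
      have hfix : reflectCoord y i x = x := by simp [reflectCoord, hxi']
      rw [hfix]
      have : 0 ≤ 2 * C / d ^ 2 * ‖x - y‖ ^ 2 := by positivity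
      linarith
    · have heq : ‖x - y‖ = d := le_antisymm hxd (not_lt.1 hlt)
      have e1 := (abs_le.1 (hb x hxb)).2
      have e2 := (abs_le.1 (hb _ (hR d x hxb))).1
      have e3 : 2 * C / d ^ 2 * ‖x - y‖ ^ 2 = 2 * C := by rw [heq]; field_simp
      linarith
  have hzD : y + t • unitVec i ∈ D := by
    refine ⟨?_, ?_⟩
    · rw [mem_ball_iff_norm]
      simpa [norm_smul, abs_of_pos ht0] using htd
    · simpa using ht0
  have hmain := nonpos_of_hasLineLaplacian_pos
    (Metric.isBounded_ball.subset Set.inter_subset_left) hDo hFc hFb hFL hzD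
  have hrefl : reflectCoord y i (y + t • unitVec i) = y - t • unitVec i := by
    simp only [reflectCoord, PiLp.add_apply, PiLp.smul_apply, unitVec]
    simp
    module
  have hn : ‖y + t • unitVec i - y‖ ^ 2 = t ^ 2 := by
    rw [add_sub_cancel_left, norm_smul, hnorm1]; simp
  have hci : (y + t • unitVec i) i - y i = t := by simp
  rw [hFeq, hrefl, hn, hci] at hmain
  have e4 : 2 * C / d ^ 2 * t ^ 2 ≤ 2 * C / d * t := by
    have : 2 * C / d * t - 2 * C / d ^ 2 * t ^ 2 = 2 * C * t * (d - t) / d ^ 2 := by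
      field_simp
    have h2 : 0 ≤ 2 * C * t * (d - t) / d ^ 2 := by
      have : 0 ≤ d - t := by linarith
      positivity
    linarith
  have e5 : K * t * (2 * d - t) ≤ 2 * d * K * t := by nlinarith [mul_pos hKpos ht0]
  have e6 : t * (10 * C / d + 4 * E * d) = 2 * C / d * t + 2 * d * K * t := by
    rw [hK]; field_simp; ring
  linarith

/-- The real part of the principal branch of the cube root. -/
def cbrtRe (z : ℂ) : ℝ := (z ^ ((1 / 3 : ℝ) : ℂ)).re

theorem cbrtRe_eq_cos_arg (z : ℂ) :
    cbrtRe z = ‖z‖ ^ (1 / 3 : ℝ) * Real.cos (z.arg * (1 / 3)) := by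
  rw [cbrtRe, Complex.cpow_ofReal_re]

theorem cbrtRe_eq_cos_arccos {z : ℂ} (hz : z ≠ 0) :
    cbrtRe z = ‖z‖ ^ (1 / 3 : ℝ) * Real.cos (Real.arccos (z.re / ‖z‖) * (1 / 3)) := by
  rw [cbrtRe_eq_cos_arg]
  congr 1
  rcases le_or_gt 0 z.im with h | h
  · rw [Complex.arg_of_im_nonneg_of_ne_zero h hz]
  · rw [Complex.arg_of_im_neg h, neg_mul, Real.cos_neg]

theorem cbrtRe_le (z : ℂ) : cbrtRe z ≤ ‖z‖ ^ (1 / 3 : ℝ) := by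
  rw [cbrtRe_eq_cos_arg]
  exact mul_le_of_le_one_right (by positivity) (Real.cos_le_one _)

theorem le_cbrtRe (z : ℂ) : 1 / 2 * ‖z‖ ^ (1 / 3 : ℝ) ≤ cbrtRe z := by
  rw [cbrtRe_eq_cos_arg, mul_comm]
  refine mul_le_mul_of_nonneg_left ?_ (by positivity)
  rw [← Real.cos_pi_div_three, ← Real.cos_abs (z.arg * (1 / 3))]
  have h := Complex.abs_arg_le_pi z
  refine Real.cos_le_cos_of_nonneg_of_le_pi (abs_nonneg _) (by linarith [Real.pi_pos]) ?_
  rw [abs_mul, abs_of_pos (by norm_num : (0 : ℝ) < 1 / 3)]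
  linarith

theorem cbrtRe_nonneg (z : ℂ) : 0 ≤ cbrtRe z :=
  le_trans (by positivity) (le_cbrtRe z)

theorem continuous_cbrtRe : Continuous cbrtRe := by
  rw [continuous_iff_continuousAt]
  intro z
  rcases eq_or_ne z 0 with rfl | hz
  · have h0 : cbrtRe 0 = 0 := by
      rw [cbrtRe_eq_cos_arg]; norm_num
    rw [ContinuousAt, h0]
    have hc : Continuous fun z : ℂ => ‖z‖ ^ (1 / 3 : ℝ) :=
      continuous_norm.rpow_const fun _ => Or.inr (by norm_num)
    have : Tendsto (fun z : ℂ => ‖z‖ ^ (1 / 3 : ℝ)) (𝓝 0) (𝓝 0) := by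
      have h := hc.tendsto 0
      rwa [norm_zero, Real.zero_rpow (by norm_num)] at h
    exact squeeze_zero cbrtRe_nonneg cbrtRe_le this
  · have : cbrtRe =ᶠ[𝓝 z] fun z =>
        ‖z‖ ^ (1 / 3 : ℝ) * Real.cos (Real.arccos (z.re / ‖z‖) * (1 / 3)) := by
      filter_upwards [isOpen_ne.mem_nhds hz] with w hw using cbrtRe_eq_cos_arccos hw
    refine ContinuousAt.congr ?_ this.symm
    have hn : ContinuousAt (fun z : ℂ => ‖z‖) z := continuous_norm.continuousAt
    refine (hn.rpow_const (Or.inr (by norm_num))).mul ?_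
    refine Real.continuous_cos.continuousAt.comp ?_
    refine ContinuousAt.mul ?_ continuousAt_const
    exact Real.continuous_arccos.continuousAt.comp
      (Complex.continuous_re.continuousAt.div hn (norm_ne_zero_iff.2 hz))

/-- The linear coordinate `c ((x₀ - p₀) + i (x₁ - p₁))` on the plane. -/
def complexCoord (c : ℂ) (p x : Pt) : ℂ :=
  c * (((x 0 - p 0 : ℝ) : ℂ) + ((x 1 - p 1 : ℝ) : ℂ) * Complex.I)

theorem norm_complexCoord {c : ℂ} (hc : ‖c‖ = 1) (p x : Pt) :
    ‖complexCoord c p x‖ = ‖x - p‖ := by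
  rw [complexCoord, norm_mul, hc, one_mul, ← sq_eq_sq₀ (norm_nonneg _) (norm_nonneg _),
    norm_sub_sq_eq_coord, ← Complex.normSq_eq_norm_sq, Complex.normSq_add_mul_I]

theorem continuous_complexCoord (c : ℂ) (p : Pt) : Continuous (complexCoord c p) := by
  unfold complexCoord; fun_prop

theorem hasLineLaplacian_cbrtRe_comp {c : ℂ} {p x : Pt}
    (hx : complexCoord c p x ∈ Complex.slitPlane) :
    HasLineLaplacian (fun y => cbrtRe (complexCoord c p y)) 0 x := by
  let κ : Fin 2 → ℂ := ![c, c * Complex.I]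
  set a : ℂ := ((1 / 3 : ℝ) : ℂ) with ha
  let z := complexCoord c p x
  have hlin : ∀ i (t : ℝ), complexCoord c p (x + t • unitVec i) = z + t * κ i := by
    intro i t
    fin_cases i <;> simp [complexCoord, κ, z] <;> ring
  refine ⟨fun i => (a * ((a - 1) * z ^ (a - 1 - 1) * κ i) * κ i).re, fun i =>
    ⟨fun t => (a * (z + t * κ i) ^ (a - 1) * κ i).re, ?_, ?_⟩, ?_⟩
  · have hcont : Continuous fun t : ℝ => z + t * κ i := by fun_prop
    have hev : ∀ᶠ t : ℝ in 𝓝 0, z + t * κ i ∈ Complex.slitPlane := by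
      apply hcont.continuousAt.eventually_mem
      simpa using Complex.isOpen_slitPlane.mem_nhds hx
    filter_upwards [hev] with t ht
    simp only [hlin, cbrtRe]
    have h1 : HasDerivAt (fun t : ℝ => z + t * κ i) (κ i) t := by
      simpa using (((hasDerivAt_id t).ofReal_comp).mul_const (κ i)).const_add z
    have h2 := (hasDerivAt_id (z + t * κ i)).cpow_const (c := a) ht
    have h3 : HasDerivAt (fun t : ℝ => (z + t * κ i) ^ a) (a * (z + t * κ i) ^ (a - 1) * κ i) t := by
      have h4 := h2.comp t h1
      exact h4.congr_deriv (by simp)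
    exact Complex.reCLM.hasFDerivAt.comp_hasDerivAt t h3
  · have h1 : HasDerivAt (fun t : ℝ => z + t * κ i) (κ i) 0 := by
      simpa using (((hasDerivAt_id (0 : ℝ)).ofReal_comp).mul_const (κ i)).const_add z
    have hz : z + ((0 : ℝ) : ℂ) * κ i ∈ Complex.slitPlane := by simpa using hx
    have h2 := (hasDerivAt_id (z + ((0 : ℝ) : ℂ) * κ i)).cpow_const (c := a - 1) hz
    have h3 : HasDerivAt (fun t : ℝ => (z + t * κ i) ^ (a - 1))
        ((a - 1) * z ^ (a - 1 - 1) * κ i) 0 := by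
      have h4 := h2.comp (0 : ℝ) h1
      exact h4.congr_deriv (by simp)
    exact Complex.reCLM.hasFDerivAt.comp_hasDerivAt (0 : ℝ) ((h3.const_mul a).mul_const (κ i))
  · rw [← Complex.re_sum, Fin.sum_univ_two]
    have : a * ((a - 1) * z ^ (a - 1 - 1) * κ 0) * κ 0 +
        a * ((a - 1) * z ^ (a - 1 - 1) * κ 1) * κ 1 = 0 := by
      simp only [κ, Matrix.cons_val_zero, Matrix.cons_val_one]
      linear_combination a * (a - 1) * z ^ (a - 1 - 1) * c ^ 2 * Complex.I_sq
    rw [this, Complex.zero_re]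

/-- Outside an open star-shaped set the outward rays stay outside. -/
theorem StarConvex.add_smul_notMem {Ω : Set Pt} {x₀ p : Pt} (hs : StarConvex ℝ x₀ Ω)
    (hp : p ∉ Ω) {s : ℝ} (hs0 : 0 ≤ s) : p + s • (p - x₀) ∉ Ω := by
  intro hmem
  refine hp ?_
  have h1 : (0 : ℝ) < 1 + s := by linarith
  have := hs hmem (a := s / (1 + s)) (b := 1 / (1 + s)) (by positivity) (by positivity)
    (by field_simp; ring)
  convert this using 1
  have e : p + s • (p - x₀) = (1 + s) • p - s • x₀ := by module
  rw [e, smul_sub, smul_smul, smul_smul, div_mul_cancel₀ _ h1.ne', one_smul]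
  have : s / (1 + s) = 1 / (1 + s) * s := by ring
  rw [this]
  abel

/-- A rotation placing a star-shaped set in the slit plane as seen from a point outside it. -/
theorem exists_complexCoord_mem_slitPlane {Ω : Set Pt} {x₀ p : Pt} (hs : StarConvex ℝ x₀ Ω)
    (hx₀ : x₀ ∈ Ω) (hp : p ∉ Ω) :
    ∃ c : ℂ, ‖c‖ = 1 ∧ ∀ x ∈ Ω, complexCoord c p x ∈ Complex.slitPlane := by
  set n : ℂ := ((p 0 - x₀ 0 : ℝ) : ℂ) + ((p 1 - x₀ 1 : ℝ) : ℂ) * Complex.I with hn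
  have hnn : ‖n‖ = ‖p - x₀‖ := by
    have := norm_complexCoord (c := 1) (by simp) x₀ p
    simpa [complexCoord, hn] using this
  have hpos : 0 < ‖n‖ := by
    rw [hnn, norm_pos_iff, sub_ne_zero]
    rintro rfl
    exact hp hx₀
  have hn0 : n ≠ 0 := norm_pos_iff.1 hpos
  refine ⟨-((‖n‖ : ℂ) / n), ?_, fun x hx => ?_⟩
  · rw [norm_neg, norm_div, Complex.norm_real, norm_norm, div_self hpos.ne']
  · by_contra hslit
    rw [Complex.mem_slitPlane_iff_not_le_zero, not_not, Complex.le_def] at hslit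
    obtain ⟨hre, him⟩ := hslit
    set w := complexCoord (-((‖n‖ : ℂ) / n)) p x with hw
    have hwr : w = (w.re : ℂ) := Complex.ext (by simp) (by simpa using him)
    have hre' : w.re ≤ 0 := by simpa using hre
    have hx' : ((x 0 - p 0 : ℝ) : ℂ) + ((x 1 - p 1 : ℝ) : ℂ) * Complex.I =
        ((-w.re / ‖n‖ : ℝ) : ℂ) * n := by
      have hne : (‖n‖ : ℂ) ≠ 0 := by exact_mod_cast hpos.ne'
      have h1 : w = -((‖n‖ : ℂ) / n) *
        (((x 0 - p 0 : ℝ) : ℂ) + ((x 1 - p 1 : ℝ) : ℂ) * Complex.I) := rfl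
      rw [hwr] at h1
      push_cast at h1 ⊢
      field_simp at h1 ⊢
      linear_combination h1
    have h0 := congrArg Complex.re hx'
    have h1 := congrArg Complex.im hx'
    simp [hn] at h0 h1
    refine hs.add_smul_notMem hp (s := -w.re / ‖n‖) (div_nonneg (by linarith) hpos.le) ?_
    convert hx using 1
    ext i
    fin_cases i
    · simp [hn]; linarith
    · simp [hn]; linarith

/-- Boundary barrier estimate, uniform in the scale `ε`. -/
theorem exists_boundary_estimate {δ C : ℝ} (hδ : 0 < δ) (hC : 0 < C) :
    ∃ μ > 0, ∀ (Ω : Set Pt) (x₀ p : Pt) (ε : ℝ) (f : Pt → ℝ), IsOpen Ω → StarConvex ℝ x₀ Ω →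
      x₀ ∈ Ω → p ∉ Ω → 0 < ε → ContinuousOn f (closure Ω) →
      (∀ x ∈ Ω, ∃ L, |L| ≤ C / ε ^ 2 ∧ HasLineLaplacian f L x) → (∀ x ∈ closure Ω, f x ≤ C) →
      (∀ x ∈ frontier Ω, dist x p < ε → f x ≤ δ) →
      ∀ x ∈ Ω, dist x p < μ * ε → f x ≤ 3 * δ := by
  obtain ⟨t, ht0, ht1, htC⟩ : ∃ t : ℝ, 0 < t ∧ t < 1 ∧ C * t ^ 2 ≤ δ := by
    have h1 : Tendsto (fun t : ℝ => C * t ^ 2) (𝓝[>] 0) (𝓝 0) := by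
      have : Continuous fun t : ℝ => C * t ^ 2 := by fun_prop
      have h := this.tendsto 0
      simp only [ne_eq, OfNat.ofNat_ne_zero, not_false_eq_true, zero_pow, mul_zero] at h
      exact h.mono_left nhdsWithin_le_nhds
    have h2 := h1.eventually_lt_const hδ
    have h3 : ∀ᶠ t : ℝ in 𝓝[>] 0, t ∈ Set.Ioo (0 : ℝ) 1 := Ioo_mem_nhdsGT one_pos
    obtain ⟨t, h4, h5⟩ := (h2.and h3).exists
    exact ⟨t, h5.1, h5.2, h4.le⟩
  obtain ⟨μ, hμ0, hμt, hμ⟩ : ∃ μ : ℝ, 0 < μ ∧ μ < t ∧ 2 * C * (μ / t) ^ (1 / 3 : ℝ) ≤ δ := by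
    have h1 : Tendsto (fun μ : ℝ => 2 * C * (μ / t) ^ (1 / 3 : ℝ)) (𝓝[>] 0) (𝓝 0) := by
      have : Continuous fun μ : ℝ => 2 * C * (μ / t) ^ (1 / 3 : ℝ) :=
        continuous_const.mul ((continuous_id.div_const t).rpow_const
          fun _ => Or.inr (by norm_num))
      have h := this.tendsto 0
      rw [zero_div, Real.zero_rpow (by norm_num), mul_zero] at h
      exact h.mono_left nhdsWithin_le_nhds
    have h2 := h1.eventually_lt_const hδ
    have h3 : ∀ᶠ μ : ℝ in 𝓝[>] 0, μ ∈ Set.Ioo (0 : ℝ) t := Ioo_mem_nhdsGT ht0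
    obtain ⟨μ, h4, h5⟩ := (h2.and h3).exists
    exact ⟨μ, h5.1, h5.2, h4.le⟩
  refine ⟨μ, hμ0, fun Ω x₀ p ε f hΩ hs hx₀ hp hε hfc hfL hfC hfb x hx hxp => ?_⟩
  obtain ⟨c, hc, hslit⟩ := exists_complexCoord_mem_slitPlane hs hx₀ hp
  set B : Pt → ℝ := fun y => cbrtRe (complexCoord c p y) with hB
  have hBc : Continuous B := continuous_cbrtRe.comp (continuous_complexCoord c p)
  have hB0 : ∀ y, 0 ≤ B y := fun y => cbrtRe_nonneg _
  have htε : 0 < t * ε := by positivity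
  set q : ℝ := (t * ε) ^ (1 / 3 : ℝ) with hq
  have hqpos : 0 < q := by positivity
  set K : ℝ := 2 * C / q with hK
  have hKpos : 0 < K := by positivity
  set D : Set Pt := Metric.ball p (t * ε) ∩ Ω with hDdef
  have hDo : IsOpen D := Metric.isOpen_ball.inter hΩ
  have hcl : closure D ⊆ Metric.closedBall p (t * ε) ∩ closure Ω :=
    closure_minimal (Set.inter_subset_inter Metric.ball_subset_closedBall subset_closure)
      (Metric.isClosed_closedBall.inter isClosed_closure)
  let F : Pt → ℝ := fun y => f y + (C / ε ^ 2 * (y 0 - p 0) ^ 2 + C / ε ^ 2 * (y 1 - p 1) ^ 2) +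
    -K * B y + (-δ - C * t ^ 2)
  have hFeq : ∀ y, F y = f y + C / ε ^ 2 * ‖y - p‖ ^ 2 - K * B y - δ - C * t ^ 2 := by
    intro y; simp only [F, norm_sub_sq_eq_coord]; ring
  have hFc : ContinuousOn F (closure D) := by
    refine (((hfc.mono fun y hy => (hcl hy).2).add (by fun_prop)).add ?_).add continuousOn_const
    exact (continuous_const.mul hBc).continuousOn
  have hFL : ∀ y ∈ D, ∃ L > 0, HasLineLaplacian F L y := by
    intro y hy
    obtain ⟨L1, hL1, h1⟩ := hfL y hy.2
    refine ⟨_, ?_, ((h1.add (((HasLineLaplacian.sq_coord_sub 0 (p 0) y).const_mul _).add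
      ((HasLineLaplacian.sq_coord_sub 1 (p 1) y).const_mul _))).add
      ((hasLineLaplacian_cbrtRe_comp (hslit y hy.2)).const_mul _)).add
      (HasLineLaplacian.const _ y)⟩
    have e1 := (abs_le.1 hL1).1
    have e2 : 0 < C / ε ^ 2 := by positivity
    linarith
  have hquad : ∀ y ∈ closure D, C / ε ^ 2 * ‖y - p‖ ^ 2 ≤ C * t ^ 2 := by
    intro y hy
    have h1 : ‖y - p‖ ≤ t * ε := mem_closedBall_iff_norm.1 (hcl hy).1
    calc C / ε ^ 2 * ‖y - p‖ ^ 2 ≤ C / ε ^ 2 * (t * ε) ^ 2 := by gcongr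
      _ = C * t ^ 2 := by field_simp
  have hFb : ∀ y ∈ closure D, y ∉ D → F y ≤ 0 := by
    intro y hy hyD
    have h1 : ‖y - p‖ ≤ t * ε := mem_closedBall_iff_norm.1 (hcl hy).1
    have h2 := hquad y hy
    rw [hFeq]
    by_cases hlt : ‖y - p‖ < t * ε
    · have hyΩ : y ∉ Ω := fun h => hyD ⟨mem_ball_iff_norm.2 hlt, h⟩
      have hfr : y ∈ frontier Ω := by
        rw [hΩ.frontier_eq]; exact ⟨(hcl hy).2, hyΩ⟩
      have h3 : f y ≤ δ := hfb y hfr (by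
        rw [dist_eq_norm]; exact hlt.trans (by nlinarith))
      have h4 : 0 ≤ K * B y := mul_nonneg hKpos.le (hB0 y)
      linarith
    · have heq : ‖y - p‖ = t * ε := le_antisymm h1 (not_lt.1 hlt)
      have h3 := hfC y (hcl hy).2
      have h4 : 1 / 2 * q ≤ B y := by
        have := le_cbrtRe (complexCoord c p y)
        rwa [norm_complexCoord hc, heq] at this
      have h5 : C ≤ K * B y := by
        calc C = K * (1 / 2 * q) := by rw [hK]; field_simp
          _ ≤ K * B y := by gcongr
      linarith
  have hxn : ‖x - p‖ < μ * ε := by rwa [dist_eq_norm] at hxp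
  have hxD : x ∈ D := ⟨mem_ball_iff_norm.2 (hxn.trans (by gcongr)), hx⟩
  have hmain := nonpos_of_hasLineLaplacian_pos
    (Metric.isBounded_ball.subset Set.inter_subset_left) hDo hFc hFb hFL hxD
  rw [hFeq] at hmain
  have h6 : B x ≤ (μ * ε) ^ (1 / 3 : ℝ) := by
    refine (cbrtRe_le _).trans ?_
    rw [norm_complexCoord hc]
    exact Real.rpow_le_rpow (norm_nonneg _) hxn.le (by norm_num)
  have h7 : K * B x ≤ δ := by
    refine le_trans ?_ hμ
    calc K * B x ≤ K * (μ * ε) ^ (1 / 3 : ℝ) := by gcongr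
      _ = 2 * C * (μ / t) ^ (1 / 3 : ℝ) := by
        have : μ / t = (μ * ε) / (t * ε) := by field_simp
        rw [this, Real.div_rpow (by positivity) htε.le, hK, hq]
        ring
  have h8 : 0 ≤ C / ε ^ 2 * ‖x - p‖ ^ 2 := by positivity
  linarith

/-- A bounded continuous function is integrable on a bounded open set. -/
theorem integrableOn_of_continuousOn_of_bound {Ω : Set Pt} (hΩo : IsOpen Ω)
    (hΩb : Bornology.IsBounded Ω) {g : Pt → ℝ} (hg : ContinuousOn g Ω) {M : ℝ}
    (hM : ∀ x ∈ Ω, |g x| ≤ M) : IntegrableOn g Ω := by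
  have : IsFiniteMeasure (volume.restrict Ω) := isFiniteMeasure_restrict.2 hΩb.measure_lt_top.ne
  refine Integrable.of_bound (hg.aestronglyMeasurable hΩo.measurableSet) M ?_
  exact (ae_restrict_iff' hΩo.measurableSet).2 (.of_forall fun x hx => hM x hx)

theorem sub_le_of_ball_subset {C E r ρ : ℝ} (hr : 0 < r) (hC : 0 ≤ C) (hE : 0 < E) {f : Pt → ℝ}
    {x z : Pt} {τ : ℝ} (i : Fin 2) (hc : ContinuousOn f (Metric.ball x r))
    (hL : ∀ y ∈ Metric.ball x r, ∃ L, |L| ≤ E ∧ HasLineLaplacian f L y)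
    (hb : ∀ y ∈ Metric.ball x r, |f y| ≤ C) (hρ : ρ ≤ r / 8) (hz : ‖z - x‖ ≤ ρ)
    (hτ : |τ| ≤ ρ) :
    |f (z + τ • unitVec i) - f z| ≤ ρ / 2 * (20 * C / r + 2 * E * r) := by
  set d := r / 2 with hd
  have hnorm1 : ‖unitVec i‖ = 1 := by simp
  set y := z + (τ / 2) • unitVec i with hy
  have hyx : ‖y - x‖ ≤ ρ + ρ / 2 := by
    have : y - x = (z - x) + (τ / 2) • unitVec i := by rw [hy]; abel
    rw [this]
    refine (norm_add_le _ _).trans (add_le_add hz ?_)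
    rw [norm_smul, hnorm1, Real.norm_eq_abs, abs_div, abs_two]
    linarith
  have hsub : Metric.closedBall y d ⊆ Metric.ball x r := by
    refine Metric.closedBall_subset_ball' ?_
    rw [dist_eq_norm]
    linarith
  have hsub' : Metric.ball y d ⊆ Metric.ball x r := Metric.ball_subset_closedBall.trans hsub
  have key : ∀ g : Pt → ℝ, ContinuousOn g (Metric.ball x r) →
      (∀ y ∈ Metric.ball x r, ∃ L, |L| ≤ E ∧ HasLineLaplacian g L y) →
      (∀ y ∈ Metric.ball x r, |g y| ≤ C) →
      g (y + (|τ| / 2) • unitVec i) - g (y - (|τ| / 2) • unitVec i) ≤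
        ρ / 2 * (20 * C / r + 2 * E * r) := by
    intro g hgc hgL hgb
    have h1 := sub_le_of_abs_laplacian_le (t := |τ| / 2) (d := d) (by positivity) hC hE i
      (hgc.mono hsub) (fun w hw => hgL w (hsub' hw)) (fun w hw => hgb w (hsub hw))
      (by positivity) (by rw [hd]; linarith)
    refine h1.trans ?_
    have h2 : 10 * C / d + 4 * E * d = 20 * C / r + 2 * E * r := by rw [hd]; field_simp; ring
    rw [h2]
    gcongr
  have k1 := key f hc hL hb
  have k2 := key (fun w => -f w) hc.neg
    (fun w hw => by
      obtain ⟨L, h1, h2⟩ := hL w hw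
      exact ⟨-L, by rwa [abs_neg], h2.neg⟩)
    (fun w hw => by rw [abs_neg]; exact hb w hw)
  rw [abs_le]
  rcases abs_cases τ with ⟨h, -⟩ | ⟨h, -⟩
  · have e1 : y + (|τ| / 2) • unitVec i = z + τ • unitVec i := by rw [h, hy]; module
    have e2 : y - (|τ| / 2) • unitVec i = z := by rw [h, hy]; module
    simp only [e1, e2] at k1 k2
    constructor <;> linarith
  · have e1 : y + (|τ| / 2) • unitVec i = z := by rw [h, hy]; module
    have e2 : y - (|τ| / 2) • unitVec i = z + τ • unitVec i := by rw [h, hy]; module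
    simp only [e1, e2] at k1 k2
    constructor <;> linarith

/-- Interior modulus of continuity of a bounded function with bounded Laplacian. -/
theorem abs_sub_le_of_ball_subset {C E r ρ : ℝ} (hr : 0 < r) (hC : 0 ≤ C) (hE : 0 < E)
    {f : Pt → ℝ} {x y : Pt} (hc : ContinuousOn f (Metric.ball x r))
    (hL : ∀ y ∈ Metric.ball x r, ∃ L, |L| ≤ E ∧ HasLineLaplacian f L y)
    (hb : ∀ y ∈ Metric.ball x r, |f y| ≤ C) (hρ : ρ ≤ r / 8) (hy : ‖y - x‖ ≤ ρ) :
    |f y - f x| ≤ ρ * (20 * C / r + 2 * E * r) := by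
  have hρ0 : 0 ≤ ρ := (norm_nonneg _).trans hy
  have h0 := (abs_coord_sub_le y x 0).trans hy
  have h1 := (abs_coord_sub_le y x 1).trans hy
  have s1 := sub_le_of_ball_subset (z := x) (τ := y 0 - x 0) hr hC hE 0 hc hL hb hρ
    (by simpa using hρ0) h0
  have s2 := sub_le_of_ball_subset (z := x + (y 0 - x 0) • unitVec 0) (τ := y 1 - x 1)
    hr hC hE 1 hc hL hb hρ (by simpa [norm_smul] using h0) h1
  have e : x + (y 0 - x 0) • unitVec 0 + (y 1 - x 1) • unitVec 1 = y := by
    ext i; fin_cases i <;> simp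
  rw [e] at s2
  calc |f y - f x| ≤ _ := abs_sub_le _ (f (x + (y 0 - x 0) • unitVec 0)) _
    _ ≤ _ := add_le_add s2 s1
    _ = _ := by ring

theorem exists_frontier_dist_lt {Ω : Set Pt} {x : Pt} {r : ℝ} (hx : x ∈ Ω)
    (h : ¬ Metric.ball x r ⊆ Ω) : ∃ p ∈ frontier Ω, dist x p < r := by
  obtain ⟨q, hq, hqΩ⟩ := Set.not_subset.1 h
  have hr : 0 < r := dist_nonneg.trans_lt hq
  have hconn : IsPreconnected (Metric.ball x r) := (convex_ball x r).isPreconnected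
  by_contra! hno
  have hdisj : Disjoint (Metric.ball x r) (frontier Ω) := by
    rw [Set.disjoint_left]
    intro p hp hpf
    exact absurd (hno p hpf) (not_le.2 (by rw [dist_comm]; exact hp))
  have hcov : Metric.ball x r ⊆ interior Ω ∪ (closure Ω)ᶜ := by
    intro p hp
    by_cases h1 : p ∈ closure Ω
    · left
      by_contra h2
      exact Set.disjoint_left.1 hdisj hp ⟨h1, h2⟩
    · exact Or.inr h1
  obtain ⟨w, -, hw1, hw2⟩ := hconn (interior Ω) (closure Ω)ᶜ isOpen_interior
    isClosed_closure.isOpen_compl hcov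
    ⟨x, Metric.mem_ball_self hr, by
      rcases hcov (Metric.mem_ball_self hr) with h | h
      · exact h
      · exact absurd (subset_closure hx) h⟩
    ⟨q, hq, by
      rcases hcov hq with h | h
      · exact absurd (interior_subset h) hqΩ
      · exact h⟩
  exact hw2 (subset_closure (interior_subset hw1))

/-- If a solution deviates from unit length somewhere, its potential energy is of order `ε ^ 2`. -/
theorem exists_le_integral_of_norm_lt {δ : ℝ} (hδ : 0 < δ) (hδ1 : δ < 1) :
    ∃ κ > 0, ∀ (Ω : Set Pt) (x₀ : Pt) (ε : ℝ) (U : Pt → ℂ), IsOpen Ω → Bornology.IsBounded Ω →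
      StarConvex ℝ x₀ Ω → x₀ ∈ Ω → 0 < ε → ContinuousOn U (closure Ω) → ContDiffOn ℝ 2 U Ω →
      (∀ x ∈ closure Ω, ‖U x‖ ≤ 2) → (∀ x ∈ Ω, ‖lap U x‖ ≤ 8 / ε ^ 2) →
      (∀ p ∈ frontier Ω, ‖U p‖ = 1) →
      (∀ p ∈ frontier Ω, ∀ x ∈ frontier Ω, dist x p < ε → dist (U x) (U p) ≤ δ / 6) →
      ∀ x ∈ Ω, ‖U x‖ < 1 - δ → κ * ε ^ 2 ≤ ∫ y in Ω, (1 - ‖U y‖ ^ 2) ^ 2 := by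
  obtain ⟨μ, hμ, hbd⟩ :=
    exists_boundary_estimate (δ := δ / 6) (C := 8) (by positivity) (by norm_num)
  set A : ℝ := 40 / μ + 16 * μ with hA
  have hApos : 0 < A := by positivity
  set s : ℝ := min (μ / 8) (δ / (4 * A)) with hs
  have hspos : 0 < s := by positivity
  have hsA : s * A ≤ δ / 4 := by
    calc s * A ≤ δ / (4 * A) * A := by gcongr; exact min_le_right _ _
      _ = δ / 4 := by field_simp
  set v : ℝ := volume.real (Metric.ball (0 : Pt) 1) with hv
  have hvpos : 0 < v := by
    rw [hv, Measure.real]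
    exact ENNReal.toReal_pos (Metric.measure_ball_pos volume _ one_pos).ne' measure_ball_lt_top.ne
  refine ⟨(δ / 2) ^ 2 * (s ^ 2 * v), by positivity, ?_⟩
  intro Ω x₀ ε U hΩ hΩb hst hx₀ hε hUc hU2 hUb hUL hU1 hUosc x hx hxlt
  have hcd : ∀ y ∈ Ω, ContDiffAt ℝ 2 U y := fun y hy => hU2.contDiffAt (hΩ.mem_nhds hy)
  have hball : Metric.ball x (μ * ε) ⊆ Ω := by
    by_contra hnot
    obtain ⟨p, hp, hxp⟩ := exists_frontier_dist_lt hx hnot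
    have hpΩ : p ∉ Ω := by rw [hΩ.frontier_eq] at hp; exact hp.2
    set c : ℂ := -(starRingEnd ℂ) (U p) with hc
    have hc1 : ‖c‖ = 1 := by rw [hc, norm_neg, RCLike.norm_conj, hU1 p hp]
    have hcU : (starRingEnd ℂ) (U p) * U p = 1 := by
      rw [← Complex.normSq_eq_conj_mul_self, Complex.normSq_eq_norm_sq, hU1 p hp]; simp
    have h := hbd Ω x₀ p ε (fun y => 1 + (c * U y).re) hΩ hst hx₀ hpΩ hε ?_ ?_ ?_ ?_ x hx hxp
    · have h1 : |(c * U x).re| ≤ ‖U x‖ := by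
        refine (Complex.abs_re_le_norm _).trans ?_
        rw [norm_mul, hc1, one_mul]
      have := (abs_le.1 h1).1
      linarith
    · exact continuousOn_const.add
        (Complex.continuous_re.comp_continuousOn (continuousOn_const.mul hUc))
    · intro y hy
      refine ⟨_, ?_, (HasLineLaplacian.const 1 y).add (HasLineLaplacian.of_complex (hcd y hy) c)⟩
      rw [zero_add]
      refine (Complex.abs_re_le_norm _).trans ?_
      rw [norm_mul, hc1, one_mul]
      exact hUL y hy
    · intro y hy
      have h1 : |(c * U y).re| ≤ 2 := by
        refine (Complex.abs_re_le_norm _).trans ?_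
        rw [norm_mul, hc1, one_mul]
        exact hUb y hy
      have := (abs_le.1 h1).2
      linarith
    · intro y hy hyp
      have h2 : 1 + (c * U y).re = (c * (U y - U p)).re := by
        rw [mul_sub, Complex.sub_re, hc]
        simp only [neg_mul, hcU]
        simp; ring
      simp only [h2]
      refine (le_abs_self _).trans ((Complex.abs_re_le_norm _).trans ?_)
      rw [norm_mul, hc1, one_mul, ← dist_eq_norm]
      exact hUosc p hp y hy hyp
  have hr : 0 < μ * ε := by positivity
  have hρ : s * ε ≤ μ * ε / 8 := by
    have : s ≤ μ / 8 := min_le_left _ _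
    calc s * ε ≤ μ / 8 * ε := by gcongr
      _ = _ := by ring
  have hosc : ∀ c : ℂ, ‖c‖ = 1 → ∀ y, ‖y - x‖ ≤ s * ε → |(c * U y).re - (c * U x).re| ≤ δ / 4 := by
    intro c hc y hy
    refine (abs_sub_le_of_ball_subset (f := fun y => (c * U y).re) (C := 2) (E := 8 / ε ^ 2) hr
      (by norm_num) (by positivity) ?_ ?_ ?_ hρ hy).trans ?_
    · exact Complex.continuous_re.comp_continuousOn
        (continuousOn_const.mul (hUc.mono (hball.trans subset_closure)))
    · intro w hw
      refine ⟨_, ?_, HasLineLaplacian.of_complex (hcd w (hball hw)) c⟩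
      refine (Complex.abs_re_le_norm _).trans ?_
      rw [norm_mul, hc, one_mul]
      exact hUL w (hball hw)
    · intro w hw
      refine (Complex.abs_re_le_norm _).trans ?_
      rw [norm_mul, hc, one_mul]
      exact hUb w (subset_closure (hball hw))
    · refine le_trans (le_of_eq ?_) hsA
      rw [hA]; field_simp; ring
  have hsmall : ∀ y ∈ Metric.ball x (s * ε), (δ / 2) ^ 2 ≤ (1 - ‖U y‖ ^ 2) ^ 2 := by
    intro y hy
    have hyn : ‖y - x‖ ≤ s * ε := (mem_ball_iff_norm.1 hy).le
    have h1 := hosc 1 (by simp) y hyn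
    have h2 := hosc (-Complex.I) (by simp) y hyn
    have h3 : ‖U y - U x‖ ≤ δ / 2 := by
      refine (Complex.norm_le_abs_re_add_abs_im _).trans ?_
      simp at h1 h2 ⊢
      linarith
    have h4 : ‖U y‖ ≤ 1 - δ / 2 := by
      have : ‖U y‖ ≤ ‖U y - U x‖ + ‖U x‖ := by simpa using norm_add_le (U y - U x) (U x)
      linarith
    have h5 := norm_nonneg (U y)
    have h6 : δ / 2 ≤ 1 - ‖U y‖ ^ 2 := by nlinarith
    gcongr
  have hsub : Metric.ball x (s * ε) ⊆ Ω :=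
    (Metric.ball_subset_ball (by linarith)).trans hball
  have hint : IntegrableOn (fun y => (1 - ‖U y‖ ^ 2) ^ 2) Ω := by
    refine integrableOn_of_continuousOn_of_bound hΩ hΩb (M := 9) ?_ ?_
    · have := hUc.mono (subset_closure (s := Ω))
      fun_prop
    · intro y hy
      have h1 := hUb y (subset_closure hy)
      have h2 := norm_nonneg (U y)
      rw [abs_of_nonneg (sq_nonneg _)]
      have h3 : ‖U y‖ ^ 2 ≤ 4 := by nlinarith
      nlinarith [sq_nonneg ‖U y‖]
  calc (δ / 2) ^ 2 * (s ^ 2 * v) * ε ^ 2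
      = (δ / 2) ^ 2 * volume.real (Metric.ball x (s * ε)) := by
        rw [measureReal_def, Measure.addHaar_ball_of_pos volume x (by positivity : 0 < s * ε),
          ENNReal.toReal_mul, ENNReal.toReal_ofReal (by positivity), ← measureReal_def,
          finrank_euclideanSpace, Fintype.card_fin]
        ring
    _ ≤ ∫ y in Metric.ball x (s * ε), (1 - ‖U y‖ ^ 2) ^ 2 :=
        setIntegral_ge_of_const_le_real measurableSet_ball measure_ball_lt_top.ne hsmall
          (hint.mono_set hsub)
    _ ≤ ∫ y in Ω, (1 - ‖U y‖ ^ 2) ^ 2 :=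
        setIntegral_mono_set hint (.of_forall fun y => sq_nonneg _) hsub.eventuallyLE

/-- A function vanishes to first order at almost every one of its zeros. -/
theorem ae_ne_zero_or_pdR_eq_zero {Ω : Set Pt} (hΩo : IsOpen Ω) {f : Pt → ℝ}
    (hf : DifferentiableOn ℝ f Ω) (i : Fin 2) :
    ∀ᵐ x, x ∈ Ω → f x ≠ 0 ∨ pdR f x i = 0 := by
  set S : Set Pt := (Ω \ (Ω ∩ f ⁻¹' {0}ᶜ)) ∩ (fun x => pdR f x i) ⁻¹' {0}ᶜ with hS
  have hSm : MeasurableSet S := by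
    refine (hΩo.measurableSet.diff
      (hf.continuousOn.isOpen_inter_preimage hΩo isOpen_compl_singleton).measurableSet).inter ?_
    exact (measurable_fderiv_apply_const ℝ f (unitVec i)) (measurableSet_singleton 0).compl
  have hae : ∀ᵐ x, x ∈ Sᶜ := by
    refine ae_mem_of_ae_add_linearMap_mem (LinearMap.toSpanSingleton ℝ Pt (unitVec i))
      volume volume hSm.compl fun y => ?_
    set A : Set ℝ := {t | y + t • unitVec i ∈ S} with hA
    have hdisc : DiscreteTopology A := by
      rw [discreteTopology_subtype_iff]
      intro t ht
      obtain ⟨⟨htΩ, htf⟩, htd⟩ := ht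
      have hd : HasDerivAt (fun s : ℝ => f (y + s • unitVec i))
          (pdR f (y + t • unitVec i) i) t := by
        have h1 : HasDerivAt (fun s : ℝ => y + s • unitVec i) (unitVec i) t := by
          simpa using ((hasDerivAt_id t).smul_const (unitVec i)).const_add y
        exact ((hf.differentiableAt (hΩo.mem_nhds htΩ)).hasFDerivAt).comp_hasDerivAt t h1
      have hne := hd.eventually_ne (c := 0) htd
      rw [Filter.inf_principal_eq_bot]
      filter_upwards [hne] with s hs hsA
      obtain ⟨⟨hsΩ, hsf⟩, -⟩ := hsA
      exact hsf ⟨hsΩ, hs⟩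
    have hAc : A.Countable := Set.countable_coe_iff.1
      (countable_of_Lindelof_of_discrete (X := A))
    filter_upwards [hAc.ae_notMem volume] with t ht
    exact ht
  filter_upwards [hae] with x hx hxΩ
  by_contra! h
  exact hx ⟨⟨hxΩ, fun h' => h'.2 h.1⟩, h.2⟩

/-- A smooth truncation: it vanishes near zero and is the identity away from zero. -/
theorem exists_truncation : ∃ T : ℝ → ℝ, ContDiff ℝ 1 T ∧ (∀ s, |s| ≤ 1 → T s = 0) ∧
    (∀ s, |T s| ≤ |s|) ∧ ∀ s, 2 ≤ |s| → T s = s := by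
  refine ⟨fun s => s * Real.smoothTransition (s ^ 2 - 1), ?_, ?_, ?_, ?_⟩
  · have : ContDiff ℝ 1 Real.smoothTransition := Real.smoothTransition.contDiff
    fun_prop
  · intro s hs
    have h : s ^ 2 - 1 ≤ 0 := by nlinarith [sq_abs s, abs_nonneg s]
    simp [Real.smoothTransition.zero_of_nonpos h]
  · intro s
    rw [abs_mul, abs_of_nonneg (Real.smoothTransition.nonneg _)]
    exact mul_le_of_le_one_right (abs_nonneg s) (Real.smoothTransition.le_one _)
  · intro s hs
    have h : 1 ≤ s ^ 2 - 1 := by nlinarith [sq_abs s, abs_nonneg s]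
    simp [Real.smoothTransition.one_of_one_le h]

theorem integrable_of_continuousOn_of_eq_zero {Ω K : Set Pt} (hK : IsCompact K) (hKΩ : K ⊆ Ω)
    {h : Pt → ℝ} (hc : ContinuousOn h Ω) (h0 : ∀ x ∉ K, h x = 0) : Integrable h := by
  rw [← integrableOn_iff_integrable_of_support_subset (s := K)]
  · exact (hc.mono hKΩ).integrableOn_compact hK
  · intro x hx
    by_contra hxK
    exact hx (h0 x hxK)

theorem continuousOn_pdR {Ω : Set Pt} (hΩo : IsOpen Ω) {f : Pt → ℝ} (hf : ContDiffOn ℝ 1 f Ω)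
    (i : Fin 2) : ContinuousOn (fun x => pdR f x i) Ω :=
  (hf.continuousOn_fderiv_of_isOpen hΩo le_rfl).clm_apply continuousOn_const

/-- Integration by parts against a function supported in a compact subset of the domain. -/
theorem integral_mul_pdR_eq_neg_of_eq_zero {Ω K : Set Pt} (hΩo : IsOpen Ω) (hK : IsCompact K)
    (hKΩ : K ⊆ Ω) {g X : Pt → ℝ} (hg : ContDiffOn ℝ 1 g Ω) (hX : ContDiffOn ℝ 1 X Ω)
    (hg0 : ∀ x ∈ Ω, x ∉ K → g x = 0) (i : Fin 2) :
    IntegrableOn (fun x => X x * pdR g x i) Ω ∧ IntegrableOn (fun x => pdR X x i * g x) Ω ∧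
    ∫ x in Ω, X x * pdR g x i = -∫ x in Ω, pdR X x i * g x := by
  set G : Pt → ℝ := Ω.indicator g with hG
  have hGK : ∀ x ∉ K, G x = 0 := by
    intro x hx
    by_cases hxΩ : x ∈ Ω
    · rw [hG, Set.indicator_of_mem hxΩ, hg0 x hxΩ hx]
    · rw [hG, Set.indicator_of_notMem hxΩ]
  have hGg : ∀ x ∈ Ω, G =ᶠ[𝓝 x] g := fun x hx => by
    filter_upwards [hΩo.mem_nhds hx] with y hy
    rw [hG, Set.indicator_of_mem hy]
  have hpdG : ∀ x ∈ Ω, pdR G x i = pdR g x i := fun x hx => by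
    rw [pdR, pdR, (hGg x hx).fderiv_eq]
  have hGs : tsupport G ⊆ K := closure_minimal
    (fun x hx => by by_contra h; exact hx (hGK x h)) hK.isClosed
  have hpdGK : ∀ x ∉ K, pdR G x i = 0 := by
    intro x hx
    have : G =ᶠ[𝓝 x] fun _ => 0 := by
      filter_upwards [hK.isClosed.isOpen_compl.mem_nhds hx] with y hy using hGK y hy
    rw [pdR, this.fderiv_eq]; simp
  have hGd : Differentiable ℝ G := by
    intro x
    by_cases hx : x ∈ Ω
    · exact ((hg.differentiableOn one_ne_zero).differentiableAt
        (hΩo.mem_nhds hx)).congr_of_eventuallyEq (hGg x hx)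
    · have : G =ᶠ[𝓝 x] fun _ => 0 := by
        filter_upwards [hK.isClosed.isOpen_compl.mem_nhds fun h => hx (hKΩ h)] with y hy
          using hGK y hy
      exact (differentiableAt_const 0).congr_of_eventuallyEq this
  have hGc : ContinuousOn G Ω := hGd.continuous.continuousOn
  have hpdGc : ContinuousOn (fun x => pdR G x i) Ω :=
    (continuousOn_pdR hΩo hg i).congr hpdG
  have i1 : Integrable (fun x => pdR X x i * G x) :=
    integrable_of_continuousOn_of_eq_zero hK hKΩ ((continuousOn_pdR hΩo hX i).mul hGc)
      fun x hx => by rw [hGK x hx, mul_zero]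
  have i2 : Integrable (fun x => X x * pdR G x i) :=
    integrable_of_continuousOn_of_eq_zero hK hKΩ (hX.continuousOn.mul hpdGc)
      fun x hx => by rw [hpdGK x hx, mul_zero]
  have i3 : Integrable (fun x => X x * G x) :=
    integrable_of_continuousOn_of_eq_zero hK hKΩ (hX.continuousOn.mul hGc)
      fun x hx => by rw [hGK x hx, mul_zero]
  have key := integral_mul_fderiv_eq_neg_fderiv_mul_of_integrable (μ := (volume : Measure Pt))
    (f := X) (g := G) (v := unitVec i) i1 i2 i3
    (fun x hx => (hX.differentiableOn one_ne_zero).differentiableAt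
      (hΩo.mem_nhds (hKΩ (hGs hx)))) (fun x _ => hGd x)
  have e1 : Set.EqOn (fun x => X x * pdR G x i) (fun x => X x * pdR g x i) Ω :=
    fun x hx => by simp only [hpdG x hx]
  have e2 : Set.EqOn (fun x => pdR X x i * G x) (fun x => pdR X x i * g x) Ω :=
    fun x hx => by simp only [hG, Set.indicator_of_mem hx]
  refine ⟨i2.integrableOn.congr_fun e1 hΩo.measurableSet,
    i1.integrableOn.congr_fun e2 hΩo.measurableSet, ?_⟩
  rw [← setIntegral_congr_fun hΩo.measurableSet e1, ← setIntegral_congr_fun hΩo.measurableSet e2,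
    setIntegral_eq_integral_of_forall_compl_eq_zero
      (fun x hx => by rw [hpdGK x fun h => hx (hKΩ h), mul_zero]),
    setIntegral_eq_integral_of_forall_compl_eq_zero
      (fun x hx => by rw [hGK x fun h => hx (hKΩ h), mul_zero])]
  exact key

/-- The divergence theorem for a vector field multiplied by a function which vanishes on the
boundary; no regularity of the boundary is needed. -/
theorem integral_sum_mul_pdR_eq_neg {Ω : Set Pt} (hΩo : IsOpen Ω) (hΩb : Bornology.IsBounded Ω)
    {f : Pt → ℝ} (hfc : ContinuousOn f (closure Ω)) (hf0 : ∀ x ∈ frontier Ω, f x = 0)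
    (hf : ContDiffOn ℝ 1 f Ω) {X : Fin 2 → Pt → ℝ} (hX : ∀ i, ContDiffOn ℝ 1 (X i) Ω)
    (h1 : IntegrableOn (fun x => ∑ i, X i x * pdR f x i) Ω)
    (h2 : IntegrableOn (fun x => (∑ i, pdR (X i) x i) * f x) Ω) :
    ∫ x in Ω, ∑ i, X i x * pdR f x i = -∫ x in Ω, (∑ i, pdR (X i) x i) * f x := by
  obtain ⟨T, hT, hT0, hTle, hTid⟩ := exists_truncation
  have hTc : Continuous (deriv T) := hT.continuous_deriv le_rfl
  have hTd : Differentiable ℝ T := hT.differentiable one_ne_zero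
  have hT'id : ∀ s, 2 < |s| → deriv T s = 1 := by
    intro s hs
    have : T =ᶠ[𝓝 s] id := by
      filter_upwards [(isOpen_lt continuous_const continuous_abs).mem_nhds hs] with t ht
        using hTid t (le_of_lt ht)
    rw [this.deriv_eq]; simp
  have hT'0 : deriv T 0 = 0 := by
    have : T =ᶠ[𝓝 0] fun _ => 0 := by
      filter_upwards [(isOpen_lt continuous_abs continuous_const).mem_nhds
        (show |(0 : ℝ)| < 1 by simp)] with t ht using hT0 t (le_of_lt ht)
    rw [this.deriv_eq]; simp
  obtain ⟨B, hB⟩ := (isCompact_Icc (a := (-2 : ℝ)) (b := 2)).exists_bound_of_continuousOn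
    hTc.continuousOn
  have hT'b : ∀ s, |deriv T s| ≤ max B 1 := by
    intro s
    by_cases hs : |s| ≤ 2
    · exact (hB s (abs_le.1 hs)).trans (le_max_left _ _)
    · rw [hT'id s (not_le.1 hs), abs_one]; exact le_max_right _ _
  set g : ℕ → Pt → ℝ := fun n x => T (f x * (n + 1)) / (n + 1) with hg
  have hn0 : ∀ n : ℕ, (0 : ℝ) < n + 1 := fun n => by positivity
  have hgC : ∀ n, ContDiffOn ℝ 1 (g n) Ω := fun n =>
    (hT.comp_contDiffOn (hf.mul contDiffOn_const)).div_const _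
  have hgpd : ∀ n, ∀ x ∈ Ω, ∀ i, pdR (g n) x i = deriv T (f x * (n + 1)) * pdR f x i := by
    intro n x hx i
    have hfx : HasFDerivAt f (fderiv ℝ f x) x :=
      ((hf.differentiableOn one_ne_zero).differentiableAt (hΩo.mem_nhds hx)).hasFDerivAt
    have h := ((hTd (f x * (n + 1))).hasDerivAt.comp_hasFDerivAt x
      (hfx.mul_const ((n : ℝ) + 1))).mul_const ((n : ℝ) + 1)⁻¹
    have e : g n = fun y => (T ∘ fun y => f y * ((n : ℝ) + 1)) y * ((n : ℝ) + 1)⁻¹ := by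
      ext y; simp [hg, div_eq_mul_inv]
    rw [pdR, e, h.fderiv]
    have := (hn0 n).ne'
    simp [pdR]; field_simp
  have hK : ∀ n : ℕ, IsCompact (closure Ω ∩ f ⁻¹' {s | 1 ≤ |s * (n + 1)|}) := fun n =>
    hΩb.isCompact_closure.of_isClosed_subset
      (hfc.preimage_isClosed_of_isClosed isClosed_closure
        (isClosed_le continuous_const (by fun_prop))) Set.inter_subset_left
  have hKΩ : ∀ n : ℕ, closure Ω ∩ f ⁻¹' {s | 1 ≤ |s * (n + 1)|} ⊆ Ω := by
    rintro n x ⟨hx, hfx⟩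
    by_contra hxΩ
    have := hf0 x (by rw [hΩo.frontier_eq]; exact ⟨hx, hxΩ⟩)
    simp only [Set.mem_preimage, Set.mem_ofPred_eq, this, zero_mul, abs_zero] at hfx
    linarith
  have hparts := fun n i => integral_mul_pdR_eq_neg_of_eq_zero hΩo (hK n) (hKΩ n) (hgC n) (hX i)
    (fun x hx hxK => by
      have : ¬ 1 ≤ |f x * (n + 1)| := fun h => hxK ⟨subset_closure hx, h⟩
      simp only [hg, hT0 _ (not_le.1 this).le, zero_div]) i
  have heq : ∀ n, ∫ x in Ω, ∑ i, X i x * pdR (g n) x i =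
      -∫ x in Ω, (∑ i, pdR (X i) x i) * g n x := by
    intro n
    simp_rw [Finset.sum_mul]
    rw [integral_finsetSum _ fun i _ => (hparts n i).1,
      integral_finsetSum _ fun i _ => (hparts n i).2.1, ← Finset.sum_neg_distrib]
    exact Finset.sum_congr rfl fun i _ => (hparts n i).2.2
  have hlarge : ∀ s : ℝ, s ≠ 0 → ∀ᶠ n : ℕ in atTop, 2 < |s * (n + 1)| := by
    intro s hs
    obtain ⟨N, hN⟩ := exists_nat_gt (2 / |s|)
    filter_upwards [eventually_ge_atTop N] with n hn
    have h1 : (N : ℝ) ≤ n := by exact_mod_cast hn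
    rw [abs_mul, abs_of_pos (hn0 n)]
    rw [div_lt_iff₀ (abs_pos.2 hs)] at hN
    nlinarith [abs_pos.2 hs]
  have lim1 : Tendsto (fun n => ∫ x in Ω, ∑ i, X i x * pdR (g n) x i) atTop
      (𝓝 (∫ x in Ω, ∑ i, X i x * pdR f x i)) := by
    refine tendsto_integral_of_dominated_convergence
      (fun x => max B 1 * |∑ i, X i x * pdR f x i|) ?_ (h1.abs.const_mul _) ?_ ?_
    · exact fun n => (integrable_finsetSum _ fun i _ => (hparts n i).1).aestronglyMeasurable
    · intro n
      refine (ae_restrict_iff' hΩo.measurableSet).2 (.of_forall fun x hx => ?_)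
      have : ∑ i, X i x * pdR (g n) x i =
          deriv T (f x * (n + 1)) * ∑ i, X i x * pdR f x i := by
        rw [Finset.mul_sum]
        exact Finset.sum_congr rfl fun i _ => by rw [hgpd n x hx i]; ring
      rw [this, Real.norm_eq_abs, abs_mul]
      exact mul_le_mul_of_nonneg_right (hT'b _) (abs_nonneg _)
    · refine (ae_restrict_iff' hΩo.measurableSet).2 ?_
      filter_upwards [ae_ne_zero_or_pdR_eq_zero hΩo (hf.differentiableOn one_ne_zero) 0,
        ae_ne_zero_or_pdR_eq_zero hΩo (hf.differentiableOn one_ne_zero) 1] with x hx0 hx1 hx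
      refine tendsto_finsetSum _ fun i _ => tendsto_const_nhds.mul ?_
      have hxi : f x ≠ 0 ∨ pdR f x i = 0 := by
        fin_cases i
        · exact hx0 hx
        · exact hx1 hx
      simp only [hgpd _ x hx]
      rcases hxi with h | h
      · refine tendsto_const_nhds.congr' ?_
        filter_upwards [hlarge _ h] with n hn
        rw [hT'id _ hn, one_mul]
      · simp [h]
  have lim2 : Tendsto (fun n => ∫ x in Ω, (∑ i, pdR (X i) x i) * g n x) atTop
      (𝓝 (∫ x in Ω, (∑ i, pdR (X i) x i) * f x)) := by
    refine tendsto_integral_of_dominated_convergence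
      (fun x => |(∑ i, pdR (X i) x i) * f x|) ?_ h2.abs ?_ ?_
    · intro n
      simp_rw [Finset.sum_mul]
      exact (integrable_finsetSum _ fun i _ => (hparts n i).2.1).aestronglyMeasurable
    · intro n
      refine .of_forall fun x => ?_
      rw [Real.norm_eq_abs, abs_mul, abs_mul]
      refine mul_le_mul_of_nonneg_left ?_ (abs_nonneg _)
      rw [hg]
      simp only
      rw [abs_div, abs_of_pos (hn0 n), div_le_iff₀ (hn0 n)]
      refine (hTle _).trans_eq ?_
      rw [abs_mul, abs_of_pos (hn0 n)]
    · refine .of_forall fun x => tendsto_const_nhds.mul ?_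
      by_cases h : f x = 0
      · simp [hg, h, hT0 0]
      · refine tendsto_const_nhds.congr' ?_
        filter_upwards [hlarge _ h] with n hn
        simp only [hg]
        rw [hTid _ hn.le, mul_div_cancel_right₀ _ (hn0 n).ne']
  exact tendsto_nhds_unique lim1 (by simpa only [heq] using lim2.neg)

/-- A function which is `C¹` up to the boundary of a bounded open set has bounded derivative. -/
theorem exists_norm_fderiv_le {F : Type*} [NormedAddCommGroup F] [NormedSpace ℝ F] {Ω : Set Pt}
    (hΩo : IsOpen Ω) (hΩb : Bornology.IsBounded Ω) {f : Pt → F}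
    (hf : ContDiffOn ℝ 1 f (closure Ω)) : ∃ M, ∀ x ∈ Ω, ‖fderiv ℝ f x‖ ≤ M := by
  have h := hΩb.isCompact_closure.induction_on
    (p := fun s => ∃ M, ∀ x ∈ s ∩ Ω, ‖fderiv ℝ f x‖ ≤ M) ⟨0, by simp⟩
    (fun s t hst ⟨M, hM⟩ => ⟨M, fun x hx => hM x ⟨hst hx.1, hx.2⟩⟩)
    (fun s t ⟨M, hM⟩ ⟨N, hN⟩ => ⟨max M N, fun x hx => by
      rcases hx.1 with h | h
      · exact (hM x ⟨h, hx.2⟩).trans (le_max_left _ _)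
      · exact (hN x ⟨h, hx.2⟩).trans (le_max_right _ _)⟩) ?_
  · obtain ⟨M, hM⟩ := h
    exact ⟨M, fun x hx => hM x ⟨subset_closure hx, hx⟩⟩
  · intro x hx
    have hx1 : ContDiffWithinAt ℝ (0 + 1) f (closure Ω) x := by simpa using hf x hx
    obtain ⟨s, hs, -, f', hf', hcont⟩ :=
      (contDiffWithinAt_succ_iff_hasFDerivWithinAt (by simp)).1 hx1
    rw [Set.insert_eq_of_mem hx] at hs
    have hc : ContinuousWithinAt f' s x := hcont.continuousWithinAt
    have hbd : ∀ᶠ y in 𝓝[s] x, ‖f' y‖ < ‖f' x‖ + 1 :=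
      hc.norm.eventually (gt_mem_nhds (lt_add_one _))
    have hbd' : {y | y ∈ s → ‖f' y‖ < ‖f' x‖ + 1} ∈ 𝓝[closure Ω] x :=
      mem_nhdsWithin_of_mem_nhds (eventually_nhdsWithin_iff.1 hbd)
    obtain ⟨V, hVo, hxV, hV⟩ := mem_nhdsWithin.1 hs
    refine ⟨V ∩ {y | y ∈ s → ‖f' y‖ < ‖f' x‖ + 1},
      inter_mem (mem_nhdsWithin_of_mem_nhds (hVo.mem_nhds hxV)) hbd', ‖f' x‖ + 1, ?_⟩
    rintro y ⟨⟨hyV, hy⟩, hyΩ⟩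
    have hsub : V ∩ Ω ⊆ s := fun z hz => hV ⟨hz.1, subset_closure hz.2⟩
    have hsn : s ∈ 𝓝 y := mem_of_superset ((hVo.inter hΩo).mem_nhds ⟨hyV, hyΩ⟩) hsub
    have hys : y ∈ s := hsub ⟨hyV, hyΩ⟩
    rw [((hf' y hys).hasFDerivAt hsn).fderiv]
    exact (hy hys).le

theorem StarConvex.isPreconnected_compl {Ω : Set Pt} {x₀ : Pt} (hs : StarConvex ℝ x₀ Ω)
    (hΩb : Bornology.IsBounded Ω) (hx₀ : x₀ ∈ Ω) : IsPreconnected Ωᶜ := by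
  obtain ⟨R₀, hR₀⟩ := hΩb.subset_ball x₀
  have hR₀pos : 0 < R₀ := dist_nonneg.trans_lt (Metric.mem_ball.1 (hR₀ hx₀))
  have hrank : 1 < Module.rank ℝ Pt := by
    rw [← Module.finrank_eq_rank, finrank_euclideanSpace, Fintype.card_fin]
    exact_mod_cast one_lt_two
  have hray : ∀ p ∉ Ω, IsPreconnected ((fun s : ℝ => p + s • (p - x₀)) '' Set.Ici 0) := fun p _ =>
    isPreconnected_Ici.image _ (by fun_prop)
  have hraysub : ∀ p ∉ Ω, (fun s : ℝ => p + s • (p - x₀)) '' Set.Ici 0 ⊆ Ωᶜ := by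
    rintro p hp _ ⟨s, hs0, rfl⟩
    exact hs.add_smul_notMem hp hs0
  have hmemray : ∀ p, p ∈ (fun s : ℝ => p + s • (p - x₀)) '' Set.Ici 0 := fun p =>
    ⟨0, Set.self_mem_Ici, by simp⟩
  have hmeet : ∀ p ∉ Ω, ∀ R, ‖p - x₀‖ ≤ R →
      ((fun s : ℝ => p + s • (p - x₀)) '' Set.Ici 0 ∩ Metric.sphere x₀ R).Nonempty := by
    intro p hp R hR
    have hpos : 0 < ‖p - x₀‖ := norm_pos_iff.2 (sub_ne_zero.2 fun h => hp (h ▸ hx₀))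
    refine ⟨_, ⟨R / ‖p - x₀‖ - 1, ?_, rfl⟩, ?_⟩
    · simpa using (one_le_div hpos).2 hR
    · have e : p + (R / ‖p - x₀‖ - 1) • (p - x₀) - x₀ = (R / ‖p - x₀‖) • (p - x₀) := by module
      rw [mem_sphere_iff_norm, e, norm_smul, Real.norm_of_nonneg (div_nonneg (hpos.le.trans hR) hpos.le),
        div_mul_cancel₀ _ hpos.ne']
  refine isPreconnected_of_forall_pair fun p hp q hq => ?_
  set R := max R₀ (max ‖p - x₀‖ ‖q - x₀‖) with hR
  have hpq : ‖p - x₀‖ ≤ R ∧ ‖q - x₀‖ ≤ R := by simp [hR]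
  have hS : Metric.sphere x₀ R ⊆ Ωᶜ := fun y hy hyΩ => by
    have h1 := hR₀ hyΩ
    rw [Metric.mem_ball, Metric.mem_sphere.1 hy] at h1
    exact absurd (le_max_left R₀ (max ‖p - x₀‖ ‖q - x₀‖)) (not_le.2 h1)
  refine ⟨_ ∪ (Metric.sphere x₀ R ∪ _),
    Set.union_subset (hraysub p hp) (Set.union_subset hS (hraysub q hq)),
    Or.inl (hmemray p), Or.inr (Or.inr (hmemray q)), ?_⟩
  have h1 := IsPreconnected.union' (by rw [Set.inter_comm]; exact hmeet q hq R hpq.2)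
    (isPreconnected_sphere hrank x₀ R) (hray q hq)
  exact IsPreconnected.union' ((hmeet p hp R hpq.1).mono
    (Set.inter_subset_inter_right _ Set.subset_union_left)) (hray p hp) h1

/-- A continuous logarithm of a function equal to one is constant on a connected set. -/
theorem IsPreconnected.eqOn_const_of_exp_eq_one {S : Set Pt} (hS : IsPreconnected S) {h : Pt → ℂ}
    (hc : Continuous h) (h1 : ∀ x ∈ S, Complex.exp (h x) = 1) {x y : Pt} (hx : x ∈ S)
    (hy : y ∈ S) : h x = h y := by
  choose! n hn using fun x hx => Complex.exp_eq_one_iff.1 (h1 x hx)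
  have him : ∀ x ∈ S, (h x).im / (2 * Real.pi) = n x := fun x hx => by
    rw [hn x hx]; simp
  have himg : IsPreconnected ((fun x => (h x).im / (2 * Real.pi)) '' S) :=
    hS.image _ (by fun_prop)
  have hlt : ∀ x ∈ S, ∀ y ∈ S, ¬ n x < n y := by
    intro x hx y hy hxy
    have hmid : ((n x : ℝ) + 1 / 2) ∈ (fun x => (h x).im / (2 * Real.pi)) '' S := by
      refine himg.ordConnected.out ⟨x, hx, him x hx⟩ ⟨y, hy, him y hy⟩ ⟨by linarith, ?_⟩
      have : (n x : ℝ) + 1 ≤ n y := by exact_mod_cast hxy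
      linarith
    obtain ⟨z, hz, hzn⟩ := hmid
    simp only [him z hz] at hzn
    have h2 : (2 * n z : ℝ) = 2 * n x + 1 := by linarith
    have h3 : 2 * n z = 2 * n x + 1 := by exact_mod_cast h2
    omega
  have : n x = n y := le_antisymm (not_lt.1 (hlt y hy x hx)) (not_lt.1 (hlt x hx y hy))
  rw [hn x hx, hn y hy, this]

/-- A continuous logarithm of a `C²` function is `C²`. -/
theorem contDiffAt_of_exp_eq {h w : Pt → ℂ} {x : Pt} (hc : ContinuousAt h x)
    (hw : ContDiffAt ℝ 2 w x) (hexp : ∀ᶠ y in 𝓝 x, Complex.exp (h y) = w y) :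
    ContDiffAt ℝ 2 h x := by
  have hwx : w x ≠ 0 := by rw [← hexp.self_of_nhds]; exact Complex.exp_ne_zero _
  have hev : h =ᶠ[𝓝 x] fun y => h x + Complex.log (w y / w x) := by
    have him : Tendsto (fun y => (h y - h x).im) (𝓝 x) (𝓝 0) := by
      have : ContinuousAt (fun y => (h y - h x).im) x :=
        Complex.continuous_im.continuousAt.comp (hc.sub continuousAt_const)
      simpa [ContinuousAt] using this
    filter_upwards [hexp, him.eventually (Ioo_mem_nhds (neg_lt_zero.2 Real.pi_pos) Real.pi_pos)]
      with y hy hyim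
    rw [← hy, ← hexp.self_of_nhds, ← Complex.exp_sub, Complex.log_exp hyim.1 hyim.2.le]
    ring
  refine ContDiffAt.congr_of_eventuallyEq ?_ hev
  have hlog : ContDiffAt ℝ 2 Complex.log (w x / w x) := by
    rw [div_self hwx]
    exact (Complex.contDiffAt_log Complex.one_mem_slitPlane).restrict_scalars ℝ
  refine contDiffAt_const.add (hlog.comp (f := fun y => w y / w x) x ?_)
  simp only [div_eq_mul_inv]
  exact hw.mul contDiffAt_const

/-- A nonvanishing function on a star-shaped domain with boundary values `exp (I * φ)` has a
continuous logarithm with boundary values `I * φ`. -/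
theorem exists_logarithm {Ω : Set Pt} {x₀ : Pt} (hΩo : IsOpen Ω) (hΩb : Bornology.IsBounded Ω)
    (hs : StarConvex ℝ x₀ Ω) (hx₀ : x₀ ∈ Ω) {φ : Pt → ℝ} (hφc : ContinuousOn φ (closure Ω))
    {U : Pt → ℂ} (hUc : ContinuousOn U (closure Ω)) (hU : ContDiffOn ℝ 2 U Ω)
    (hU0 : ∀ x ∈ closure Ω, U x ≠ 0)
    (hUb : ∀ x ∈ frontier Ω, U x = Complex.exp (Complex.I * (φ x : ℂ))) :
    ∃ H : Pt → ℂ, ContinuousOn H (closure Ω) ∧ ContDiffOn ℝ 2 H Ω ∧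
      (∀ x ∈ Ω, Complex.exp (H x) = U x) ∧ ∀ x ∈ frontier Ω, H x = Complex.I * (φ x : ℂ) := by
  classical
  set w₀ : Pt → ℂ := fun x => U x * Complex.exp (-(Complex.I * (φ x : ℂ))) with hw₀
  set w : Pt → ℂ := Ω.piecewise w₀ (fun _ => 1) with hw
  have hw₀c : ContinuousOn w₀ (closure Ω) := by fun_prop
  have hwc : Continuous w := by
    refine continuous_piecewise (fun x hx => ?_) hw₀c continuousOn_const
    rw [hw₀]
    simp only
    rw [hUb x hx, ← Complex.exp_add, add_neg_cancel, Complex.exp_zero]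
  have hwΩ : ∀ x ∈ Ω, w x = w₀ x := fun x hx => Set.piecewise_eq_of_mem _ _ _ hx
  have hwΩc : ∀ x ∉ Ω, w x = 1 := fun x hx => Set.piecewise_eq_of_notMem _ _ _ hx
  have hw0 : ∀ x, w x ≠ 0 := by
    intro x
    by_cases hx : x ∈ Ω
    · rw [hwΩ x hx]
      exact mul_ne_zero (hU0 x (subset_closure hx)) (Complex.exp_ne_zero _)
    · rw [hwΩc x hx]; exact one_ne_zero
  have hsc : IsSimplyConnected (Set.univ : Set Pt) := by
    have : ContractibleSpace (Set.univ : Set Pt) := convex_univ.contractibleSpace Set.univ_nonempty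
    exact SimplyConnectedSpace.ofContractible _
  obtain ⟨h, hc, hexp⟩ := Complex.exists_continuousOn_eqOn_exp_comp hsc isOpen_univ
    hwc.continuousOn (by rintro ⟨x, -, hx⟩; exact hw0 x hx)
  rw [continuousOn_univ] at hc
  replace hexp : ∀ x, Complex.exp (h x) = w x := fun x => hexp (Set.mem_univ x)
  by_cases hne : (frontier Ω).Nonempty
  swap
  · exfalso
    have hcl : IsClopen Ω := by
      rw [isClopen_iff_frontier_eq_empty]; exact Set.not_nonempty_iff_eq_empty.1 hne
    have huniv := isClopen_iff.1 hcl
    rcases huniv with h | h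
    · rw [h] at hx₀; exact hx₀
    · rw [h] at hΩb
      exact NormedSpace.unbounded_univ ℝ Pt hΩb
  obtain ⟨p₀, hp₀⟩ := hne
  have hfΩ : ∀ p ∈ frontier Ω, p ∉ Ω := fun p hp => by rw [hΩo.frontier_eq] at hp; exact hp.2
  have h1 : Complex.exp (h p₀) = 1 := by rw [hexp, hwΩc p₀ (hfΩ p₀ hp₀)]
  have hconst : ∀ p ∈ frontier Ω, h p = h p₀ := fun p hp =>
    (hs.isPreconnected_compl hΩb hx₀).eqOn_const_of_exp_eq_one hc
      (fun x hx => by rw [hexp, hwΩc x hx]) (hfΩ p hp) (hfΩ p₀ hp₀)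
  have hHc : ContinuousOn (fun x => h x - h p₀ + Complex.I * (φ x : ℂ)) (closure Ω) := by
    have := hc.continuousOn (s := closure Ω)
    fun_prop
  have hHexp : ∀ x ∈ Ω, Complex.exp (h x - h p₀ + Complex.I * (φ x : ℂ)) = U x := by
    intro x hx
    rw [Complex.exp_add, Complex.exp_sub, h1, div_one, hexp, hwΩ x hx, hw₀]
    simp only
    rw [mul_assoc, ← Complex.exp_add, neg_add_cancel, Complex.exp_zero, mul_one]
  refine ⟨_, hHc, fun x hx => ?_, hHexp, fun x hx => by rw [hconst x hx, sub_self, zero_add]⟩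
  have hxn := hΩo.mem_nhds hx
  refine (contDiffAt_of_exp_eq ((hHc.mono subset_closure).continuousAt hxn)
    (hU.contDiffAt hxn) ?_).contDiffWithinAt
  filter_upwards [hxn] with y hy using hHexp y hy

theorem contDiffOn_pd {Ω : Set Pt} (hΩo : IsOpen Ω) {U : Pt → ℂ} (hU : ContDiffOn ℝ 2 U Ω)
    (i : Fin 2) : ContDiffOn ℝ 1 (fun x => pd U x i) Ω :=
  (hU.fderiv_of_isOpen hΩo (by norm_num)).clm_apply contDiffOn_const

theorem gradSq_le {U : Pt → ℂ} {x : Pt} {M : ℝ} (hM : ‖fderiv ℝ U x‖ ≤ M) :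
    gradSq U x ≤ 2 * M ^ 2 := by
  have h : ∀ i, ‖pd U x i‖ ^ 2 ≤ M ^ 2 := fun i => by
    have : ‖pd U x i‖ ≤ M := by
      simpa [pd] using (fderiv ℝ U x).le_of_opNorm_le hM (unitVec i)
    gcongr
  rw [gradSq, Fin.sum_univ_two]
  linarith [h 0, h 1]

theorem gradSq_nonneg (U : Pt → ℂ) (x : Pt) : 0 ≤ gradSq U x :=
  Finset.sum_nonneg fun _ _ => sq_nonneg _

theorem gradSqR_nonneg (f : Pt → ℝ) (x : Pt) : 0 ≤ gradSqR f x :=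
  Finset.sum_nonneg fun _ _ => sq_nonneg _

theorem gradSqR_le {f : Pt → ℝ} {x : Pt} {M : ℝ} (hM : ‖fderiv ℝ f x‖ ≤ M) :
    gradSqR f x ≤ 2 * M ^ 2 := by
  have h : ∀ i, (pdR f x i) ^ 2 ≤ M ^ 2 := fun i => by
    have : |pdR f x i| ≤ M := by
      simpa [pdR] using (fderiv ℝ f x).le_of_opNorm_le hM (unitVec i)
    exact sq_le_sq' (abs_le.1 this).1 (abs_le.1 this).2
  rw [gradSqR, Fin.sum_univ_two]
  linarith [h 0, h 1]

theorem continuousOn_gradSq {Ω : Set Pt} (hΩo : IsOpen Ω) {U : Pt → ℂ}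
    (hU : ContDiffOn ℝ 2 U Ω) : ContinuousOn (gradSq U) Ω :=
  continuousOn_finsetSum _ fun i _ => ((contDiffOn_pd hΩo hU i).continuousOn.norm.pow 2)

theorem continuousOn_gradSqR {Ω : Set Pt} (hΩo : IsOpen Ω) {f : Pt → ℝ}
    (hf : ContDiffOn ℝ 1 f Ω) : ContinuousOn (gradSqR f) Ω :=
  continuousOn_finsetSum _ fun i _ => (continuousOn_pdR hΩo hf i).pow 2

/-- The complex energy flux `Ū ∂ᵢU`. -/
def energyFlux (U : Pt → ℂ) (i : Fin 2) (x : Pt) : ℂ :=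
  (starRingEnd ℂ) (U x) * pd U x i

theorem contDiffOn_energyFlux {Ω : Set Pt} (hΩo : IsOpen Ω) {U : Pt → ℂ}
    (hU : ContDiffOn ℝ 2 U Ω) (i : Fin 2) : ContDiffOn ℝ 1 (energyFlux U i) Ω :=
  (Complex.conjCLE.contDiff.comp_contDiffOn (hU.of_le (by norm_num))).mul (contDiffOn_pd hΩo hU i)

theorem norm_energyFlux_sq (U : Pt → ℂ) (i : Fin 2) (x : Pt) :
    (energyFlux U i x).re ^ 2 + (energyFlux U i x).im ^ 2 = ‖U x‖ ^ 2 * ‖pd U x i‖ ^ 2 := by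
  rw [← mul_pow, ← RCLike.norm_conj (U x), ← norm_mul, ← Complex.normSq_eq_norm_sq,
    Complex.normSq_apply, energyFlux]
  ring

theorem pdR_norm_sq {U : Pt → ℂ} {x : Pt} (hU : DifferentiableAt ℝ U x) (i : Fin 2) :
    pdR (fun y => ‖U y‖ ^ 2) x i = 2 * (energyFlux U i x).re := by
  rw [pdR, hU.hasFDerivAt.norm_sq.fderiv]
  simp [energyFlux, pd, Complex.inner, mul_comm]
  ring

theorem sum_pdR_energyFlux (L : ℂ →L[ℝ] ℝ) {U : Pt → ℂ} {x : Pt} (hU : ContDiffAt ℝ 2 U x)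
    {a : ℝ} (hlap : -lap U x = a * U x) :
    ∑ i, pdR (fun y => L (energyFlux U i y)) x i =
      L ((gradSq U x - a * ‖U x‖ ^ 2 : ℝ) : ℂ) := by
  have h1 : DifferentiableAt ℝ U x := hU.differentiableAt two_ne_zero
  have h2 : ∀ i, DifferentiableAt ℝ (fun y => pd U y i) x := fun i =>
    (((hU.fderiv_right (m := 1) (by norm_num)).clm_apply contDiffAt_const).differentiableAt
      one_ne_zero)
  have h3 : ∀ i, pdR (fun y => L (energyFlux U i y)) x i =
      L ((starRingEnd ℂ) (U x) * fderiv ℝ (fun y => pd U y i) x (unitVec i) +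
        ((‖pd U x i‖ ^ 2 : ℝ) : ℂ)) := by
    intro i
    have h4 := L.hasFDerivAt.comp x
      ((Complex.conjCLE.hasFDerivAt.comp x h1.hasFDerivAt).mul (h2 i).hasFDerivAt)
    have h5 : HasFDerivAt (fun y => L (energyFlux U i y)) _ x := h4
    rw [pdR, h5.fderiv]
    have h6 : pd U x i * (starRingEnd ℂ) (pd U x i) = ((‖pd U x i‖ ^ 2 : ℝ) : ℂ) := by
      rw [Complex.mul_conj, Complex.normSq_eq_norm_sq]
    rw [← h6]
    simp [pd]
  simp_rw [h3]
  rw [← map_sum, Finset.sum_add_distrib, ← Finset.mul_sum]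
  have h7 : ∑ i, fderiv ℝ (fun y => pd U y i) x (unitVec i) = -(a * U x) := by
    rw [← hlap, neg_neg, lap]
  have h8 : (starRingEnd ℂ) (U x) * U x = ((‖U x‖ ^ 2 : ℝ) : ℂ) := by
    rw [mul_comm, Complex.mul_conj, Complex.normSq_eq_norm_sq]
  rw [h7]
  congr 1
  rw [mul_neg, mul_left_comm, h8, gradSq]
  push_cast
  ring

theorem energyFlux_im_eq {U H : Pt → ℂ} {x : Pt} (hH : DifferentiableAt ℝ H x)
    (hexp : ∀ᶠ y in 𝓝 x, Complex.exp (H y) = U y) (i : Fin 2) :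
    (energyFlux U i x).im = ‖U x‖ ^ 2 * pdR (fun y => (H y).im) x i := by
  have h1 : pd U x i = U x * pd H x i := by
    have hev : U =ᶠ[𝓝 x] fun y => Complex.exp (H y) := by
      filter_upwards [hexp] with y hy using hy.symm
    rw [pd, hev.fderiv_eq, (hH.hasFDerivAt.cexp).fderiv, ← hexp.self_of_nhds]
    simp [pd]
  have h2 : pdR (fun y => (H y).im) x i = (pd H x i).im := by
    have := (Complex.imCLM.hasFDerivAt.comp x hH.hasFDerivAt)
    have h3 : HasFDerivAt (fun y => (H y).im) _ x := this
    rw [pdR, h3.fderiv]; simp [pd]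
  have h3 : (starRingEnd ℂ) (U x) * U x = ((‖U x‖ ^ 2 : ℝ) : ℂ) := by
    rw [mul_comm, Complex.mul_conj, Complex.normSq_eq_norm_sq]
  rw [energyFlux, h1, ← mul_assoc, h3, h2, Complex.im_ofReal_mul]

/-- The pointwise inequality behind the energy comparison. Here `p`, `q` are the real and imaginary
parts of the energy flux, `t` the gradient of the phase and `f` that of the reference phase. -/
theorem gradSq_le_of_flux {η s a G : ℝ} {p q t f : Fin 2 → ℝ} (hη : 0 ≤ η) (hη3 : η ≤ 1 / 3)
    (hs : 1 - η ≤ s) (hs4 : s ≤ 4) (hq : ∀ i, q i = s * t i)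
    (hG : ∑ i, (p i ^ 2 + q i ^ 2) = s * G) :
    G ≤ ((1 + η) * (s * ∑ i, f i ^ 2) + 4 * (|a| * |1 - s|)) +
      (2 * (1 + η) * ∑ i, q i * (t i - f i) +
        (∑ i, p i * (2 * p i) + (G - a * s) * (s - 1))) := by
  have hs0 : 0 < s := by linarith
  simp only [Fin.sum_univ_two, hq] at hG ⊢
  set P := p 0 ^ 2 + p 1 ^ 2 with hP
  set θ := t 0 ^ 2 + t 1 ^ 2 with hθ
  set E := P / s with hE
  have hPE : P = s * E := by rw [hE]; field_simp
  have hE0 : 0 ≤ E := by positivity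
  have hθ0 : 0 ≤ θ := by positivity
  have hGE : G = E + s * θ := by
    have : s * G = s * (E + s * θ) := by rw [← hG, mul_add, ← hPE, hP, hθ]; ring
    exact mul_left_cancel₀ hs0.ne' this
  have hA : s / 2 * θ - s / 2 * (f 0 ^ 2 + f 1 ^ 2) ≤
      s * t 0 * (t 0 - f 0) + s * t 1 * (t 1 - f 1) := by
    nlinarith [mul_nonneg hs0.le (sq_nonneg (t 0 - f 0)), mul_nonneg hs0.le (sq_nonneg (t 1 - f 1))]
  have hB : a * s * (s - 1) ≤ 4 * (|a| * |1 - s|) := by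
    calc a * s * (s - 1) ≤ |a * s * (s - 1)| := le_abs_self _
      _ = s * (|a| * |1 - s|) := by
        rw [abs_mul, abs_mul, abs_of_pos hs0, abs_sub_comm s 1]; ring
      _ ≤ _ := by gcongr
  have hA' := mul_le_mul_of_nonneg_left hA (by linarith : 0 ≤ 2 * (1 + η))
  have hE1 : E ≤ E * (3 * s - 1) := le_mul_of_one_le_right hE0 (by linarith)
  have hθ1 : 0 ≤ s * θ * (s - 1 + η) := mul_nonneg (by positivity) (by linarith)
  have e1 : p 0 * (2 * p 0) + p 1 * (2 * p 1) = 2 * (s * E) := by rw [← hPE, hP]; ring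
  rw [e1, hGE]
  nlinarith

/-- A solution of unit modulus and prescribed phase on the boundary, whose modulus is close to one,
has at most the energy of the phase, up to an error controlled by the potential. -/
theorem integral_gradSq_le_of_phase {Ω : Set Pt} {x₀ : Pt} (hΩo : IsOpen Ω)
    (hΩb : Bornology.IsBounded Ω) (hs : StarConvex ℝ x₀ Ω) (hx₀ : x₀ ∈ Ω) {φ : Pt → ℝ}
    (hφ1 : ContDiffOn ℝ 1 φ (closure Ω)) {U : Pt → ℂ} (hU1 : ContDiffOn ℝ 1 U (closure Ω))
    (hU2 : ContDiffOn ℝ 2 U Ω)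
    (hUb : ∀ x ∈ frontier Ω, U x = Complex.exp (Complex.I * (φ x : ℂ)))
    {a : Pt → ℝ} {N : ℝ} (hac : ContinuousOn a Ω) (haN : ∀ x ∈ Ω, |a x| ≤ N)
    (hlap : ∀ x ∈ Ω, -lap U x = a x * U x) {η : ℝ} (hη : 0 ≤ η) (hη3 : η ≤ 1 / 3)
    (hlow : ∀ x ∈ closure Ω, 1 - η ≤ ‖U x‖ ^ 2) (hup : ∀ x ∈ Ω, ‖U x‖ ≤ 2) :
    ∫ x in Ω, gradSq U x ≤ ∫ x in Ω, ((1 + η) * (‖U x‖ ^ 2 * gradSqR φ x) +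
      4 * (|a x| * |1 - ‖U x‖ ^ 2|)) := by
  have hU0 : ∀ x ∈ closure Ω, U x ≠ 0 := fun x hx h => by
    have := hlow x hx
    rw [h, norm_zero] at this
    linarith
  have hUc := hU1.continuousOn
  obtain ⟨H, hHc, hH2, hHexp, hHb⟩ :=
    exists_logarithm hΩo hΩb hs hx₀ hφ1.continuousOn hUc hU2 hU0 hUb
  set θ : Pt → ℝ := fun x => (H x).im with hθ
  have hθc : ContinuousOn θ (closure Ω) := Complex.continuous_im.comp_continuousOn hHc
  have hθ1 : ContDiffOn ℝ 1 θ Ω :=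
    Complex.imCLM.contDiff.comp_contDiffOn (hH2.of_le (by norm_num))
  have hφΩ : ContDiffOn ℝ 1 φ Ω := hφ1.mono subset_closure
  have hUΩ : ContinuousOn U Ω := hUc.mono subset_closure
  have hnear : ∀ x ∈ Ω, Ω ∈ 𝓝 x := fun x hx => hΩo.mem_nhds hx
  have hflux : ∀ x ∈ Ω, ∀ i, (energyFlux U i x).im = ‖U x‖ ^ 2 * pdR θ x i := fun x hx i =>
    energyFlux_im_eq ((hH2.differentiableOn two_ne_zero).differentiableAt (hnear x hx))
      (by filter_upwards [hnear x hx] with y hy using hHexp y hy) i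
  obtain ⟨M, hM⟩ := exists_norm_fderiv_le hΩo hΩb hU1
  obtain ⟨K, hK⟩ := exists_norm_fderiv_le hΩo hΩb hφ1
  have hUsq : ∀ x ∈ Ω, ‖U x‖ ^ 2 ≤ 4 := fun x hx => by
    nlinarith [hup x hx, norm_nonneg (U x)]
  have hpd : ∀ x ∈ Ω, ∀ i, ‖pd U x i‖ ≤ M := fun x hx i => by
    simpa [pd] using (fderiv ℝ U x).le_of_opNorm_le (hM x hx) (unitVec i)
  have hpdφ : ∀ x ∈ Ω, ∀ i, |pdR φ x i| ≤ K := fun x hx i => by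
    simpa [pdR] using (fderiv ℝ φ x).le_of_opNorm_le (hK x hx) (unitVec i)
  have hfluxb : ∀ x ∈ Ω, ∀ i, ‖energyFlux U i x‖ ≤ 2 * M := fun x hx i => by
    rw [energyFlux, norm_mul, RCLike.norm_conj]
    exact mul_le_mul (hup x hx) (hpd x hx i) (norm_nonneg _) two_pos.le
  have hpdθ : ∀ x ∈ Ω, ∀ i, |pdR θ x i| ≤ 3 * M := fun x hx i => by
    have h1 : |(energyFlux U i x).im| ≤ 2 * M := (Complex.abs_im_le_norm _).trans (hfluxb x hx i)
    rw [hflux x hx i, abs_mul, abs_of_nonneg (sq_nonneg _)] at h1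
    have h2 := hlow x (subset_closure hx)
    nlinarith [abs_nonneg (pdR θ x i)]
  have hfc : ∀ i, ContinuousOn (energyFlux U i) Ω := fun i =>
    (contDiffOn_energyFlux hΩo hU2 i).continuousOn
  have hrec : ∀ i, ContinuousOn (fun x => (energyFlux U i x).re) Ω := fun i =>
    Complex.continuous_re.comp_continuousOn (hfc i)
  have himc : ∀ i, ContinuousOn (fun x => (energyFlux U i x).im) Ω := fun i =>
    Complex.continuous_im.comp_continuousOn (hfc i)
  have hgU := continuousOn_gradSq hΩo hU2
  have hgφ := continuousOn_gradSqR hΩo hφΩ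
  have hpθc := fun i => continuousOn_pdR hΩo hθ1 i
  have hpφc := fun i => continuousOn_pdR hΩo hφΩ i
  have hgradM : ∀ x ∈ Ω, |gradSq U x| ≤ 2 * M ^ 2 := fun x hx => by
    rw [abs_of_nonneg (gradSq_nonneg U x)]; exact gradSq_le (hM x hx)
  have hsub : ∀ x ∈ Ω, ∀ i, pdR (fun y => θ y - φ y) x i = pdR θ x i - pdR φ x i :=
    fun x hx i => by
      rw [pdR, fderiv_fun_sub ((hθ1.differentiableOn one_ne_zero).differentiableAt (hnear x hx))
        ((hφΩ.differentiableOn one_ne_zero).differentiableAt (hnear x hx))]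
      rfl
  have hdivim : ∀ x ∈ Ω, ∑ i, pdR (fun y => (energyFlux U i y).im) x i = 0 := fun x hx => by
    have := sum_pdR_energyFlux Complex.imCLM (hU2.contDiffAt (hnear x hx)) (hlap x hx)
    simpa only [Complex.imCLM_apply, Complex.ofReal_im] using this
  have hdivre : ∀ x ∈ Ω, ∑ i, pdR (fun y => (energyFlux U i y).re) x i =
      gradSq U x - a x * ‖U x‖ ^ 2 := fun x hx => by
    have := sum_pdR_energyFlux Complex.reCLM (hU2.contDiffAt (hnear x hx)) (hlap x hx)
    simpa only [Complex.reCLM_apply, Complex.ofReal_re] using this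
  set A : Pt → ℝ := fun x => ∑ i, (energyFlux U i x).im * (pdR θ x i - pdR φ x i) with hA
  set B₁ : Pt → ℝ := fun x => ∑ i, (energyFlux U i x).re * (2 * (energyFlux U i x).re) with hB₁
  set B₂ : Pt → ℝ := fun x => (gradSq U x - a x * ‖U x‖ ^ 2) * (‖U x‖ ^ 2 - 1) with hB₂
  have hAi : IntegrableOn A Ω := by
    refine integrableOn_of_continuousOn_of_bound hΩo hΩb
      (M := ∑ _i : Fin 2, 2 * M * (3 * M + K)) ?_ ?_
    · exact continuousOn_finsetSum _ fun i _ => (himc i).mul ((hpθc i).sub (hpφc i))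
    · intro x hx
      refine (Finset.abs_sum_le_sum_abs _ _).trans (Finset.sum_le_sum fun i _ => ?_)
      have h1 := (Complex.abs_im_le_norm _).trans (hfluxb x hx i)
      rw [abs_mul]
      exact mul_le_mul h1 ((abs_sub _ _).trans (add_le_add (hpdθ x hx i) (hpdφ x hx i)))
        (abs_nonneg _) ((abs_nonneg _).trans h1)
  have hB₁i : IntegrableOn B₁ Ω := by
    refine integrableOn_of_continuousOn_of_bound hΩo hΩb
      (M := ∑ _i : Fin 2, 2 * M * (2 * (2 * M))) ?_ ?_
    · exact continuousOn_finsetSum _ fun i _ => (hrec i).mul (continuousOn_const.mul (hrec i))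
    · intro x hx
      refine (Finset.abs_sum_le_sum_abs _ _).trans (Finset.sum_le_sum fun i _ => ?_)
      have h1 := (Complex.abs_re_le_norm _).trans (hfluxb x hx i)
      rw [abs_mul, abs_mul, abs_two]
      exact mul_le_mul h1 (by linarith) (by positivity) ((abs_nonneg _).trans h1)
  have hB₂i : IntegrableOn B₂ Ω := by
    refine integrableOn_of_continuousOn_of_bound hΩo hΩb (M := (2 * M ^ 2 + N * 4) * 5) ?_ ?_
    · fun_prop
    · intro x hx
      have h1 := hUsq x hx
      have h2 := haN x hx
      rw [abs_mul]
      refine mul_le_mul ((abs_sub _ _).trans (add_le_add (hgradM x hx) ?_)) ?_ (abs_nonneg _)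
        (by nlinarith [abs_nonneg (a x)])
      · rw [abs_mul, abs_of_nonneg (sq_nonneg ‖U x‖)]
        gcongr
        exact (abs_nonneg _).trans h2
      · exact abs_le.2 ⟨by nlinarith [sq_nonneg ‖U x‖], by linarith⟩
  have hA0 : ∫ x in Ω, A x = 0 := by
    have e1 : Set.EqOn (fun x => ∑ i, (energyFlux U i x).im * pdR (fun y => θ y - φ y) x i) A Ω :=
      fun x hx => Finset.sum_congr rfl fun i _ => by rw [hsub x hx i]
    have e2 : Set.EqOn (fun x => (∑ i, pdR (fun y => (energyFlux U i y).im) x i) * (θ x - φ x))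
        (fun _ => 0) Ω := fun x hx => by simp only [hdivim x hx, zero_mul]
    have := integral_sum_mul_pdR_eq_neg hΩo hΩb (f := fun y => θ y - φ y)
      (X := fun i y => (energyFlux U i y).im) (hθc.sub hφ1.continuousOn)
      (fun x hx => by simp [hθ, hHb x hx]) (hθ1.sub hφΩ)
      (fun i => Complex.imCLM.contDiff.comp_contDiffOn (contDiffOn_energyFlux hΩo hU2 i))
      (hAi.congr_fun e1.symm hΩo.measurableSet)
      (integrableOn_zero.congr_fun e2.symm hΩo.measurableSet)
    rw [setIntegral_congr_fun hΩo.measurableSet e1,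
      setIntegral_congr_fun hΩo.measurableSet e2] at this
    simpa using this
  have hB0 : ∫ x in Ω, B₁ x = -∫ x in Ω, B₂ x := by
    have e1 : Set.EqOn (fun x => ∑ i, (energyFlux U i x).re * pdR (fun y => ‖U y‖ ^ 2 - 1) x i)
        B₁ Ω := fun x hx => Finset.sum_congr rfl fun i _ => by
      have h : pdR (fun y => ‖U y‖ ^ 2 - 1) x i = pdR (fun y => ‖U y‖ ^ 2) x i := by
        rw [pdR, fderiv_sub_const]; rfl
      rw [h, pdR_norm_sq ((hU2.differentiableOn two_ne_zero).differentiableAt (hnear x hx))]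
    have e2 : Set.EqOn (fun x => (∑ i, pdR (fun y => (energyFlux U i y).re) x i) *
        (‖U x‖ ^ 2 - 1)) B₂ Ω := fun x hx => by simp only [hdivre x hx, hB₂]
    have := integral_sum_mul_pdR_eq_neg hΩo hΩb (f := fun y => ‖U y‖ ^ 2 - 1)
      (X := fun i y => (energyFlux U i y).re) (by fun_prop)
      (fun x hx => by
        rw [hUb x hx, mul_comm, Complex.norm_exp_ofReal_mul_I]; norm_num)
      (((hU2.of_le (by norm_num)).norm_sq ℝ).sub contDiffOn_const)
      (fun i => Complex.reCLM.contDiff.comp_contDiffOn (contDiffOn_energyFlux hΩo hU2 i))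
      (hB₁i.congr_fun e1.symm hΩo.measurableSet)
      (hB₂i.congr_fun e2.symm hΩo.measurableSet)
    rwa [setIntegral_congr_fun hΩo.measurableSet e1,
      setIntegral_congr_fun hΩo.measurableSet e2] at this
  have hRi : IntegrableOn (fun x => (1 + η) * (‖U x‖ ^ 2 * gradSqR φ x) +
      4 * (|a x| * |1 - ‖U x‖ ^ 2|)) Ω := by
    refine integrableOn_of_continuousOn_of_bound hΩo hΩb
      (M := (1 + η) * (4 * (2 * K ^ 2)) + 4 * (N * 5)) (by fun_prop) ?_
    intro x hx
    have h1 := gradSqR_nonneg φ x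
    have h2 := hUsq x hx
    have h3 := gradSqR_le (hK x hx)
    have h4 := haN x hx
    have h5 : |1 - ‖U x‖ ^ 2| ≤ 5 := abs_le.2 ⟨by linarith, by nlinarith [sq_nonneg ‖U x‖]⟩
    rw [abs_of_nonneg (by positivity)]
    have h6 : 0 ≤ N := (abs_nonneg _).trans h4
    gcongr
  have hGi : IntegrableOn (gradSq U) Ω := integrableOn_of_continuousOn_of_bound hΩo hΩb hgU hgradM
  have hS : IntegrableOn (fun x => B₁ x + B₂ x) Ω := hB₁i.add hB₂i
  have hT : IntegrableOn (fun x => 2 * (1 + η) * A x + (B₁ x + B₂ x)) Ω :=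
    (hAi.const_mul _).add hS
  calc ∫ x in Ω, gradSq U x
      ≤ ∫ x in Ω, (((1 + η) * (‖U x‖ ^ 2 * gradSqR φ x) + 4 * (|a x| * |1 - ‖U x‖ ^ 2|)) +
        (2 * (1 + η) * A x + (B₁ x + B₂ x))) := by
        refine setIntegral_mono_on hGi (hRi.add hT) hΩo.measurableSet fun x hx => ?_
        refine gradSq_le_of_flux hη hη3 (hlow x (subset_closure hx)) (hUsq x hx)
          (hflux x hx) ?_
        rw [gradSq, Finset.mul_sum]
        exact Finset.sum_congr rfl fun i _ => norm_energyFlux_sq U i x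
    _ = _ := by
        rw [integral_add hRi hT, integral_add (hAi.const_mul _) hS, integral_add hB₁i hB₂i,
          integral_const_mul, hA0, hB0]
        ring

/-- The maximum principle for `-ΔU = aU`: the modulus of `U` is at most `R` as soon as this holds
on the boundary and at the points where `a` is nonnegative. -/
theorem norm_le_of_neg_lap_eq {Ω : Set Pt} (hΩo : IsOpen Ω) (hΩb : Bornology.IsBounded Ω)
    {U : Pt → ℂ} (hUc : ContinuousOn U (closure Ω)) (hU2 : ContDiffOn ℝ 2 U Ω) {a : Pt → ℝ}
    (hlap : ∀ x ∈ Ω, -lap U x = a x * U x) {R : ℝ} (hR : 0 ≤ R)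
    (hfr : ∀ x ∈ frontier Ω, ‖U x‖ ≤ R) (ha : ∀ x ∈ Ω, 0 ≤ a x → ‖U x‖ ≤ R) :
    ∀ x ∈ closure Ω, ‖U x‖ ≤ R := by
  intro x hx
  obtain ⟨z, hz, hmax⟩ := hΩb.isCompact_closure.exists_isMaxOn ⟨x, hx⟩ hUc.norm
  refine (isMaxOn_iff.1 hmax x hx).trans ?_
  by_cases hzΩ : z ∈ Ω
  swap
  · exact hfr z ⟨hz, by rwa [hΩo.interior_eq]⟩
  rcases eq_or_ne (U z) 0 with h0 | h0
  · rwa [h0, norm_zero]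
  refine ha z hzΩ ?_
  have hconj : ∀ w : ℂ, ((starRingEnd ℂ) (U z) * w).re ≤ ‖U z‖ * ‖w‖ := fun w =>
    (Complex.re_le_norm _).trans (by rw [norm_mul, RCLike.norm_conj])
  have hself : (starRingEnd ℂ) (U z) * U z = ((‖U z‖ ^ 2 : ℝ) : ℂ) := by
    rw [mul_comm, Complex.mul_conj, Complex.normSq_eq_norm_sq]
  have hloc : IsLocalMax (fun y => ((starRingEnd ℂ) (U z) * U y).re) z := by
    filter_upwards [hΩo.mem_nhds hzΩ] with y hy
    rw [hself, Complex.ofReal_re, sq]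
    exact (hconj _).trans (mul_le_mul_of_nonneg_left
      (isMaxOn_iff.1 hmax y (subset_closure hy)) (norm_nonneg _))
  have h := (HasLineLaplacian.of_complex (hU2.contDiffAt (hΩo.mem_nhds hzΩ))
    ((starRingEnd ℂ) (U z))).nonpos_of_isLocalMax hloc
  rw [show lap U z = -(a z * U z) by rw [← hlap z hzΩ, neg_neg],
    show (starRingEnd ℂ) (U z) * -(a z * U z) = -(a z * ((starRingEnd ℂ) (U z) * U z)) by ring,
    hself, ← Complex.ofReal_mul, Complex.neg_re, Complex.ofReal_re, neg_nonpos] at h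
  exact nonneg_of_mul_nonneg_left h (by positivity)

/-- If the rescaled potential of a family of solutions tends to zero, then their moduli are
eventually bounded below by any number less than one. -/
theorem eventually_forall_le_norm {Ω : Set Pt} {x₀ : Pt} (hΩo : IsOpen Ω)
    (hΩb : Bornology.IsBounded Ω) (hs : StarConvex ℝ x₀ Ω) (hx₀ : x₀ ∈ Ω) {g : Pt → ℂ}
    (hgc : ContinuousOn g (frontier Ω)) (hg : ∀ x ∈ frontier Ω, ‖g x‖ = 1) {U : ℝ → Pt → ℂ}
    (hUc : ∀ ε > 0, ContinuousOn (U ε) (closure Ω)) (hU2 : ∀ ε > 0, ContDiffOn ℝ 2 (U ε) Ω)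
    (hUb : ∀ ε > 0, ∀ x ∈ frontier Ω, U ε x = g x)
    (hup : ∀ ε > 0, ∀ x ∈ closure Ω, ‖U ε x‖ ≤ 2)
    (hlap : ∀ ε > 0, ∀ x ∈ Ω, ‖lap (U ε) x‖ ≤ 8 / ε ^ 2)
    (hT : Tendsto (fun ε => (ε ^ 2)⁻¹ * ∫ x in Ω, (1 - ‖U ε x‖ ^ 2) ^ 2) (𝓝[>] 0) (𝓝 0))
    {δ : ℝ} (hδ : 0 < δ) (hδ1 : δ < 1) :
    ∀ᶠ ε in 𝓝[>] (0 : ℝ), ∀ x ∈ closure Ω, 1 - δ ≤ ‖U ε x‖ := by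
  obtain ⟨κ, hκ, hbd⟩ := exists_le_integral_of_norm_lt hδ hδ1
  have hcomp : IsCompact (frontier Ω) :=
    hΩb.isCompact_closure.of_isClosed_subset isClosed_frontier frontier_subset_closure
  obtain ⟨r, hr, hmod⟩ := Metric.uniformContinuousOn_iff.1
    (hcomp.uniformContinuousOn_of_continuous hgc) (δ / 6) (by positivity)
  filter_upwards [self_mem_nhdsWithin, hT.eventually_lt_const hκ,
    mem_nhdsWithin_of_mem_nhds (gt_mem_nhds hr)] with ε hε hsmall hεr x hx
  have hε : 0 < ε := hε
  by_cases hxΩ : x ∈ Ω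
  · by_contra! hlt
    have h := hbd Ω x₀ ε (U ε) hΩo hΩb hs hx₀ hε (hUc ε hε) (hU2 ε hε) (hup ε hε) (hlap ε hε)
      (fun p hp => by rw [hUb ε hε p hp, hg p hp])
      (fun p hp y hy hyp => by
        rw [hUb ε hε p hp, hUb ε hε y hy]
        exact (hmod y hy p hp (hyp.trans hεr)).le) x hxΩ hlt
    rw [inv_mul_lt_iff₀ (by positivity)] at hsmall
    linarith
  · have hxf : x ∈ frontier Ω := ⟨hx, by rwa [hΩo.interior_eq]⟩
    rw [hUb ε hε x hxf, hg x hxf]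
    linarith

/-- The pointwise form of the energy comparison. -/
theorem phase_integrand_le {η s g a M ε : ℝ} (hη1 : η ≤ 1) (hη : 0 ≤ η) (hg : 0 ≤ g)
    (hgM : g ≤ M) (hε : 0 < ε) :
    (1 + η) * (s * g) + 4 * (|(ε ^ 2)⁻¹ * a| * |1 - s|) ≤
      (1 + η) * g + (M * ε + ((M * ε + 2) * ((ε ^ 2)⁻¹ * (1 - s) ^ 2) +
        2 * ((ε ^ 2)⁻¹ * a ^ 2))) := by
  have hM : 0 ≤ M := hg.trans hgM
  have h1 : (1 + η) * (s * g) ≤ (1 + η) * g + 2 * M * |1 - s| := by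
    have h2 : (s - 1) * g ≤ |1 - s| * M := by
      rw [abs_sub_comm]
      exact mul_le_mul (le_abs_self _) hgM hg (abs_nonneg _)
    have h3 : 0 ≤ |1 - s| * M := by positivity
    nlinarith
  have h2 : 2 * |1 - s| ≤ ε + ε * ((ε ^ 2)⁻¹ * (1 - s) ^ 2) := by
    have : ε + ε * ((ε ^ 2)⁻¹ * (1 - s) ^ 2) - 2 * |1 - s| = ε⁻¹ * (ε - |1 - s|) ^ 2 := by
      rw [← sq_abs (1 - s)]
      field_simp
      ring
    have h3 : 0 ≤ ε⁻¹ * (ε - |1 - s|) ^ 2 := by positivity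
    linarith
  have h3 : 4 * (|(ε ^ 2)⁻¹ * a| * |1 - s|) ≤
      2 * ((ε ^ 2)⁻¹ * (1 - s) ^ 2) + 2 * ((ε ^ 2)⁻¹ * a ^ 2) := by
    rw [abs_mul, abs_of_pos (by positivity : 0 < (ε ^ 2)⁻¹), ← sq_abs (1 - s), ← sq_abs a]
    have : 0 ≤ (ε ^ 2)⁻¹ * (|a| - |1 - s|) ^ 2 := by positivity
    nlinarith
  nlinarith [mul_le_mul_of_nonneg_left h2 hM]

/-- If the rescaled potential terms of a family of solutions tend to zero, then the Dirichlet
energies are eventually at most that of the harmonic phase, up to an arbitrary error. -/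
theorem eventually_integral_gradSq_le {Ω : Set Pt} {x₀ : Pt} (hΩo : IsOpen Ω)
    (hΩb : Bornology.IsBounded Ω) (hs : StarConvex ℝ x₀ Ω) (hx₀ : x₀ ∈ Ω) {φ : Pt → ℝ}
    (hφ1 : ContDiffOn ℝ 1 φ (closure Ω)) {U : ℝ → Pt → ℂ} {A : ℝ → Pt → ℝ}
    (hU1 : ∀ ε > 0, ContDiffOn ℝ 1 (U ε) (closure Ω))
    (hU2 : ∀ ε > 0, ContDiffOn ℝ 2 (U ε) Ω)
    (hUb : ∀ ε > 0, ∀ x ∈ frontier Ω, U ε x = Complex.exp (Complex.I * (φ x : ℂ)))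
    (hAc : ∀ ε > 0, ContinuousOn (A ε) Ω) (hA : ∀ ε > 0, ∀ x ∈ Ω, |A ε x| ≤ 4)
    (hlap : ∀ ε > 0, ∀ x ∈ Ω, -lap (U ε) x = (((ε ^ 2)⁻¹ * A ε x : ℝ) : ℂ) * U ε x)
    (hup : ∀ ε > 0, ∀ x ∈ closure Ω, ‖U ε x‖ ≤ 2)
    (hT1 : Tendsto (fun ε => (ε ^ 2)⁻¹ * ∫ x in Ω, (1 - ‖U ε x‖ ^ 2) ^ 2) (𝓝[>] 0) (𝓝 0))
    (hT2 : Tendsto (fun ε => (ε ^ 2)⁻¹ * ∫ x in Ω, (A ε x) ^ 2) (𝓝[>] 0) (𝓝 0))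
    {τ : ℝ} (hτ : 0 < τ) :
    ∀ᶠ ε in 𝓝[>] (0 : ℝ), ∫ x in Ω, gradSq (U ε) x ≤ (∫ x in Ω, gradSqR φ x) + τ := by
  set D : ℝ := ∫ x in Ω, gradSqR φ x with hD
  have hφΩ : ContDiffOn ℝ 1 φ Ω := hφ1.mono subset_closure
  have hD0 : 0 ≤ D := integral_nonneg fun x => gradSqR_nonneg φ x
  obtain ⟨K, hK⟩ := exists_norm_fderiv_le hΩo hΩb hφ1
  set M : ℝ := 2 * K ^ 2 with hM
  set V : ℝ := volume.real Ω with hV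
  have hgM : ∀ x ∈ Ω, gradSqR φ x ≤ M := fun x hx => gradSqR_le (hK x hx)
  have hgc := continuousOn_gradSqR hΩo hφΩ
  have hgi : IntegrableOn (gradSqR φ) Ω := integrableOn_of_continuousOn_of_bound hΩo hΩb hgc
    fun x hx => by rw [abs_of_nonneg (gradSqR_nonneg φ x)]; exact hgM x hx
  set η : ℝ := min (1 / 3) (τ / (2 * (D + 1))) with hη
  have hηpos : 0 < η := by positivity
  have hη3 : η ≤ 1 / 3 := min_le_left _ _
  have hηD : η * D < τ := by
    have h1 : η * (2 * (D + 1)) ≤ τ :=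
      (le_div_iff₀ (by positivity)).1 (min_le_right (1 / 3) (τ / (2 * (D + 1))))
    nlinarith
  have hlow := eventually_forall_le_norm hΩo hΩb hs hx₀
    (g := fun x => Complex.exp (Complex.I * φ x))
    (by
      have := hφ1.continuousOn.mono frontier_subset_closure
      fun_prop)
    (fun x _ => by rw [mul_comm, Complex.norm_exp_ofReal_mul_I])
    (fun ε hε => (hU1 ε hε).continuousOn) hU2 hUb hup
    (fun ε hε x hx => by
      have h1 : ‖U ε x‖ ≤ 2 := hup ε hε x (subset_closure hx)
      have hε0 : 0 < (ε ^ 2)⁻¹ := by positivity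
      rw [← norm_neg, hlap ε hε x hx, norm_mul, Complex.norm_real, Real.norm_eq_abs, abs_mul,
        abs_of_pos hε0, mul_assoc, div_eq_inv_mul]
      have h2 := mul_le_mul (hA ε hε x hx) h1 (norm_nonneg _) (by norm_num)
      exact mul_le_mul_of_nonneg_left (h2.trans (by norm_num)) hε0.le) hT1
    (δ := η / 2) (by positivity) (by linarith)
  have hlim : Tendsto (fun ε : ℝ => (1 + η) * D + (M * ε * V +
      ((M * ε + 2) * ((ε ^ 2)⁻¹ * ∫ x in Ω, (1 - ‖U ε x‖ ^ 2) ^ 2) +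
        2 * ((ε ^ 2)⁻¹ * ∫ x in Ω, (A ε x) ^ 2)))) (𝓝[>] 0)
      (𝓝 ((1 + η) * D + (M * 0 * V + ((M * 0 + 2) * 0 + 2 * 0)))) := by
    have hid : Tendsto (fun ε : ℝ => ε) (𝓝[>] 0) (𝓝 0) := tendsto_nhdsWithin_of_tendsto_nhds
      tendsto_id
    exact tendsto_const_nhds.add (((hid.const_mul M).mul_const V).add
      ((((hid.const_mul M).add_const 2).mul hT1).add (hT2.const_mul 2)))
  filter_upwards [self_mem_nhdsWithin, hlow, hlim.eventually_lt_const (u := D + τ) (by linarith)]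
    with ε hε hlow hsmall
  have hε : 0 < ε := hε
  have hUΩ : ContinuousOn (U ε) Ω := (hU2 ε hε).continuousOn
  have hAε := hAc ε hε
  have hUi : IntegrableOn (fun x => (1 - ‖U ε x‖ ^ 2) ^ 2) Ω :=
    integrableOn_of_continuousOn_of_bound hΩo hΩb (M := 9) (by fun_prop) fun x hx => by
      have h1 := hup ε hε x (subset_closure hx)
      have h2 : ‖U ε x‖ ^ 2 ≤ 4 := by nlinarith [norm_nonneg (U ε x)]
      rw [abs_of_nonneg (sq_nonneg _)]
      nlinarith [sq_nonneg ‖U ε x‖]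
  have hAi : IntegrableOn (fun x => (A ε x) ^ 2) Ω :=
    integrableOn_of_continuousOn_of_bound hΩo hΩb (M := 16) (by fun_prop) fun x hx => by
      rw [abs_of_nonneg (sq_nonneg _), ← sq_abs]
      nlinarith [hA ε hε x hx, abs_nonneg (A ε x)]
  have hAb : ∀ x ∈ Ω, |(ε ^ 2)⁻¹ * A ε x| ≤ (ε ^ 2)⁻¹ * 4 := fun x hx => by
    rw [abs_mul, abs_of_pos (by positivity : 0 < (ε ^ 2)⁻¹)]
    exact mul_le_mul_of_nonneg_left (hA ε hε x hx) (by positivity)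
  have hmain := integral_gradSq_le_of_phase hΩo hΩb hs hx₀ hφ1 (hU1 ε hε) (hU2 ε hε) (hUb ε hε)
    (a := fun x => (ε ^ 2)⁻¹ * A ε x) (by fun_prop) hAb (hlap ε hε) hηpos.le hη3
    (fun x hx => by nlinarith [hlow x hx]) (fun x hx => hup ε hε x (subset_closure hx))
  have hi1 : IntegrableOn (fun x => (M * ε + 2) * ((ε ^ 2)⁻¹ * (1 - ‖U ε x‖ ^ 2) ^ 2) +
      2 * ((ε ^ 2)⁻¹ * (A ε x) ^ 2)) Ω :=
    ((hUi.const_mul _).const_mul _).add ((hAi.const_mul _).const_mul _)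
  have hc : IntegrableOn (fun _ : Pt => M * ε) Ω :=
    integrableOn_const hΩb.measure_lt_top.ne
  have hi2 : IntegrableOn (fun x => M * ε + ((M * ε + 2) * ((ε ^ 2)⁻¹ * (1 - ‖U ε x‖ ^ 2) ^ 2) +
      2 * ((ε ^ 2)⁻¹ * (A ε x) ^ 2))) Ω := hc.add hi1
  refine hmain.trans (le_trans ?_ hsmall.le)
  calc _ ≤ ∫ x in Ω, ((1 + η) * gradSqR φ x + (M * ε +
        ((M * ε + 2) * ((ε ^ 2)⁻¹ * (1 - ‖U ε x‖ ^ 2) ^ 2) + 2 * ((ε ^ 2)⁻¹ * (A ε x) ^ 2)))) := by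
        refine integral_mono_of_nonneg (.of_forall fun x => ?_) ((hgi.const_mul _).add hi2)
          ((ae_restrict_iff' hΩo.measurableSet).2 (.of_forall fun x hx => ?_))
        · have := gradSqR_nonneg φ x
          simp only [Pi.zero_apply]
          positivity
        · exact phase_integrand_le (by linarith) hηpos.le (gradSqR_nonneg φ x) (hgM x hx) hε
    _ = _ := by
        rw [integral_add (hgi.const_mul _) hi2, integral_add hc hi1,
          integral_add ((hUi.const_mul _).const_mul _) ((hAi.const_mul _).const_mul _)]
        simp only [integral_const_mul, setIntegral_const, smul_eq_mul]
        ring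

theorem gradSq_exp_phase {f : Pt → ℝ} {x : Pt} (hf : DifferentiableAt ℝ f x) :
    gradSq (fun y => Complex.exp (Complex.I * (f y : ℂ))) x = gradSqR f x := by
  have h : HasFDerivAt (fun y => Complex.exp (Complex.I * (f y : ℂ)))
      (Complex.exp (Complex.I * (f x : ℂ)) •
        (Complex.I • (Complex.ofRealCLM.comp (fderiv ℝ f x)))) x :=
    ((Complex.ofRealCLM.hasFDerivAt.comp x hf.hasFDerivAt).const_mul Complex.I).cexp
  refine Finset.sum_congr rfl fun i _ => ?_
  rw [pd, h.fderiv, pdR]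
  simp [mul_comm Complex.I, Complex.norm_exp_ofReal_mul_I]

/-- If `f² ≤ 2F` and the rescaled integrals of `F` tend to zero, so do those of `f²`. -/
theorem tendsto_rescaled_integral_sq {Ω : Set Pt} (hΩo : IsOpen Ω) {f F : ℝ → Pt → ℝ}
    (hF : ∀ ε > 0, IntegrableOn (F ε) Ω) (hle : ∀ ε > 0, ∀ x ∈ Ω, (f ε x) ^ 2 ≤ 2 * F ε x)
    (hT : Tendsto (fun ε => (ε ^ 2)⁻¹ * ∫ x in Ω, F ε x) (𝓝[>] 0) (𝓝 0)) :
    Tendsto (fun ε => (ε ^ 2)⁻¹ * ∫ x in Ω, (f ε x) ^ 2) (𝓝[>] 0) (𝓝 0) := by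
  have h2 : Tendsto (fun ε => 2 * ((ε ^ 2)⁻¹ * ∫ x in Ω, F ε x)) (𝓝[>] 0) (𝓝 0) := by
    simpa using hT.const_mul 2
  refine squeeze_zero' (.of_forall fun ε => ?_) ?_ h2
  · have : 0 ≤ ∫ x in Ω, (f ε x) ^ 2 := integral_nonneg fun x => sq_nonneg _
    positivity
  · filter_upwards [self_mem_nhdsWithin] with ε hε
    have hε : 0 < ε := hε
    have h0 : ∀ x, 0 ≤ (f ε x) ^ 2 := fun x => sq_nonneg _
    have h : ∫ x in Ω, (f ε x) ^ 2 ≤ ∫ x in Ω, 2 * F ε x :=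
      integral_mono_of_nonneg (.of_forall h0) ((hF ε hε).const_mul 2)
        ((ae_restrict_iff' hΩo.measurableSet).2 (.of_forall fun x hx => hle ε hε x hx))
    rw [integral_const_mul] at h
    have h3 := mul_le_mul_of_nonneg_left h (by positivity : 0 ≤ (ε ^ 2)⁻¹)
    linarith

/-- Theorem 1.3 (ii): for the non-symmetric two-component system, if the Dirichlet
energies eventually exceed a constant `C₄` strictly above `(1/2)∫(|∇u₀|² + |∇v₀|²)`,
then the rescaled potential does not converge to `0`. -/
theorem stmt14
    (Ω : Set Pt) (hΩo : IsOpen Ω) (hΩne : Ω.Nonempty) (hΩconn : IsConnected Ω)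
    (hΩbdd : Bornology.IsBounded Ω)
    (hstar : ∃ x₀, StarConvex ℝ x₀ Ω)
    (g₁ g₂ : Pt → ℂ)
    (hg₁ : ∀ x ∈ frontier Ω, ‖g₁ x‖ = 1) (hg₂ : ∀ x ∈ frontier Ω, ‖g₂ x‖ = 1)
    (φ ψ : Pt → ℝ)
    (hφ1 : ContDiffOn ℝ 1 φ (closure Ω)) (hφ2 : ContDiffOn ℝ 2 φ Ω)
    (hφharm : ∀ x ∈ Ω, lapR φ x = 0)
    (hψ1 : ContDiffOn ℝ 1 ψ (closure Ω)) (hψ2 : ContDiffOn ℝ 2 ψ Ω)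
    (hψharm : ∀ x ∈ Ω, lapR ψ x = 0)
    (u₀ v₀ : Pt → ℂ)
    (hu₀ : ∀ x, u₀ x = Complex.exp (Complex.I * (φ x : ℂ)))
    (hv₀ : ∀ x, v₀ x = Complex.exp (Complex.I * (ψ x : ℂ)))
    (hu₀b : ∀ x ∈ frontier Ω, u₀ x = g₁ x)
    (hv₀b : ∀ x ∈ frontier Ω, v₀ x = g₂ x)
    (u v : ℝ → Pt → ℂ)
    (hu1 : ∀ ε > 0, ContDiffOn ℝ 1 (u ε) (closure Ω))
    (hu2 : ∀ ε > 0, ContDiffOn ℝ 2 (u ε) Ω)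
    (hv1 : ∀ ε > 0, ContDiffOn ℝ 1 (v ε) (closure Ω))
    (hv2 : ∀ ε > 0, ContDiffOn ℝ 2 (v ε) Ω)
    (hGLu : ∀ ε > 0, ∀ x ∈ Ω,
      -(lap (u ε) x) =
        ((ε ^ 2 : ℝ) : ℂ)⁻¹ * u ε x * ((2 - ‖u ε x‖ ^ 2 - ‖v ε x‖ ^ 2 : ℝ) : ℂ) +
          ((ε ^ 2 : ℝ) : ℂ)⁻¹ * u ε x * ((1 - ‖u ε x‖ ^ 2 : ℝ) : ℂ))
    (hGLv : ∀ ε > 0, ∀ x ∈ Ω,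
      -(lap (v ε) x) =
        ((ε ^ 2 : ℝ) : ℂ)⁻¹ * v ε x * ((2 - ‖u ε x‖ ^ 2 - ‖v ε x‖ ^ 2 : ℝ) : ℂ))
    (hub : ∀ ε > 0, ∀ x ∈ frontier Ω, u ε x = g₁ x)
    (hvb : ∀ ε > 0, ∀ x ∈ frontier Ω, v ε x = g₂ x)
    (hpoho : ∃ γ₂ > 0, ∀ᶠ ε in 𝓝[>] (0 : ℝ),
      (ε ^ 2)⁻¹ * (∫ x in Ω,
        ((2 - ‖u ε x‖ ^ 2 - ‖v ε x‖ ^ 2) ^ 2 + (1 - ‖u ε x‖ ^ 2) ^ 2)) ≤ γ₂)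
    (C₄ : ℝ)
    (hC₄a : ∀ᶠ ε in 𝓝[>] (0 : ℝ),
      C₄ ≤ (1 / 2) * ∫ x in Ω, (gradSq (u ε) x + gradSq (v ε) x))
    (hC₄b : (1 / 2) * (∫ x in Ω, (gradSq u₀ x + gradSq v₀ x)) < C₄) :
    ¬ Tendsto (fun ε => (ε ^ 2)⁻¹ * ∫ x in Ω,
        ((2 - ‖u ε x‖ ^ 2 - ‖v ε x‖ ^ 2) ^ 2 + (1 - ‖u ε x‖ ^ 2) ^ 2))
      (𝓝[>] (0 : ℝ)) (𝓝 0) := by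
  intro hT
  obtain ⟨x₀, hs⟩ := hstar
  have hx₀ : x₀ ∈ Ω := hs.mem hΩne
  have huφ : ∀ ε > 0, ∀ x ∈ frontier Ω, u ε x = Complex.exp (Complex.I * (φ x : ℂ)) :=
    fun ε hε x hx => by rw [hub ε hε x hx, ← hu₀b x hx, hu₀]
  have hvψ : ∀ ε > 0, ∀ x ∈ frontier Ω, v ε x = Complex.exp (Complex.I * (ψ x : ℂ)) :=
    fun ε hε x hx => by rw [hvb ε hε x hx, ← hv₀b x hx, hv₀]
  have hlapu : ∀ ε > 0, ∀ x ∈ Ω, -lap (u ε) x =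
      (((ε ^ 2)⁻¹ * (3 - 2 * ‖u ε x‖ ^ 2 - ‖v ε x‖ ^ 2) : ℝ) : ℂ) * u ε x :=
    fun ε hε x hx => by
      rw [hGLu ε hε x hx]
      push_cast
      ring
  have hlapv : ∀ ε > 0, ∀ x ∈ Ω, -lap (v ε) x =
      (((ε ^ 2)⁻¹ * (2 - ‖u ε x‖ ^ 2 - ‖v ε x‖ ^ 2) : ℝ) : ℂ) * v ε x :=
    fun ε hε x hx => by
      rw [hGLv ε hε x hx]
      push_cast
      ring
  have hunorm : ∀ ε > 0, ∀ x ∈ closure Ω, ‖u ε x‖ ≤ 3 / 2 := fun ε hε =>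
    norm_le_of_neg_lap_eq hΩo hΩbdd (hu1 ε hε).continuousOn (hu2 ε hε)
      (a := fun x => (ε ^ 2)⁻¹ * (3 - 2 * ‖u ε x‖ ^ 2 - ‖v ε x‖ ^ 2)) (hlapu ε hε) (by norm_num)
      (fun x hx => by rw [hub ε hε x hx, hg₁ x hx]; norm_num)
      (fun x _ h => by
        have h1 := nonneg_of_mul_nonneg_right h (by positivity : 0 < (ε ^ 2)⁻¹)
        nlinarith [sq_nonneg ‖v ε x‖])
  have hvnorm : ∀ ε > 0, ∀ x ∈ closure Ω, ‖v ε x‖ ≤ 3 / 2 := fun ε hε =>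
    norm_le_of_neg_lap_eq hΩo hΩbdd (hv1 ε hε).continuousOn (hv2 ε hε)
      (a := fun x => (ε ^ 2)⁻¹ * (2 - ‖u ε x‖ ^ 2 - ‖v ε x‖ ^ 2)) (hlapv ε hε) (by norm_num)
      (fun x hx => by rw [hvb ε hε x hx, hg₂ x hx]; norm_num)
      (fun x _ h => by
        have h1 := nonneg_of_mul_nonneg_right h (by positivity : 0 < (ε ^ 2)⁻¹)
        nlinarith [sq_nonneg ‖u ε x‖])
  have husq : ∀ ε > 0, ∀ x ∈ Ω, ‖u ε x‖ ^ 2 ≤ 9 / 4 := fun ε hε x hx => by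
    nlinarith [hunorm ε hε x (subset_closure hx), norm_nonneg (u ε x)]
  have hvsq : ∀ ε > 0, ∀ x ∈ Ω, ‖v ε x‖ ^ 2 ≤ 9 / 4 := fun ε hε x hx => by
    nlinarith [hvnorm ε hε x (subset_closure hx), norm_nonneg (v ε x)]
  have huc : ∀ ε > 0, ContinuousOn (u ε) Ω := fun ε hε => (hu2 ε hε).continuousOn
  have hvc : ∀ ε > 0, ContinuousOn (v ε) Ω := fun ε hε => (hv2 ε hε).continuousOn
  have hF : ∀ ε > 0, IntegrableOn (fun x =>
      (2 - ‖u ε x‖ ^ 2 - ‖v ε x‖ ^ 2) ^ 2 + (1 - ‖u ε x‖ ^ 2) ^ 2) Ω := fun ε hε => by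
    have h1 := huc ε hε
    have h2 := hvc ε hε
    refine integrableOn_of_continuousOn_of_bound hΩo hΩbdd (M := 9 + 4) (by fun_prop) ?_
    intro x hx
    have h3 := husq ε hε x hx
    have h4 := hvsq ε hε x hx
    rw [abs_of_nonneg (by positivity)]
    exact add_le_add (by nlinarith [sq_nonneg ‖u ε x‖, sq_nonneg ‖v ε x‖])
      (by nlinarith [sq_nonneg ‖u ε x‖])
  have hTu := fun τ (hτ : (0 : ℝ) < τ) => eventually_integral_gradSq_le hΩo hΩbdd hs hx₀ hφ1
    (A := fun ε x => 3 - 2 * ‖u ε x‖ ^ 2 - ‖v ε x‖ ^ 2) hu1 hu2 huφ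
    (fun ε hε => by
      have h1 := huc ε hε
      have h2 := hvc ε hε
      fun_prop)
    (fun ε hε x hx => abs_le.2
      ⟨by linarith [husq ε hε x hx, hvsq ε hε x hx],
        by linarith [sq_nonneg ‖u ε x‖, sq_nonneg ‖v ε x‖]⟩)
    hlapu (fun ε hε x hx => (hunorm ε hε x hx).trans (by norm_num))
    (tendsto_rescaled_integral_sq hΩo hF (fun ε _ x _ => by
      nlinarith [sq_nonneg (2 - ‖u ε x‖ ^ 2 - ‖v ε x‖ ^ 2), sq_nonneg (1 - ‖u ε x‖ ^ 2)]) hT)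
    (tendsto_rescaled_integral_sq hΩo hF (fun ε _ x _ => by
      nlinarith [sq_nonneg ((2 - ‖u ε x‖ ^ 2 - ‖v ε x‖ ^ 2) - (1 - ‖u ε x‖ ^ 2))]) hT) hτ
  have hTv := fun τ (hτ : (0 : ℝ) < τ) => eventually_integral_gradSq_le hΩo hΩbdd hs hx₀ hψ1
    (A := fun ε x => 2 - ‖u ε x‖ ^ 2 - ‖v ε x‖ ^ 2) hv1 hv2 hvψ
    (fun ε hε => by
      have h1 := huc ε hε
      have h2 := hvc ε hε
      fun_prop)
    (fun ε hε x hx => abs_le.2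
      ⟨by linarith [husq ε hε x hx, hvsq ε hε x hx],
        by linarith [sq_nonneg ‖u ε x‖, sq_nonneg ‖v ε x‖]⟩)
    hlapv (fun ε hε x hx => (hvnorm ε hε x hx).trans (by norm_num))
    (tendsto_rescaled_integral_sq hΩo hF (fun ε _ x _ => by
      nlinarith [sq_nonneg ((2 - ‖u ε x‖ ^ 2 - ‖v ε x‖ ^ 2) + (1 - ‖u ε x‖ ^ 2))]) hT)
    (tendsto_rescaled_integral_sq hΩo hF (fun ε _ x _ => by
      nlinarith [sq_nonneg (2 - ‖u ε x‖ ^ 2 - ‖v ε x‖ ^ 2), sq_nonneg (1 - ‖u ε x‖ ^ 2)]) hT) hτ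
  have hintR : ∀ {f : Pt → ℝ}, ContDiffOn ℝ 1 f (closure Ω) → IntegrableOn (gradSqR f) Ω :=
    fun {f} hf => by
      obtain ⟨K, hK⟩ := exists_norm_fderiv_le hΩo hΩbdd hf
      exact integrableOn_of_continuousOn_of_bound hΩo hΩbdd
        (continuousOn_gradSqR hΩo (hf.mono subset_closure)) fun x hx => by
          rw [abs_of_nonneg (gradSqR_nonneg f x)]; exact gradSqR_le (hK x hx)
  have hint : ∀ {w : Pt → ℂ}, ContDiffOn ℝ 1 w (closure Ω) → ContDiffOn ℝ 2 w Ω →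
      IntegrableOn (gradSq w) Ω := fun {w} hw hw2 => by
    obtain ⟨K, hK⟩ := exists_norm_fderiv_le hΩo hΩbdd hw
    exact integrableOn_of_continuousOn_of_bound hΩo hΩbdd (continuousOn_gradSq hΩo hw2)
      fun x hx => by rw [abs_of_nonneg (gradSq_nonneg w x)]; exact gradSq_le (hK x hx)
  have hlimit : ∫ x in Ω, (gradSq u₀ x + gradSq v₀ x) =
      (∫ x in Ω, gradSqR φ x) + ∫ x in Ω, gradSqR ψ x := by
    rw [← integral_add (hintR hφ1) (hintR hψ1)]
    refine setIntegral_congr_fun hΩo.measurableSet fun x hx => ?_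
    have hx' := hΩo.mem_nhds hx
    simp only [funext hu₀, funext hv₀,
      gradSq_exp_phase ((hφ2.differentiableOn two_ne_zero).differentiableAt hx'),
      gradSq_exp_phase ((hψ2.differentiableOn two_ne_zero).differentiableAt hx')]
  rw [hlimit] at hC₄b
  obtain ⟨τ, hτ, hlt⟩ := exists_between hC₄b
  obtain ⟨ε, hε, h1, h2, h3⟩ := ((eventually_mem_nhdsWithin (a := (0 : ℝ)) (s := Set.Ioi 0)).and
    (hC₄a.and ((hTu (C₄ - τ) (by linarith)).and (hTv (C₄ - τ) (by linarith))))).exists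
  have hε : 0 < ε := hε
  rw [integral_add (hint (hu1 ε hε) (hu2 ε hε)) (hint (hv1 ε hε) (hv2 ε hε))] at h1
  linarith
end
end

section
/- Assume there are constants γ₃, γ₄ ≥ 0 with limsup_{ε→0⁺} ε⁻² ∫_Ω (1 − |u_ε|²)² dx ≤ γ₃ and limsup_{ε→0⁺} ε⁻² ∫_Ω (1 − |v_ε|²)² dx ≤ γ₄. Suppose there exists a real constant C₆ such that for all sufficiently small ε > 0 one has (1/2)∫_Ω (|∇u_ε|² + |∇v_ε|²) dx ≥ C₆ > (1/2)∫_Ω (|∇u₀|² + |∇v₀|²) dx + √(γ₁γ₃) + √(γ₁γ₄). Then it is not the case that both sup_{closure(Ω)} ||u_ε| − 1| → 0 and sup_{closure(Ω)} ||v_ε| − 1| → 0 as ε → 0⁺; that is, either |u_ε| or |v_ε| fails to converge uniformly to 1 on the closure of Ω. -/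
open MeasureTheory Filter Topology

noncomputable section

theorem isPreconnected_compl_of_starConvex {Ω : Set Pt} (hne : Ω.Nonempty)
    (hb : Bornology.IsBounded Ω) (hstar : ∃ x₀, StarConvex ℝ x₀ Ω) : IsPreconnected Ωᶜ := by
  obtain ⟨x₀, hx₀⟩ := hstar
  have hx₀Ω : x₀ ∈ Ω := hx₀.mem hne
  obtain ⟨R, hR⟩ := hb.subset_ball x₀
  have hray : ∀ x ∈ Ωᶜ, (fun t : ℝ => x₀ + t • (x - x₀)) '' Set.Ici 1 ⊆ Ωᶜ := by
    rintro x hx _ ⟨t, ht, rfl⟩ hmem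
    have ht : 1 ≤ t := ht
    apply hx
    have h2 := hx₀.add_smul_sub_mem hmem (t := t⁻¹) (by positivity) (inv_le_one_of_one_le₀ ht)
    convert h2 using 1
    rw [add_sub_cancel_left, smul_smul, inv_mul_cancel₀ (by positivity)]
    simp
  have hrayc : ∀ x, IsPreconnected ((fun t : ℝ => x₀ + t • (x - x₀)) '' Set.Ici 1) := fun x =>
    isPreconnected_Ici.image _ (by fun_prop)
  refine isPreconnected_of_forall_pair fun x hx y hy => ?_
  set r := max R (max (dist x x₀) (dist y x₀)) with hr
  have hrank : 1 < Module.rank ℝ Pt := by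
    rw [← Module.finrank_eq_rank]
    simp
  have hmeet : ∀ z ∈ Ωᶜ, dist z x₀ ≤ r →
      (((fun t : ℝ => x₀ + t • (z - x₀)) '' Set.Ici 1) ∩ Metric.sphere x₀ r).Nonempty := by
    intro z hz hzr
    have hzx : 0 < dist z x₀ := dist_pos.2 (fun h => hz (h ▸ hx₀Ω))
    refine ⟨_, ⟨r / dist z x₀, ?_, rfl⟩, ?_⟩
    · exact (one_le_div hzx).2 hzr
    · simp only [Metric.mem_sphere, dist_eq_norm, add_sub_cancel_left, norm_smul]
      rw [← dist_eq_norm, Real.norm_of_nonneg (div_nonneg (hzx.le.trans hzr) hzx.le)]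
      field_simp
  have hS : Metric.sphere x₀ r ⊆ Ωᶜ := by
    intro z hz hzΩ
    have h1 := Metric.mem_ball.1 (hR hzΩ)
    have h2 := Metric.mem_sphere.1 hz
    have : R ≤ r := le_max_left _ _
    linarith
  have hSc := isPreconnected_sphere hrank x₀ r
  refine ⟨((fun t : ℝ => x₀ + t • (x - x₀)) '' Set.Ici 1) ∪ Metric.sphere x₀ r ∪
    ((fun t : ℝ => x₀ + t • (y - x₀)) '' Set.Ici 1),
    Set.union_subset (Set.union_subset (hray x hx) hS) (hray y hy), ?_, ?_, ?_⟩
  · exact Or.inl (Or.inl ⟨1, Set.self_mem_Ici, by simp⟩)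
  · exact Or.inr ⟨1, Set.self_mem_Ici, by simp⟩
  · have h1 := IsPreconnected.union' (hmeet x hx ((le_max_left _ _).trans (le_max_right _ _)))
      (hrayc x) hSc
    refine IsPreconnected.union' ?_ h1 (hrayc y)
    obtain ⟨z, hz1, hz2⟩ := hmeet y hy ((le_max_right _ _).trans (le_max_right _ _))
    exact ⟨z, Or.inr hz2, hz1⟩

/-- A nonvanishing function on the closure of a bounded star-shaped planar domain which equals `1`
on the boundary has a continuous angular function vanishing outside the domain. -/
theorem exists_angle_eq_zero_off {Ω : Set Pt} (hΩo : IsOpen Ω) (hne : Ω.Nonempty)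
    (hb : Bornology.IsBounded Ω) (hstar : ∃ x₀, StarConvex ℝ x₀ Ω) {h : Pt → ℂ}
    (hc : ContinuousOn h (closure Ω)) (h0 : ∀ x ∈ closure Ω, h x ≠ 0)
    (h1 : ∀ x ∈ frontier Ω, h x = 1) :
    ∃ L : Pt → ℂ, Continuous L ∧ (∀ x ∈ Ω, Complex.exp (L x) = h x) ∧ ∀ x ∉ Ω, L x = 0 := by
  classical
  set H : Pt → ℂ := Set.piecewise Ω h (fun _ => 1) with hH
  have hHc : Continuous H := by
    apply continuous_piecewise h1 hc continuousOn_const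
  have hH0 : (0 : ℂ) ∉ H '' Set.univ := by
    rintro ⟨x, -, hx⟩
    by_cases hxΩ : x ∈ Ω
    · rw [hH, Set.piecewise_eq_of_mem _ _ _ hxΩ] at hx
      exact h0 x (subset_closure hxΩ) hx
    · rw [hH, Set.piecewise_eq_of_notMem _ _ _ hxΩ] at hx
      exact one_ne_zero hx
  obtain ⟨a, ha⟩ : Ωᶜ.Nonempty := by
    rw [Set.nonempty_compl]
    rintro rfl
    exact NormedSpace.unbounded_univ ℝ Pt hb
  have hHa : H a = 1 := Set.piecewise_eq_of_notMem _ _ _ ha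
  obtain ⟨L, ⟨hLa, hL⟩, -⟩ := Complex.isCoveringMapOn_exp.existsUnique_continuousMap_lifts
    (⟨H, hHc⟩ : C(Pt, ℂ)) (a₀ := a) (e₀ := 0) (by simp [hHa])
    (fun x hx => hH0 ⟨x, trivial, hx⟩)
  have hLe : ∀ x, Complex.exp (L x) = H x := fun x => congr_fun hL x
  refine ⟨L, L.continuous, fun x hx => ?_, ?_⟩
  · rw [hLe, hH, Set.piecewise_eq_of_mem _ _ _ hx]
  have hint : ∀ x ∉ Ω, ∃ n : ℤ, L x = n * (2 * Real.pi * Complex.I) := fun x hx => by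
    rw [← Complex.exp_eq_one_iff, hLe, hH, Set.piecewise_eq_of_notMem _ _ _ hx]
  have hdisc : IsDiscrete (Set.range ((↑) : ℤ → ℝ)) :=
    Int.isClosedEmbedding_coe_real.isEmbedding.isDiscrete_range
  have hmaps : Set.MapsTo (fun x => (L x).im / (2 * Real.pi)) Ωᶜ (Set.range ((↑) : ℤ → ℝ)) := by
    intro x hx
    obtain ⟨n, hn⟩ := hint x hx
    refine ⟨n, ?_⟩
    simp only [hn]
    simp
  intro x hx
  have h2 : (L x).im / (2 * Real.pi) = (L a).im / (2 * Real.pi) :=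
    (isPreconnected_compl_of_starConvex hne hb hstar).constant_of_mapsTo hdisc
      (f := fun x => (L x).im / (2 * Real.pi)) (by fun_prop) hmaps hx ha
  obtain ⟨n, hn⟩ := hint x hx
  rw [hLa, hn] at h2
  have h3 : (n : ℝ) = 0 := by
    simpa [Real.pi_ne_zero] using h2
  rw [hn]
  have : n = 0 := by exact_mod_cast h3
  simp [this]

theorem hasFDerivAt_of_exp_eq {E : Type*} [NormedAddCommGroup E] [NormedSpace ℝ E]
    {L h : E → ℂ} {h' : E →L[ℝ] ℂ} {x : E} (hL : ContinuousAt L x)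
    (he : ∀ᶠ y in 𝓝 x, Complex.exp (L y) = h y) (hh : HasFDerivAt h h' x) :
    HasFDerivAt L ((h x)⁻¹ • h') x := by
  have hx : Complex.exp (L x) = h x := he.self_of_nhds
  have hx0 : h x ≠ 0 := hx ▸ Complex.exp_ne_zero _
  have h1 : HasFDerivAt (fun y => Complex.log ((h x)⁻¹ * h y)) ((h x)⁻¹ • h') x := by
    have h2 := hh.const_mul (h x)⁻¹
    have h3 : HasDerivAt Complex.log 1 ((h x)⁻¹ * h x) := by
      rw [inv_mul_cancel₀ hx0]
      simpa using Complex.hasDerivAt_log Complex.one_mem_slitPlane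
    have h4 := (h3.hasFDerivAt.restrictScalars ℝ).comp x h2
    have h5 : (ContinuousLinearMap.restrictScalars ℝ
        (ContinuousLinearMap.toSpanSingleton ℂ (1 : ℂ))).comp ((h x)⁻¹ • h') = (h x)⁻¹ • h' := by
      ext v
      simp
    rw [h5] at h4
    exact h4
  have h4 : ∀ᶠ y in 𝓝 x, L y = L x + Complex.log ((h x)⁻¹ * h y) := by
    have h5 : Tendsto (fun y => (L y - L x).im) (𝓝 x) (𝓝 0) := by
      have : Tendsto (fun y => (L y - L x).im) (𝓝 x) (𝓝 (L x - L x).im) :=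
        (Complex.continuous_im.tendsto _).comp (hL.sub continuousAt_const)
      simpa using this
    filter_upwards [he, h5.eventually (gt_mem_nhds Real.pi_pos),
      h5.eventually (lt_mem_nhds (neg_lt_zero.2 Real.pi_pos))] with y hy h6 h7
    rw [← hx, ← hy, ← Complex.exp_neg, ← Complex.exp_add, neg_add_eq_sub,
      Complex.log_exp h7 h6.le]
    ring
  exact (h1.const_add (L x)).congr_of_eventuallyEq h4

/-- A `C¹` function on the closure of a bounded open set has bounded derivative on the set. -/
theorem ContDiffOn.exists_bound_norm_fderiv {E : Type*} [NormedAddCommGroup E] [NormedSpace ℝ E]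
    {Ω : Set Pt} (hΩo : IsOpen Ω) (hb : Bornology.IsBounded Ω)
    {f : Pt → E} (hf : ContDiffOn ℝ 1 f (closure Ω)) :
    ∃ C, ∀ x ∈ Ω, ‖fderiv ℝ f x‖ ≤ C := by
  have hK : IsCompact (closure Ω) := hb.isCompact_closure
  suffices H : ∃ C, ∀ x ∈ closure Ω ∩ Ω, ‖fderiv ℝ f x‖ ≤ C from
    H.imp fun C hC x hx => hC x ⟨subset_closure hx, hx⟩
  refine hK.induction_on (p := fun t => ∃ C, ∀ x ∈ t ∩ Ω, ‖fderiv ℝ f x‖ ≤ C) ⟨0, by simp⟩ ?_ ?_ ?_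
  · rintro s t hst ⟨C, hC⟩
    exact ⟨C, fun x hx => hC x ⟨hst hx.1, hx.2⟩⟩
  · rintro s t ⟨C, hC⟩ ⟨D, hD⟩
    refine ⟨max C D, ?_⟩
    rintro x ⟨hx | hx, hxΩ⟩
    · exact (hC x ⟨hx, hxΩ⟩).trans (le_max_left _ _)
    · exact (hD x ⟨hx, hxΩ⟩).trans (le_max_right _ _)
  · intro x hx
    have h1 : ContDiffWithinAt ℝ (0 + 1) f (closure Ω) x := by simpa using hf x hx
    obtain ⟨t, ht, -, -, f', hf', hc⟩ :=
      (contDiffWithinAt_succ_iff_hasFDerivWithinAt' (by simp)).1 h1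
    rw [Set.insert_eq_of_mem hx] at ht
    have hcont : ContinuousWithinAt f' (closure Ω) x := hc.continuousWithinAt
    have hlt : ∀ᶠ y in 𝓝[closure Ω] x, ‖f' y‖ < ‖f' x‖ + 1 :=
      hcont.norm.eventually (gt_mem_nhds (by linarith))
    refine ⟨t ∩ {y | ‖f' y‖ < ‖f' x‖ + 1}, inter_mem ht hlt, ‖f' x‖ + 1, ?_⟩
    rintro y ⟨⟨hyt, hy⟩, hyΩ⟩
    have hcl : closure Ω ∈ 𝓝 y := mem_of_superset (hΩo.mem_nhds hyΩ) subset_closure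
    rw [((hf' y hyt).hasFDerivAt hcl).fderiv]
    exact hy.le

theorem ae_fderiv_eq_zero_of_eq_zero {w : Pt → ℝ} {Ω : Set Pt} (hΩ : MeasurableSet Ω)
    (hw : Measurable w) (hd : ∀ x ∈ Ω, DifferentiableAt ℝ w x) :
    ∀ᵐ x ∂(volume.restrict Ω), w x = 0 → fderiv ℝ w x = 0 := by
  set e : Pt := EuclideanSpace.single 0 1
  set A : ℝ →L[ℝ] Pt := (ContinuousLinearMap.id ℝ ℝ).smulRight e with hA
  have hS : MeasurableSet (Ω ∩ w ⁻¹' {0}) := hΩ.inter (hw (measurableSet_singleton 0))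
  have happ : ApproximatesLinearOn (fun x => A (w x)) (0 : Pt →L[ℝ] Pt) (Ω ∩ w ⁻¹' {0}) 0 := by
    rintro x ⟨-, hx⟩ y ⟨-, hy⟩
    have hx : w x = 0 := hx
    have hy : w y = 0 := hy
    simp [hx, hy]
  have h := happ.norm_fderiv_sub_le volume hS (fun x => A.comp (fderiv ℝ w x))
    (fun x hx => (A.hasFDerivAt.comp x (hd x hx.1).hasFDerivAt).hasFDerivWithinAt)
  rw [ae_restrict_iff' hS] at h
  rw [ae_restrict_iff' hΩ]
  filter_upwards [h] with x hx hxΩ hx0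
  have h1 : A.comp (fderiv ℝ w x) = 0 := by
    have := hx ⟨hxΩ, hx0⟩
    simpa using this
  ext v
  have h2 : A (fderiv ℝ w x v) = 0 := by
    rw [← ContinuousLinearMap.comp_apply, h1]; rfl
  have h3 : fderiv ℝ w x v • e = 0 := h2
  simpa [e] using h3

/-- A `C¹` truncation at scale `(n + 1)⁻¹`, vanishing near zero. -/
theorem exists_truncation_s15 : ∃ g g' : ℕ → ℝ → ℝ,
    (∀ n t, HasDerivAt (g n) (g' n t) t) ∧ (∀ n, Continuous (g' n)) ∧
    (∀ n t, 0 ≤ g' n t ∧ g' n t ≤ 1) ∧ (∀ (n : ℕ) t, |t| ≤ 1 / ((n : ℝ) + 1) → g n t = 0) ∧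
    (∀ n t, |g n t| ≤ |t|) ∧ (∀ t, Tendsto (fun n => g n t) atTop (𝓝 t)) ∧
    (∀ t, t ≠ 0 → Tendsto (fun n => g' n t) atTop (𝓝 1)) := by
  set g' : ℕ → ℝ → ℝ := fun n t => max 0 (min 1 ((n + 1) * |t| - 1)) with hg'
  have hc : ∀ n, Continuous (g' n) := fun n => by fun_prop
  have h01 : ∀ n t, 0 ≤ g' n t ∧ g' n t ≤ 1 := fun n t =>
    ⟨le_max_left _ _, max_le zero_le_one (min_le_left _ _)⟩
  have hlim : ∀ t, t ≠ 0 → Tendsto (fun n => g' n t) atTop (𝓝 1) := by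
    intro t ht
    refine tendsto_const_nhds.congr' ?_
    have : Tendsto (fun n : ℕ => ((n : ℝ) + 1) * |t| - 1) atTop atTop :=
      tendsto_atTop_add_const_right _ _ ((tendsto_atTop_add_const_right _ _
        tendsto_natCast_atTop_atTop).atTop_mul_const (abs_pos.2 ht))
    filter_upwards [this.eventually_ge_atTop 1] with n hn
    simp only [hg']
    rw [min_eq_left hn]; simp
  refine ⟨fun n t => ∫ r in (0 : ℝ)..t, g' n r, g', fun n t => ?_, hc, h01, fun n t ht => ?_,
    fun n t => ?_, fun t => ?_, hlim⟩
  · exact intervalIntegral.integral_hasDerivAt_right ((hc n).intervalIntegrable _ _)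
      (hc n).aestronglyMeasurable.stronglyMeasurableAtFilter (hc n).continuousAt
  · have : ∀ r ∈ Set.uIcc 0 t, g' n r = 0 := by
      intro r hr
      have hrt : |r| ≤ |t| := by simpa using Set.abs_sub_left_of_mem_uIcc hr
      simp only [hg']
      apply max_eq_left
      refine (min_le_right _ _).trans ?_
      have := (le_div_iff₀ (by positivity : (0 : ℝ) < n + 1)).1 (hrt.trans ht)
      linarith
    simpa using intervalIntegral.integral_congr (g := fun _ => (0 : ℝ)) this
  · have := intervalIntegral.norm_integral_le_of_norm_le_const (a := 0) (b := t) (f := g' n) (C := 1)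
      (fun r _ => by rw [Real.norm_of_nonneg (h01 n r).1]; exact (h01 n r).2)
    simpa using this
  · have h := intervalIntegral.tendsto_integral_filter_of_dominated_convergence
      (μ := volume) (a := 0) (b := t) (F := g') (f := fun _ => (1 : ℝ)) (l := atTop) (fun _ => 1)
      (Eventually.of_forall fun n => (hc n).aestronglyMeasurable)
      (Eventually.of_forall fun n => ae_of_all _ fun r _ => by
        rw [Real.norm_of_nonneg (h01 n r).1]; exact (h01 n r).2)
      intervalIntegrable_const
      (by
        have : ∀ᵐ r : ℝ, r ≠ 0 := by simp [ae_iff]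
        filter_upwards [this] with r hr _ using hlim r hr)
    simpa using h

theorem integrableOn_of_bounded {Ω : Set Pt} (hΩo : IsOpen Ω) (hb : Bornology.IsBounded Ω)
    {f : Pt → ℝ} (hf : AEStronglyMeasurable f (volume.restrict Ω)) {C : ℝ}
    (hC : ∀ x ∈ Ω, |f x| ≤ C) : IntegrableOn f Ω :=
  IntegrableOn.of_bound hb.measure_lt_top hf C ((ae_restrict_iff' hΩo.measurableSet).2
    (ae_of_all _ hC))

/-- Integration by parts against a function vanishing continuously on the boundary, with no
regularity of the boundary. -/
theorem integral_grad_mul_eq {Ω : Set Pt} (hΩo : IsOpen Ω) (hb : Bornology.IsBounded Ω)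
    {w : Pt → ℝ} (hw : Continuous w) (hw0 : ∀ x ∉ Ω, w x = 0)
    (hwd : ∀ x ∈ Ω, DifferentiableAt ℝ w x) {Cw : ℝ} (hwb : ∀ x ∈ Ω, ∀ i, |pdR w x i| ≤ Cw)
    {F : Fin 2 → Pt → ℝ} (hF : ∀ i, ContDiffOn ℝ 1 (F i) Ω) {CF : ℝ}
    (hFb : ∀ i, ∀ x ∈ Ω, |F i x| ≤ CF)
    {G : Pt → ℝ} (hG : ∀ x ∈ Ω, ∑ i, pdR (F i) x i = G x) {CG : ℝ}
    (hGb : ∀ x ∈ Ω, |G x| ≤ CG) (hGm : AEStronglyMeasurable G (volume.restrict Ω)) :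
    ∫ x in Ω, ∑ i, pdR w x i * F i x = - ∫ x in Ω, w x * G x := by
  obtain ⟨g, g', hg, hg'c, hg01, hg0, hgle, hglim, hg'lim⟩ := exists_truncation_s15
  obtain ⟨M, hM⟩ := hb.isCompact_closure.exists_bound_of_continuousOn hw.continuousOn
  have hMΩ : ∀ x ∈ Ω, |w x| ≤ M := fun x hx => hM x (subset_closure hx)
  have hpm : ∀ i, Measurable fun x => pdR w x i := fun i =>
    measurable_fderiv_apply_const ℝ w _
  have hFm : ∀ i, AEStronglyMeasurable (F i) (volume.restrict Ω) := fun i =>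
    (hF i).continuousOn.aestronglyMeasurable hΩo.measurableSet
  have key : ∀ n, ∫ x in Ω, g n (w x) * G x =
      - ∫ x in Ω, g' n (w x) * ∑ i, pdR w x i * F i x := by
    intro n
    set K : Set Pt := {x | 1 / ((n : ℝ) + 1) ≤ |w x|} with hK
    have hKcl : IsClosed K := isClosed_le continuous_const (by fun_prop)
    have hKΩ : K ⊆ Ω := by
      intro x hx
      by_contra hxΩ
      have h1 : 1 / ((n : ℝ) + 1) ≤ |w x| := hx
      rw [hw0 x hxΩ, abs_zero] at h1
      have : 0 < 1 / ((n : ℝ) + 1) := by positivity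
      linarith
    have hKc : IsCompact K := Metric.isCompact_of_isClosed_isBounded hKcl (hb.subset hKΩ)
    have hzero : ∀ x ∉ K, g n (w x) = 0 := fun x hx => hg0 n _ (not_le.1 hx).le
    have hts : tsupport (fun x => g n (w x)) ⊆ K :=
      closure_minimal (fun x hx => by_contra fun h => hx (hzero x h)) hKcl
    have hder : ∀ x ∈ Ω, HasFDerivAt (fun x => g n (w x)) (g' n (w x) • fderiv ℝ w x) x :=
      fun x hx => (hg n (w x)).comp_hasFDerivAt x (hwd x hx).hasFDerivAt
    have hder0 : ∀ x ∉ K, HasFDerivAt (fun x => g n (w x)) (0 : Pt →L[ℝ] ℝ) x := by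
      intro x hx
      refine (hasFDerivAt_const (0 : ℝ) x).congr_of_eventuallyEq ?_
      filter_upwards [hKcl.isOpen_compl.mem_nhds hx] with y hy using hzero y hy
    have hgc : Continuous fun x => g n (w x) :=
      (continuous_iff_continuousAt.2 fun t => (hg n t).continuousAt).comp hw
    have hgd : ∀ x, DifferentiableAt ℝ (fun x => g n (w x)) x := fun x => by
      by_cases hx : x ∈ K
      · exact (hder x (hKΩ hx)).differentiableAt
      · exact (hder0 x hx).differentiableAt
    have hdF : ∀ i, ContinuousOn (fun x => pdR (F i) x i) Ω := fun i =>
      ((hF i).continuousOn_fderiv_of_isOpen hΩo le_rfl).clm_apply continuousOn_const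
    have hIK : ∀ f : Pt → ℝ, ContinuousOn f Ω → Integrable fun x => g n (w x) * f x := by
      intro f hf
      rw [← integrableOn_iff_integrable_of_support_subset (s := K)]
      · exact (hgc.continuousOn.mul (hf.mono hKΩ)).integrableOn_compact hKc
      · intro x hx
        by_contra h
        exact hx (by simp [hzero x h])
    have hsupp : ∀ i, (Function.support fun x => fderiv ℝ (fun x => g n (w x)) x
        (EuclideanSpace.single i 1) * F i x) ⊆ Ω := by
      intro i x hx
      by_contra h
      apply hx
      simp [(hder0 x (fun hk => h (hKΩ hk))).fderiv]
    have hI : ∀ i, IntegrableOn (fun x => fderiv ℝ (fun x => g n (w x)) x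
        (EuclideanSpace.single i 1) * F i x) Ω := by
      intro i
      refine integrableOn_of_bounded hΩo hb (C := Cw * CF)
        ((measurable_fderiv_apply_const ℝ _ _).aestronglyMeasurable.mul (hFm i)) fun x hx => ?_
      rw [(hder x hx).fderiv, abs_mul]
      refine mul_le_mul ?_ (hFb i x hx) (abs_nonneg _) ((abs_nonneg _).trans (hwb x hx i))
      have h1 : |g' n (w x)| ≤ 1 := by rw [abs_of_nonneg (hg01 n _).1]; exact (hg01 n _).2
      have h2 : |g' n (w x)| * |pdR w x i| ≤ 1 * Cw :=
        mul_le_mul h1 (hwb x hx i) (abs_nonneg _) zero_le_one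
      simpa [pdR, abs_mul] using h2
    have hparts : ∀ i, ∫ x in Ω, g n (w x) * pdR (F i) x i =
        - ∫ x in Ω, g' n (w x) * (pdR w x i * F i x) := by
      intro i
      have h1 := integral_mul_fderiv_eq_neg_fderiv_mul_of_integrable (μ := (volume : Measure Pt))
        (f := fun x => g n (w x)) (g := F i) (v := EuclideanSpace.single i 1)
        ((integrableOn_iff_integrable_of_support_subset (hsupp i)).1 (hI i))
        (hIK _ (hdF i)) (hIK _ (hF i).continuousOn) (fun x _ => hgd x)
        (fun x hx => ((hF i).differentiableOn one_ne_zero).differentiableAt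
          (hΩo.mem_nhds (hKΩ (hts hx))))
      have h2 : ∫ x in Ω, g n (w x) * fderiv ℝ (F i) x (EuclideanSpace.single i 1) =
          ∫ x, g n (w x) * fderiv ℝ (F i) x (EuclideanSpace.single i 1) :=
        setIntegral_eq_integral_of_forall_compl_eq_zero fun x hx => by
          rw [hzero x fun hk => hx (hKΩ hk), zero_mul]
      have h3 := setIntegral_eq_integral_of_forall_compl_eq_zero (μ := (volume : Measure Pt))
        (fun x hx => by_contra fun h => hx (hsupp i h))
      rw [← h2, ← h3] at h1
      refine h1.trans (congrArg Neg.neg (setIntegral_congr_fun hΩo.measurableSet fun x hx => ?_))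
      simp [(hder x hx).fderiv, pdR, mul_assoc]
    have hI' : ∀ i, IntegrableOn (fun x => g' n (w x) * (pdR w x i * F i x)) Ω := fun i =>
      (hI i).congr_fun (fun x hx => by simp [(hder x hx).fderiv, pdR, mul_assoc])
        hΩo.measurableSet
    calc ∫ x in Ω, g n (w x) * G x = ∫ x in Ω, ∑ i, g n (w x) * pdR (F i) x i :=
          setIntegral_congr_fun hΩo.measurableSet fun x hx => by
            simp only [← hG x hx, Finset.mul_sum]
      _ = ∑ i, ∫ x in Ω, g n (w x) * pdR (F i) x i :=
          integral_finsetSum _ fun i _ => (hIK _ (hdF i)).integrableOn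
      _ = - ∑ i, ∫ x in Ω, g' n (w x) * (pdR w x i * F i x) := by
          simp [hparts, Finset.sum_neg_distrib]
      _ = - ∫ x in Ω, ∑ i, g' n (w x) * (pdR w x i * F i x) := by
          rw [integral_finsetSum _ fun i _ => hI' i]
      _ = _ := by simp only [Finset.mul_sum]
  have hlim1 : Tendsto (fun n => ∫ x in Ω, g n (w x) * G x) atTop (𝓝 (∫ x in Ω, w x * G x)) := by
    refine tendsto_integral_of_dominated_convergence (fun _ => M * CG) (fun n => ?_)
      (integrableOn_const hb.measure_lt_top.ne) (fun n => ?_) ?_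
    · exact ((continuous_iff_continuousAt.2 fun t => (hg n t).continuousAt).comp
        hw).aestronglyMeasurable.mul hGm
    · refine (ae_restrict_iff' hΩo.measurableSet).2 (ae_of_all _ fun x hx => ?_)
      rw [Real.norm_eq_abs, abs_mul]
      exact mul_le_mul ((hgle n _).trans (hMΩ x hx)) (hGb x hx) (abs_nonneg _)
        ((abs_nonneg _).trans (hMΩ x hx))
    · exact ae_of_all _ fun x => (hglim (w x)).mul_const _
  have hlim2 : Tendsto (fun n => ∫ x in Ω, g' n (w x) * ∑ i, pdR w x i * F i x) atTop
      (𝓝 (∫ x in Ω, ∑ i, pdR w x i * F i x)) := by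
    refine tendsto_integral_of_dominated_convergence (fun _ => ∑ _i : Fin 2, Cw * CF) (fun n => ?_)
      (integrableOn_const hb.measure_lt_top.ne) (fun n => ?_) ?_
    · exact ((hg'c n).comp hw).aestronglyMeasurable.mul
        (Finset.aestronglyMeasurable_fun_sum _ fun i _ =>
          (hpm i).aestronglyMeasurable.mul (hFm i))
    · refine (ae_restrict_iff' hΩo.measurableSet).2 (ae_of_all _ fun x hx => ?_)
      rw [Real.norm_eq_abs, abs_mul]
      have h1 : |g' n (w x)| ≤ 1 := by rw [abs_of_nonneg (hg01 n _).1]; exact (hg01 n _).2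
      have h2 : |∑ i, pdR w x i * F i x| ≤ ∑ _i : Fin 2, Cw * CF := by
        refine (Finset.abs_sum_le_sum_abs _ _).trans (Finset.sum_le_sum fun i _ => ?_)
        rw [abs_mul]
        exact mul_le_mul (hwb x hx i) (hFb i x hx) (abs_nonneg _)
          ((abs_nonneg _).trans (hwb x hx i))
      exact (mul_le_mul h1 h2 (abs_nonneg _) zero_le_one).trans_eq (one_mul _)
    · filter_upwards [ae_fderiv_eq_zero_of_eq_zero hΩo.measurableSet hw.measurable hwd] with x hx
      by_cases h : w x = 0
      · simp [pdR, hx h]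
      · simpa using (hg'lim _ h).mul_const (∑ i, pdR w x i * F i x)
  have h := tendsto_nhds_unique hlim1 (by simpa only [key] using hlim2.neg)
  rw [h, neg_neg]

/-- `f` is continuous and bounded on `Ω`. -/
def BddContOn (Ω : Set Pt) (f : Pt → ℝ) : Prop :=
  ContinuousOn f Ω ∧ ∃ C, ∀ x ∈ Ω, |f x| ≤ C

namespace BddContOn

variable {Ω : Set Pt} {f g : Pt → ℝ}

theorem mul (hf : BddContOn Ω f) (hg : BddContOn Ω g) : BddContOn Ω fun x => f x * g x := by
  obtain ⟨hf, C, hC⟩ := hf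
  obtain ⟨hg, D, hD⟩ := hg
  refine ⟨hf.mul hg, C * D, fun x hx => ?_⟩
  rw [abs_mul]
  exact mul_le_mul (hC x hx) (hD x hx) (abs_nonneg _) ((abs_nonneg _).trans (hC x hx))

theorem add (hf : BddContOn Ω f) (hg : BddContOn Ω g) : BddContOn Ω fun x => f x + g x := by
  obtain ⟨hf, C, hC⟩ := hf
  obtain ⟨hg, D, hD⟩ := hg
  exact ⟨hf.add hg, C + D, fun x hx => (abs_add_le _ _).trans (add_le_add (hC x hx) (hD x hx))⟩

theorem const (c : ℝ) : BddContOn Ω fun _ => c :=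
  ⟨continuousOn_const, |c|, fun _ _ => le_rfl⟩

theorem sub (hf : BddContOn Ω f) (hg : BddContOn Ω g) : BddContOn Ω fun x => f x - g x := by
  simpa [sub_eq_add_neg] using hf.add ((const (-1)).mul hg)

theorem sum {f : Fin 2 → Pt → ℝ} (hf : ∀ i, BddContOn Ω (f i)) :
    BddContOn Ω fun x => ∑ i, f i x := by
  simpa [Fin.sum_univ_two] using (hf 0).add (hf 1)

theorem inv (hf : BddContOn Ω f) {a : ℝ} (ha : 0 < a) (hfa : ∀ x ∈ Ω, a ≤ f x) :
    BddContOn Ω fun x => (f x)⁻¹ := by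
  refine ⟨hf.1.inv₀ fun x hx => (ha.trans_le (hfa x hx)).ne', a⁻¹, fun x hx => ?_⟩
  rw [abs_inv, abs_of_pos (ha.trans_le (hfa x hx))]
  exact inv_anti₀ ha (hfa x hx)

theorem of_continuousOn_closure (hb : Bornology.IsBounded Ω) (hf : ContinuousOn f (closure Ω)) :
    BddContOn Ω f :=
  ⟨hf.mono subset_closure,
    (hb.isCompact_closure.exists_bound_of_continuousOn hf).imp
      fun _ h x hx => h x (subset_closure hx)⟩

theorem integrableOn (hΩo : IsOpen Ω) (hb : Bornology.IsBounded Ω) (hf : BddContOn Ω f) :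
    IntegrableOn f Ω := by
  obtain ⟨hf, C, hC⟩ := hf
  exact integrableOn_of_bounded hΩo hb (hf.aestronglyMeasurable hΩo.measurableSet) hC

end BddContOn

theorem bddContOn_pd {Ω : Set Pt} (hΩo : IsOpen Ω) (hb : Bornology.IsBounded Ω) {u : Pt → ℂ}
    (hu : ContDiffOn ℝ 1 u (closure Ω)) (i : Fin 2) :
    BddContOn Ω (fun x => (pd u x i).re) ∧ BddContOn Ω (fun x => (pd u x i).im) := by
  obtain ⟨C, hC⟩ := hu.exists_bound_norm_fderiv hΩo hb
  have hc : ContinuousOn (fun x => pd u x i) Ω :=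
    ((hu.mono subset_closure).continuousOn_fderiv_of_isOpen hΩo le_rfl).clm_apply continuousOn_const
  have hle : ∀ x ∈ Ω, ‖pd u x i‖ ≤ C := fun x hx => by
    refine ((fderiv ℝ u x).le_opNorm _).trans ?_
    simpa using hC x hx
  exact ⟨⟨Complex.continuous_re.comp_continuousOn hc, C, fun x hx =>
      (Complex.abs_re_le_norm _).trans (hle x hx)⟩,
    ⟨Complex.continuous_im.comp_continuousOn hc, C, fun x hx =>
      (Complex.abs_im_le_norm _).trans (hle x hx)⟩⟩

theorem bddContOn_pdR {Ω : Set Pt} (hΩo : IsOpen Ω) (hb : Bornology.IsBounded Ω) {φ : Pt → ℝ}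
    (hφ : ContDiffOn ℝ 1 φ (closure Ω)) (i : Fin 2) : BddContOn Ω (fun x => pdR φ x i) := by
  obtain ⟨C, hC⟩ := hφ.exists_bound_norm_fderiv hΩo hb
  refine ⟨((hφ.mono subset_closure).continuousOn_fderiv_of_isOpen hΩo le_rfl).clm_apply
    continuousOn_const, C, fun x hx => ((fderiv ℝ φ x).le_opNorm _).trans ?_⟩
  simpa using hC x hx

theorem bddContOn_gradSq {Ω : Set Pt} (hΩo : IsOpen Ω) (hb : Bornology.IsBounded Ω) {u : Pt → ℂ}
    (hu : ContDiffOn ℝ 1 u (closure Ω)) : BddContOn Ω (gradSq u) := by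
  have h := BddContOn.sum fun i =>
    ((bddContOn_pd hΩo hb hu i).1.mul (bddContOn_pd hΩo hb hu i).1).add
      ((bddContOn_pd hΩo hb hu i).2.mul (bddContOn_pd hΩo hb hu i).2)
  convert h using 2 with x
  simp only [gradSq, ← Complex.normSq_eq_norm_sq, Complex.normSq_apply]

theorem bddContOn_gradSqR {Ω : Set Pt} (hΩo : IsOpen Ω) (hb : Bornology.IsBounded Ω) {φ : Pt → ℝ}
    (hφ : ContDiffOn ℝ 1 φ (closure Ω)) : BddContOn Ω (gradSqR φ) := by
  have h := BddContOn.sum fun i => (bddContOn_pdR hΩo hb hφ i).mul (bddContOn_pdR hΩo hb hφ i)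
  convert h using 2 with x
  simp only [gradSqR, sq]

/-- The divergence of `conj u ∇u`. -/
theorem sum_fderiv_conj_mul_pd {Ω : Set Pt} (hΩo : IsOpen Ω) {u : Pt → ℂ}
    (hu : ContDiffOn ℝ 2 u Ω) {x : Pt} (hx : x ∈ Ω) :
    ∑ i, fderiv ℝ (fun y => (starRingEnd ℂ) (u y) * pd u y i) x (EuclideanSpace.single i 1) =
      (gradSq u x : ℂ) + (starRingEnd ℂ) (u x) * lap u x := by
  have hd : DifferentiableAt ℝ u x :=
    (hu.differentiableOn two_ne_zero).differentiableAt (hΩo.mem_nhds hx)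
  have hpd : ∀ i, DifferentiableAt ℝ (fun y => pd u y i) x := fun i => by
    have h1 : ContDiffOn ℝ 1 (fderiv ℝ u) Ω := hu.fderiv_of_isOpen hΩo (by norm_num)
    exact ((h1.differentiableOn one_ne_zero).differentiableAt (hΩo.mem_nhds hx)).clm_apply
      (differentiableAt_const _)
  have hterm : ∀ i, fderiv ℝ (fun y => (starRingEnd ℂ) (u y) * pd u y i) x
      (EuclideanSpace.single i 1) = ((‖pd u x i‖ ^ 2 : ℝ) : ℂ) + (starRingEnd ℂ) (u x) *
        fderiv ℝ (fun y => pd u y i) x (EuclideanSpace.single i 1) := by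
    intro i
    have hconj : HasFDerivAt (fun y => (starRingEnd ℂ) (u y))
        ((Complex.conjCLE : ℂ →L[ℝ] ℂ).comp (fderiv ℝ u x)) x :=
      (Complex.conjCLE : ℂ →L[ℝ] ℂ).hasFDerivAt.comp x hd.hasFDerivAt
    rw [(hconj.fun_mul (hpd i).hasFDerivAt).fderiv]
    have : (starRingEnd ℂ) (pd u x i) * pd u x i = ((‖pd u x i‖ ^ 2 : ℝ) : ℂ) := by
      rw [mul_comm, Complex.mul_conj, Complex.normSq_eq_norm_sq]
    rw [← this]
    simp [pd]
    ring
  simp only [hterm, Finset.sum_add_distrib, gradSq, lap, Finset.mul_sum]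
  push_cast
  rfl

/-- Dirichlet energy estimate for a map of modulus close to `1` solving `-Δu = c u` with real `c`,
in terms of the phase `φ` of its boundary values. -/
theorem integral_gradSq_le {Ω : Set Pt} (hΩo : IsOpen Ω) (hne : Ω.Nonempty)
    (hb : Bornology.IsBounded Ω) (hstar : ∃ x₀, StarConvex ℝ x₀ Ω) {φ : Pt → ℝ}
    (hφ : ContDiffOn ℝ 1 φ (closure Ω)) {u : Pt → ℂ} (hu1 : ContDiffOn ℝ 1 u (closure Ω))
    (hu2 : ContDiffOn ℝ 2 u Ω) {c : Pt → ℝ} (hc : BddContOn Ω c)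
    (heq : ∀ x ∈ Ω, lap u x = -((c x : ℂ) * u x))
    (hub : ∀ x ∈ frontier Ω, u x = Complex.exp (Complex.I * (φ x : ℂ))) {η : ℝ} (hη0 : 0 ≤ η)
    (hη : η ≤ 1 / 2) (hs : ∀ x ∈ closure Ω, |‖u x‖ ^ 2 - 1| ≤ η) :
    ∫ x in Ω, gradSq u x ≤ (1 + η) * (∫ x in Ω, gradSqR φ x) +
      3 / 2 * η * (∫ x in Ω, gradSq u x) + (1 + η) / 2 * ∫ x in Ω, (‖u x‖ ^ 2 - 1) * c x := by
  have hs' : ∀ x ∈ closure Ω, 1 - η ≤ ‖u x‖ ^ 2 ∧ ‖u x‖ ^ 2 ≤ 1 + η := fun x hx => by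
    have := abs_le.1 (hs x hx)
    constructor <;> linarith
  have hu0 : ∀ x ∈ closure Ω, u x ≠ 0 := by
    intro x hx h0
    have := (hs' x hx).1
    rw [h0, norm_zero] at this
    norm_num at this
    linarith
  have hΩcl : Ω ⊆ closure Ω := subset_closure
  set E : Pt → ℂ := fun x => Complex.exp (-(Complex.I * (φ x : ℂ))) with hE
  have hEc : ContinuousOn E (closure Ω) := by
    have := hφ.continuousOn
    fun_prop
  obtain ⟨L, hLc, hLe, hL0⟩ := exists_angle_eq_zero_off hΩo hne hb hstar (h := fun x => u x * E x)
    (hu1.continuousOn.mul hEc) (fun x hx => mul_ne_zero (hu0 x hx) (Complex.exp_ne_zero _))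
    (fun x hx => by rw [hub x hx, hE, ← Complex.exp_add]; simp)
  set K : Fin 2 → Pt → ℂ := fun i x => (starRingEnd ℂ) (u x) * pd u x i with hK
  set s : Pt → ℝ := fun x => ‖u x‖ ^ 2 with hsdef
  have hspos : ∀ x ∈ Ω, 0 < s x := fun x hx => by
    have := (hs' x (hΩcl hx)).1
    simp only [hsdef]; linarith
  have hud : ∀ x ∈ Ω, HasFDerivAt u (fderiv ℝ u x) x := fun x hx =>
    ((hu2.differentiableOn two_ne_zero).differentiableAt (hΩo.mem_nhds hx)).hasFDerivAt
  have hφd : ∀ x ∈ Ω, HasFDerivAt φ (fderiv ℝ φ x) x := fun x hx =>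
    (((hφ.mono hΩcl).differentiableOn one_ne_zero).differentiableAt (hΩo.mem_nhds hx)).hasFDerivAt
  have hLd : ∀ x ∈ Ω, ∃ L' : Pt →L[ℝ] ℂ, HasFDerivAt L L' x ∧
      ∀ i, L' (EuclideanSpace.single i 1) = K i x / (s x : ℂ) - Complex.I * (pdR φ x i : ℂ) := by
    intro x hx
    have h1 : HasFDerivAt E (E x • -(Complex.I • (Complex.ofRealCLM.comp (fderiv ℝ φ x)))) x := by
      have h2 : HasFDerivAt (fun y => (φ y : ℂ)) (Complex.ofRealCLM.comp (fderiv ℝ φ x)) x :=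
        Complex.ofRealCLM.hasFDerivAt.comp x (hφd x hx)
      exact (h2.const_mul Complex.I).neg.cexp
    have h3 := hasFDerivAt_of_exp_eq hLc.continuousAt
      (by filter_upwards [hΩo.mem_nhds hx] with y hy using hLe y hy) ((hud x hx).fun_mul h1)
    refine ⟨_, h3, fun i => ?_⟩
    have hux := hu0 x (hΩcl hx)
    have hEx : E x ≠ 0 := Complex.exp_ne_zero _
    have hcs : (s x : ℂ) = (starRingEnd ℂ) (u x) * u x := by
      rw [mul_comm, Complex.mul_conj, Complex.normSq_eq_norm_sq]
    have hcu : (starRingEnd ℂ) (u x) ≠ 0 := (map_ne_zero _).2 hux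
    rw [hcs]
    simp [hK, pd, pdR]
    field_simp
    ring
  have hure : ContinuousOn (fun x => (u x).re) (closure Ω) :=
    Complex.continuous_re.comp_continuousOn hu1.continuousOn
  have huim : ContinuousOn (fun x => (u x).im) (closure Ω) :=
    Complex.continuous_im.comp_continuousOn hu1.continuousOn
  have bre := BddContOn.of_continuousOn_closure hb hure
  have bim := BddContOn.of_continuousOn_closure hb huim
  have bs : BddContOn Ω s :=
    BddContOn.of_continuousOn_closure hb (hu1.continuousOn.norm.pow 2)
  have bsi : BddContOn Ω fun x => (s x)⁻¹ := bs.inv (a := 1 / 2) (by norm_num) fun x hx => by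
    have := (hs' x (hΩcl hx)).1
    simp only [hsdef]; linarith
  have bpd := fun i => bddContOn_pd hΩo hb hu1 i
  have bφ := fun i => bddContOn_pdR hΩo hb hφ i
  have bgu := bddContOn_gradSq hΩo hb hu1
  have bgφ := bddContOn_gradSqR hΩo hb hφ
  have bKre : ∀ i, BddContOn Ω fun x => (K i x).re := fun i => by
    convert (bre.mul (bpd i).1).add (bim.mul (bpd i).2) using 2 with x
    simp [hK]
  have bKim : ∀ i, BddContOn Ω fun x => (K i x).im := fun i => by
    convert (bre.mul (bpd i).2).sub (bim.mul (bpd i).1) using 2 with x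
    simp [hK]; ring
  have hKC : ∀ i, ContDiffOn ℝ 1 (K i) Ω := fun i => by
    have h1 : ContDiffOn ℝ 1 (fderiv ℝ u) Ω := hu2.fderiv_of_isOpen hΩo (by norm_num)
    have h2 : ContDiffOn ℝ 1 (fun x => pd u x i) Ω := h1.clm_apply contDiffOn_const
    exact (Complex.conjCLE.contDiff.comp_contDiffOn (hu1.mono hΩcl)).mul h2
  have hdiv : ∀ x ∈ Ω, ∑ i, fderiv ℝ (K i) x (EuclideanSpace.single i 1) =
      ((gradSq u x - c x * s x : ℝ) : ℂ) := by
    intro x hx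
    rw [sum_fderiv_conj_mul_pd hΩo hu2 hx, heq x hx]
    have hcs : (s x : ℂ) = (starRingEnd ℂ) (u x) * u x := by
      rw [mul_comm, Complex.mul_conj, Complex.normSq_eq_norm_sq]
    push_cast
    rw [hcs]
    ring
  have hKd : ∀ i, ∀ x ∈ Ω, HasFDerivAt (K i) (fderiv ℝ (K i) x) x := fun i x hx =>
    (((hKC i).differentiableOn one_ne_zero).differentiableAt (hΩo.mem_nhds hx)).hasFDerivAt
  have hdivre : ∀ x ∈ Ω, ∑ i, pdR (fun x => (K i x).re) x i = gradSq u x - c x * s x := by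
    intro x hx
    have h1 : ∀ i, pdR (fun x => (K i x).re) x i =
        (fderiv ℝ (K i) x (EuclideanSpace.single i 1)).re := fun i => by
      have h : HasFDerivAt (fun x => (K i x).re) (Complex.reCLM.comp (fderiv ℝ (K i) x)) x :=
        Complex.reCLM.hasFDerivAt.comp x (hKd i x hx)
      rw [pdR, h.fderiv]
      rfl
    simp only [h1]
    rw [← Complex.re_sum, hdiv x hx, Complex.ofReal_re]
  have hdivim : ∀ x ∈ Ω, ∑ i, pdR (fun x => (K i x).im) x i = 0 := by
    intro x hx
    have h1 : ∀ i, pdR (fun x => (K i x).im) x i =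
        (fderiv ℝ (K i) x (EuclideanSpace.single i 1)).im := fun i => by
      have h : HasFDerivAt (fun x => (K i x).im) (Complex.imCLM.comp (fderiv ℝ (K i) x)) x :=
        Complex.imCLM.hasFDerivAt.comp x (hKd i x hx)
      rw [pdR, h.fderiv]
      rfl
    simp only [h1]
    rw [← Complex.im_sum, hdiv x hx, Complex.ofReal_im]
  set w₁ : Pt → ℝ := fun x => (L x).im with hw₁
  set w₂ : Pt → ℝ := fun x => 1 - Real.exp (-2 * (L x).re) with hw₂
  have hw₂Ω : ∀ x ∈ Ω, Real.exp (-2 * (L x).re) = (s x)⁻¹ := by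
    intro x hx
    have h1 : ‖u x‖ = Real.exp (L x).re := by
      rw [← Complex.norm_exp, hLe x hx, norm_mul, hE, Complex.norm_exp]
      simp
    rw [hsdef]
    simp only [h1]
    rw [← Real.exp_nat_mul, ← Real.exp_neg]
    congr 1
    push_cast
    ring
  have hw₁d : ∀ x ∈ Ω, ∃ w' : Pt →L[ℝ] ℝ, HasFDerivAt w₁ w' x ∧
      ∀ i, w' (EuclideanSpace.single i 1) = (K i x).im * (s x)⁻¹ - pdR φ x i := by
    intro x hx
    obtain ⟨L', hL', hi⟩ := hLd x hx
    refine ⟨_, Complex.imCLM.hasFDerivAt.comp x hL', fun i => ?_⟩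
    simp [hi, div_eq_mul_inv, ← Complex.ofReal_inv]
  have hw₂d : ∀ x ∈ Ω, ∃ w' : Pt →L[ℝ] ℝ, HasFDerivAt w₂ w' x ∧
      ∀ i, w' (EuclideanSpace.single i 1) = 2 * (K i x).re * ((s x)⁻¹ * (s x)⁻¹) := by
    intro x hx
    obtain ⟨L', hL', hi⟩ := hLd x hx
    have h1 : HasFDerivAt (fun x => (L x).re) (Complex.reCLM.comp L') x :=
      Complex.reCLM.hasFDerivAt.comp x hL'
    refine ⟨_, (h1.const_mul (-2)).exp.const_sub 1, fun i => ?_⟩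
    rw [hw₂Ω x hx]
    simp [hi, div_eq_mul_inv, ← Complex.ofReal_inv]
    ring
  have hp₁ : ∀ i, ∀ x ∈ Ω, pdR w₁ x i = (K i x).im * (s x)⁻¹ - pdR φ x i := fun i x hx => by
    obtain ⟨w', hw', hi⟩ := hw₁d x hx
    rw [pdR, hw'.fderiv, hi]
  have hp₂ : ∀ i, ∀ x ∈ Ω, pdR w₂ x i = 2 * (K i x).re * ((s x)⁻¹ * (s x)⁻¹) := fun i x hx => by
    obtain ⟨w', hw', hi⟩ := hw₂d x hx
    rw [pdR, hw'.fderiv, hi]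
  have bp₁ := fun i => ((bKim i).mul bsi).sub (bφ i)
  have bp₂ := fun i => ((BddContOn.const 2).mul (bKre i)).mul (bsi.mul bsi)
  have unif : ∀ {f : Fin 2 → Pt → ℝ}, (∀ i, BddContOn Ω (f i)) →
      ∃ C, ∀ i, ∀ x ∈ Ω, |f i x| ≤ C := by
    intro f hf
    obtain ⟨C, hC⟩ := (hf 0).2
    obtain ⟨D, hD⟩ := (hf 1).2
    refine ⟨max C D, fun i x hx => ?_⟩
    fin_cases i
    · exact (hC x hx).trans (le_max_left _ _)
    · exact (hD x hx).trans (le_max_right _ _)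
  have test₁ : ∫ x in Ω, ∑ i, ((K i x).im * (s x)⁻¹ - pdR φ x i) * (K i x).im = 0 := by
    obtain ⟨C, hC⟩ := unif bp₁
    obtain ⟨D, hD⟩ := unif bKim
    have h := integral_grad_mul_eq hΩo hb (w := w₁) (F := fun i x => (K i x).im) (G := fun _ => 0)
      (Complex.continuous_im.comp hLc) (fun x hx => by simp [hw₁, hL0 x hx])
      (fun x hx => (hw₁d x hx).choose_spec.1.differentiableAt)
      (fun x hx i => by rw [hp₁ i x hx]; exact hC i x hx)
      (fun i => Complex.imCLM.contDiff.comp_contDiffOn (hKC i)) hD hdivim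
      (CG := 0) (by simp) aestronglyMeasurable_const
    simp only [mul_zero, integral_zero, neg_zero] at h
    rw [← h]
    exact setIntegral_congr_fun hΩo.measurableSet fun x hx =>
      Finset.sum_congr rfl fun i _ => by rw [hp₁ i x hx]
  have bdiv : BddContOn Ω fun x => gradSq u x - c x * s x := bgu.sub (hc.mul bs)
  have test₂ : ∫ x in Ω, ∑ i, 2 * (K i x).re * ((s x)⁻¹ * (s x)⁻¹) * (K i x).re =
      - ∫ x in Ω, (1 - (s x)⁻¹) * (gradSq u x - c x * s x) := by
    obtain ⟨C, hC⟩ := unif bp₂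
    obtain ⟨D, hD⟩ := unif bKre
    obtain ⟨M, hM⟩ := bdiv.2
    have h := integral_grad_mul_eq hΩo hb (w := w₂) (F := fun i x => (K i x).re)
      (by fun_prop) (fun x hx => by simp [hw₂, hL0 x hx])
      (fun x hx => (hw₂d x hx).choose_spec.1.differentiableAt)
      (fun x hx i => by rw [hp₂ i x hx]; exact hC i x hx)
      (fun i => Complex.reCLM.contDiff.comp_contDiffOn (hKC i)) hD hdivre hM
      (bdiv.1.aestronglyMeasurable hΩo.measurableSet)
    have h1 : ∫ x in Ω, w₂ x * (gradSq u x - c x * s x) =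
        ∫ x in Ω, (1 - (s x)⁻¹) * (gradSq u x - c x * s x) :=
      setIntegral_congr_fun hΩo.measurableSet fun x hx => by
        simp only [hw₂]; rw [hw₂Ω x hx]
    rw [← h1, ← h]
    exact setIntegral_congr_fun hΩo.measurableSet fun x hx =>
      Finset.sum_congr rfl fun i _ => by rw [hp₂ i x hx]
  have bA := BddContOn.sum fun i => (bp₁ i).mul (bKim i)
  have bB := BddContOn.sum fun i => (bp₂ i).mul (bKre i)
  have hsplit : ∀ x ∈ Ω, gradSq u x =
      ∑ i, ((K i x).re ^ 2 * (s x)⁻¹ + (K i x).im ^ 2 * (s x)⁻¹) := by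
    intro x hx
    refine Finset.sum_congr rfl fun i _ => ?_
    have h1 : (K i x).re ^ 2 + (K i x).im ^ 2 = s x * ‖pd u x i‖ ^ 2 := by
      have : ‖K i x‖ ^ 2 = s x * ‖pd u x i‖ ^ 2 := by
        simp [hK, hsdef, mul_pow]
      rw [← this, ← Complex.normSq_eq_norm_sq, Complex.normSq_apply]
      ring
    rw [← add_mul, h1]
    field_simp [(hspos x hx).ne']
  have hpt₁ : ∀ x ∈ Ω, gradSq u x ≤
      2 * (∑ i, ((K i x).im * (s x)⁻¹ - pdR φ x i) * (K i x).im) + (1 + η) * gradSqR φ x +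
      (1 + η) / 2 * ∑ i, 2 * (K i x).re * ((s x)⁻¹ * (s x)⁻¹) * (K i x).re := by
    intro x hx
    have h0 := hspos x hx
    have h1 : s x ≤ 1 + η := (hs' x (hΩcl hx)).2
    rw [hsplit x hx, gradSqR, Finset.mul_sum, Finset.mul_sum, Finset.mul_sum,
      ← Finset.sum_add_distrib, ← Finset.sum_add_distrib]
    refine Finset.sum_le_sum fun i _ => ?_
    set a := (K i x).re
    set b := (K i x).im
    set p := pdR φ x i
    set t := (s x)⁻¹
    have ht : 0 < t := inv_pos.2 h0
    have hst : s x * t = 1 := mul_inv_cancel₀ h0.ne'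
    have e1 : a ^ 2 * t ≤ (1 + η) * (a ^ 2 * t * t) := by
      have : a ^ 2 * t = s x * (a ^ 2 * t * t) := by
        linear_combination (-(a ^ 2 * t)) * hst
      exact this.trans_le (mul_le_mul_of_nonneg_right h1 (by positivity))
    have e2 : b ^ 2 * t ≤ 2 * ((b * t - p) * b) + (1 + η) * p ^ 2 := by
      have h2 : s x * p ^ 2 ≤ (1 + η) * p ^ 2 := mul_le_mul_of_nonneg_right h1 (sq_nonneg _)
      have h3 : 0 ≤ t * (b - s x * p) ^ 2 := by positivity
      have h4 : t * (b - s x * p) ^ 2 = b ^ 2 * t - 2 * b * p + s x * p ^ 2 := by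
        linear_combination (- 2 * b * p + s x * p ^ 2) * hst
      linarith
    linarith
  have hpt₂ : ∀ x ∈ Ω, -((1 - (s x)⁻¹) * (gradSq u x - c x * s x)) ≤
      2 * η * gradSq u x + (s x - 1) * c x := by
    intro x hx
    have h0 := hspos x hx
    have h1 : 1 - η ≤ s x := (hs' x (hΩcl hx)).1
    have hg : 0 ≤ gradSq u x := Finset.sum_nonneg fun i _ => sq_nonneg _
    have hst : (s x)⁻¹ * s x = 1 := inv_mul_cancel₀ h0.ne'
    have h2 : (s x)⁻¹ ≤ 1 + 2 * η := by
      rw [inv_le_iff_one_le_mul₀ h0]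
      nlinarith
    have h3 : -((1 - (s x)⁻¹) * (gradSq u x - c x * s x)) =
        ((s x)⁻¹ - 1) * gradSq u x + (s x - 1) * c x := by
      linear_combination (- c x) * hst
    rw [h3]
    have : ((s x)⁻¹ - 1) * gradSq u x ≤ 2 * η * gradSq u x :=
      mul_le_mul_of_nonneg_right (by linarith) hg
    linarith
  have iu := bgu.integrableOn hΩo hb
  have iφ := bgφ.integrableOn hΩo hb
  have iA := bA.integrableOn hΩo hb
  have iB := bB.integrableOn hΩo hb
  have iC := ((bs.sub (BddContOn.const 1)).mul hc).integrableOn hΩo hb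
  have iD := (((BddContOn.const 1).sub bsi).mul bdiv).integrableOn hΩo hb
  have I₁ : ∫ x in Ω, gradSq u x ≤ (1 + η) * (∫ x in Ω, gradSqR φ x) + (1 + η) / 2 *
      ∫ x in Ω, ∑ i, 2 * (K i x).re * ((s x)⁻¹ * (s x)⁻¹) * (K i x).re := by
    have iAφ : IntegrableOn (fun x => 2 * (∑ i, ((K i x).im * (s x)⁻¹ - pdR φ x i) * (K i x).im) +
        (1 + η) * gradSqR φ x) Ω := (iA.const_mul 2).add (iφ.const_mul (1 + η))
    refine (setIntegral_mono_on iu (iAφ.add (iB.const_mul ((1 + η) / 2)))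
      hΩo.measurableSet hpt₁).trans_eq ?_
    simp only [Pi.add_apply]
    rw [integral_add iAφ (iB.const_mul ((1 + η) / 2)),
      integral_add (iA.const_mul 2) (iφ.const_mul (1 + η)), integral_const_mul, integral_const_mul,
      integral_const_mul, test₁]
    ring
  have I₂ : - ∫ x in Ω, (1 - (s x)⁻¹) * (gradSq u x - c x * s x) ≤
      2 * η * (∫ x in Ω, gradSq u x) + ∫ x in Ω, (s x - 1) * c x := by
    rw [← integral_neg]
    refine (setIntegral_mono_on iD.neg ((iu.const_mul (2 * η)).add iC)
      hΩo.measurableSet hpt₂).trans_eq ?_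
    simp only [Pi.add_apply]
    rw [integral_add (iu.const_mul (2 * η)) iC, integral_const_mul]
  rw [test₂] at I₁
  have hnn : 0 ≤ ∫ x in Ω, gradSq u x :=
    integral_nonneg fun x => Finset.sum_nonneg fun i _ => sq_nonneg _
  have h1 := mul_le_mul_of_nonneg_left I₂ (by positivity : 0 ≤ (1 + η) / 2)
  have h2 : (1 + η) / 2 * (2 * η * ∫ x in Ω, gradSq u x) ≤ 3 / 2 * η * ∫ x in Ω, gradSq u x := by
    have : (1 + η) * η ≤ 3 / 2 * η := mul_le_mul_of_nonneg_right (by linarith) hη0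
    calc _ = ((1 + η) * η) * ∫ x in Ω, gradSq u x := by ring
      _ ≤ _ := mul_le_mul_of_nonneg_right this hnn
  linarith

theorem gradSq_cexp_I_mul {u₀ : Pt → ℂ} {φ : Pt → ℝ}
    (hu₀ : ∀ x, u₀ x = Complex.exp (Complex.I * (φ x : ℂ))) {x : Pt}
    (hφ : DifferentiableAt ℝ φ x) : gradSq u₀ x = gradSqR φ x := by
  obtain rfl : u₀ = fun x => Complex.exp (Complex.I * (φ x : ℂ)) := funext hu₀
  have h2 : HasFDerivAt (fun y => (φ y : ℂ)) (Complex.ofRealCLM.comp (fderiv ℝ φ x)) x :=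
    Complex.ofRealCLM.hasFDerivAt.comp x hφ.hasFDerivAt
  have h := (h2.const_mul Complex.I).cexp
  refine Finset.sum_congr rfl fun i _ => ?_
  rw [pd, h.fderiv, pdR]
  simp [Complex.norm_exp]

theorem abs_norm_sub_one_le_iSup {Ω : Set Pt} (hb : Bornology.IsBounded Ω) {u : Pt → ℂ}
    (hu : ContinuousOn u (closure Ω)) {x : Pt} (hx : x ∈ closure Ω) :
    |‖u x‖ - 1| ≤ ⨆ x : closure Ω, |‖u x.1‖ - 1| := by
  obtain ⟨C, hC⟩ := hb.isCompact_closure.exists_bound_of_continuousOn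
    (hu.norm.sub (continuousOn_const (c := (1 : ℝ))))
  have hbdd : BddAbove (Set.range fun x : closure Ω => |‖u x.1‖ - 1|) := by
    refine ⟨C, ?_⟩
    rintro _ ⟨y, rfl⟩
    exact hC y.1 y.2
  exact le_ciSup hbdd ⟨x, hx⟩

theorem abs_sq_sub_one_le {r η : ℝ} (hr : 0 ≤ r) (hη : η ≤ 1 / 2) (h : |r - 1| ≤ η / 3) :
    |r ^ 2 - 1| ≤ η := by
  obtain ⟨h1, h2⟩ := abs_le.1 h
  rw [abs_le]
  constructor <;> nlinarith

theorem exists_small_factor {a b : ℝ} (ha : 0 ≤ a) (hab : a < b) :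
    ∃ η : ℝ, 0 < η ∧ η ≤ 1 / 2 ∧ (1 + η) * a < (1 - 3 / 2 * η) * b := by
  refine ⟨min (1 / 2) ((b - a) / (2 * (a + 3 / 2 * b))), ?_, min_le_left _ _, ?_⟩
  · exact lt_min (by norm_num) (div_pos (by linarith) (by linarith))
  · have h := min_le_right (1 / 2) ((b - a) / (2 * (a + 3 / 2 * b)))
    rw [le_div_iff₀ (by linarith)] at h
    linarith

/-- Theorem 1.4 (ii) (as proved): for the symmetric two-component system, under the
Pohozaev bound with constant `γ₁` and limsup potential bounds `γ₃, γ₄`, if the Dirichlet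
energies eventually exceed `C₆ > (1/2)∫(|∇u₀|² + |∇v₀|²) + √(γ₁γ₃) + √(γ₁γ₄)`, then
`|u_ε|` and `|v_ε|` cannot both converge uniformly to `1` on the closure of `Ω`. -/
theorem stmt15
    (Ω : Set Pt) (hΩo : IsOpen Ω) (hΩne : Ω.Nonempty) (hΩconn : IsConnected Ω)
    (hΩbdd : Bornology.IsBounded Ω)
    (hstar : ∃ x₀, StarConvex ℝ x₀ Ω)
    (g₁ g₂ : Pt → ℂ)
    (hg₁ : ∀ x ∈ frontier Ω, ‖g₁ x‖ = 1) (hg₂ : ∀ x ∈ frontier Ω, ‖g₂ x‖ = 1)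
    (φ ψ : Pt → ℝ)
    (hφ1 : ContDiffOn ℝ 1 φ (closure Ω)) (hφ2 : ContDiffOn ℝ 2 φ Ω)
    (hφharm : ∀ x ∈ Ω, lapR φ x = 0)
    (hψ1 : ContDiffOn ℝ 1 ψ (closure Ω)) (hψ2 : ContDiffOn ℝ 2 ψ Ω)
    (hψharm : ∀ x ∈ Ω, lapR ψ x = 0)
    (u₀ v₀ : Pt → ℂ)
    (hu₀ : ∀ x, u₀ x = Complex.exp (Complex.I * (φ x : ℂ)))
    (hv₀ : ∀ x, v₀ x = Complex.exp (Complex.I * (ψ x : ℂ)))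
    (hu₀b : ∀ x ∈ frontier Ω, u₀ x = g₁ x)
    (hv₀b : ∀ x ∈ frontier Ω, v₀ x = g₂ x)
    (u v : ℝ → Pt → ℂ)
    (hu1 : ∀ ε > 0, ContDiffOn ℝ 1 (u ε) (closure Ω))
    (hu2 : ∀ ε > 0, ContDiffOn ℝ 2 (u ε) Ω)
    (hv1 : ∀ ε > 0, ContDiffOn ℝ 1 (v ε) (closure Ω))
    (hv2 : ∀ ε > 0, ContDiffOn ℝ 2 (v ε) Ω)
    (hGLu : ∀ ε > 0, ∀ x ∈ Ω,
      -(lap (u ε) x) =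
        ((ε ^ 2 : ℝ) : ℂ)⁻¹ * u ε x * ((2 - ‖u ε x‖ ^ 2 - ‖v ε x‖ ^ 2 : ℝ) : ℂ))
    (hGLv : ∀ ε > 0, ∀ x ∈ Ω,
      -(lap (v ε) x) =
        ((ε ^ 2 : ℝ) : ℂ)⁻¹ * v ε x * ((2 - ‖u ε x‖ ^ 2 - ‖v ε x‖ ^ 2 : ℝ) : ℂ))
    (hub : ∀ ε > 0, ∀ x ∈ frontier Ω, u ε x = g₁ x)
    (hvb : ∀ ε > 0, ∀ x ∈ frontier Ω, v ε x = g₂ x)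
    (γ₁ : ℝ) (hγ₁ : 0 < γ₁)
    (hpoho : ∀ᶠ ε in 𝓝[>] (0 : ℝ),
      (ε ^ 2)⁻¹ * (∫ x in Ω, (2 - ‖u ε x‖ ^ 2 - ‖v ε x‖ ^ 2) ^ 2) ≤ γ₁)
    (γ₃ γ₄ : ℝ) (hγ₃ : 0 ≤ γ₃) (hγ₄ : 0 ≤ γ₄)
    (hls₃ : Filter.limsup (fun ε => (ε ^ 2)⁻¹ * ∫ x in Ω, (1 - ‖u ε x‖ ^ 2) ^ 2)
      (𝓝[>] (0 : ℝ)) ≤ γ₃)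
    (hls₄ : Filter.limsup (fun ε => (ε ^ 2)⁻¹ * ∫ x in Ω, (1 - ‖v ε x‖ ^ 2) ^ 2)
      (𝓝[>] (0 : ℝ)) ≤ γ₄)
    (C₆ : ℝ)
    (hC₆a : ∀ᶠ ε in 𝓝[>] (0 : ℝ),
      C₆ ≤ (1 / 2) * ∫ x in Ω, (gradSq (u ε) x + gradSq (v ε) x))
    (hC₆b : (1 / 2) * (∫ x in Ω, (gradSq u₀ x + gradSq v₀ x)) +
        Real.sqrt (γ₁ * γ₃) + Real.sqrt (γ₁ * γ₄) < C₆) :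
    ¬ (Tendsto (fun ε => ⨆ x : closure Ω, |‖u ε x.1‖ - 1|) (𝓝[>] (0 : ℝ)) (𝓝 0) ∧
       Tendsto (fun ε => ⨆ x : closure Ω, |‖v ε x.1‖ - 1|) (𝓝[>] (0 : ℝ)) (𝓝 0)) := by
  rintro ⟨hlu, hlv⟩
  have bφ := bddContOn_gradSqR hΩo hΩbdd hφ1
  have bψ := bddContOn_gradSqR hΩo hΩbdd hψ1
  have hE₀ : ∫ x in Ω, (gradSq u₀ x + gradSq v₀ x) =
      (∫ x in Ω, gradSqR φ x) + ∫ x in Ω, gradSqR ψ x := by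
    rw [← integral_add (bφ.integrableOn hΩo hΩbdd) (bψ.integrableOn hΩo hΩbdd)]
    refine setIntegral_congr_fun hΩo.measurableSet fun x hx => ?_
    have hd : ∀ {f : Pt → ℝ}, ContDiffOn ℝ 2 f Ω → DifferentiableAt ℝ f x := fun hf =>
      (hf.differentiableOn two_ne_zero).differentiableAt (hΩo.mem_nhds hx)
    simp only [gradSq_cexp_I_mul hu₀ (hd hφ2), gradSq_cexp_I_mul hv₀ (hd hψ2)]
  have hE₀_nonneg : 0 ≤ (∫ x in Ω, gradSqR φ x) + ∫ x in Ω, gradSqR ψ x :=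
    add_nonneg (integral_nonneg fun x => Finset.sum_nonneg fun i _ => sq_nonneg _)
      (integral_nonneg fun x => Finset.sum_nonneg fun i _ => sq_nonneg _)
  have hgap : (∫ x in Ω, gradSqR φ x) + ∫ x in Ω, gradSqR ψ x < 2 * C₆ := by
    rw [hE₀] at hC₆b
    have := Real.sqrt_nonneg (γ₁ * γ₃)
    have := Real.sqrt_nonneg (γ₁ * γ₄)
    linarith
  obtain ⟨η, hη0, hη, hηgap⟩ := exists_small_factor hE₀_nonneg hgap
  have hpos : ∀ᶠ ε in 𝓝[>] (0 : ℝ), 0 < ε := self_mem_nhdsWithin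
  obtain ⟨ε, ⟨⟨hε, hεC⟩, hεu⟩, hεv⟩ := (((hpos.and hC₆a).and
    (hlu.eventually_lt_const (by positivity : 0 < η / 3))).and
    (hlv.eventually_lt_const (by positivity : 0 < η / 3))).exists
  have hcu := (hu1 ε hε).continuousOn
  have hcv := (hv1 ε hε).continuousOn
  set c : Pt → ℝ := fun x => (ε ^ 2)⁻¹ * (2 - ‖u ε x‖ ^ 2 - ‖v ε x‖ ^ 2) with hc
  have bc : BddContOn Ω c := .of_continuousOn_closure hΩbdd (by fun_prop)
  have bsu : BddContOn Ω fun x => ‖u ε x‖ ^ 2 - 1 :=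
    .of_continuousOn_closure hΩbdd (by fun_prop)
  have bsv : BddContOn Ω fun x => ‖v ε x‖ ^ 2 - 1 :=
    .of_continuousOn_closure hΩbdd (by fun_prop)
  have hU := integral_gradSq_le hΩo hΩne hΩbdd hstar hφ1 (hu1 ε hε) (hu2 ε hε) bc
    (fun x hx => by
      rw [← neg_eq_iff_eq_neg, hGLu ε hε x hx, hc]
      push_cast
      ring)
    (fun x hx => by rw [hub ε hε x hx, ← hu₀b x hx, hu₀]) hη0.le hη
    (fun x hx => abs_sq_sub_one_le (norm_nonneg _) hη
      ((abs_norm_sub_one_le_iSup hΩbdd hcu hx).trans hεu.le))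
  have hV := integral_gradSq_le hΩo hΩne hΩbdd hstar hψ1 (hv1 ε hε) (hv2 ε hε) bc
    (fun x hx => by
      rw [← neg_eq_iff_eq_neg, hGLv ε hε x hx, hc]
      push_cast
      ring)
    (fun x hx => by rw [hvb ε hε x hx, ← hv₀b x hx, hv₀]) hη0.le hη
    (fun x hx => abs_sq_sub_one_le (norm_nonneg _) hη
      ((abs_norm_sub_one_le_iSup hΩbdd hcv hx).trans hεv.le))
  have hpot : (∫ x in Ω, (‖u ε x‖ ^ 2 - 1) * c x) + ∫ x in Ω, (‖v ε x‖ ^ 2 - 1) * c x ≤ 0 := by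
    rw [← integral_add ((bsu.mul bc).integrableOn hΩo hΩbdd)
      ((bsv.mul bc).integrableOn hΩo hΩbdd)]
    refine integral_nonpos fun x => ?_
    have h : (‖u ε x‖ ^ 2 - 1) * c x + (‖v ε x‖ ^ 2 - 1) * c x =
        -((ε ^ 2)⁻¹ * (2 - ‖u ε x‖ ^ 2 - ‖v ε x‖ ^ 2) ^ 2) := by
      simp only [hc]
      ring
    simp only [h, Pi.zero_apply, Left.neg_nonpos_iff]
    positivity
  rw [integral_add ((bddContOn_gradSq hΩo hΩbdd (hu1 ε hε)).integrableOn hΩo hΩbdd)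
    ((bddContOn_gradSq hΩo hΩbdd (hv1 ε hε)).integrableOn hΩo hΩbdd)] at hεC
  have hpot' := mul_nonpos_of_nonneg_of_nonpos (by positivity : 0 ≤ (1 + η) / 2) hpot
  have hlow : (1 - 3 / 2 * η) * (2 * C₆) ≤
      (1 - 3 / 2 * η) * ((∫ x in Ω, gradSq (u ε) x) + ∫ x in Ω, gradSq (v ε) x) :=
    mul_le_mul_of_nonneg_left (by linarith) (by linarith)
  linarith
end
end

section
/- Let ε > 0 and let u : closure(Ω) → ℂ be C¹ on closure(Ω), C² on Ω, satisfy −Δu = ε⁻² u (1 − |u|²) on Ω, and satisfy |u| = 1 on ∂Ω. Then |u(x)| ≤ 1 for all x in the closure of Ω. -/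
open MeasureTheory Filter Topology

noncomputable section

/-- Second-order necessary condition for a local maximum on the line. -/
lemma IsLocalMax.deriv_deriv_nonpos {f : ℝ → ℝ} {x : ℝ} (h : IsLocalMax f x)
    (hc : ContinuousAt f x) : deriv (deriv f) x ≤ 0 := by
  by_contra! hpos
  have hmin : IsLocalMin f x := isLocalMin_of_deriv_deriv_pos hpos h.deriv_eq_zero hc
  have hconst : f =ᶠ[𝓝 x] fun _ => f x := by
    filter_upwards [h, hmin] with y h₁ h₂ using le_antisymm h₁ h₂
  have hzero : deriv (deriv f) x = 0 := by
    rw [hconst.deriv.deriv_eq]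
    simp
  exact hpos.ne' hzero

/-- If a linear functional of `u` has a local maximum at `x`, then its value on each pure second
partial derivative of `u` at `x` is nonpositive. -/
lemma IsLocalMax.clm_fderiv_pd_nonpos {u : Pt → ℂ} {x : Pt} (L : ℂ →L[ℝ] ℝ)
    (hu : ContDiffAt ℝ 2 u x) (h : IsLocalMax (fun y => L (u y)) x) (i : Fin 2) :
    L (fderiv ℝ (fun y => pd u y i) x (EuclideanSpace.single i 1)) ≤ 0 := by
  set e : Pt := EuclideanSpace.single i 1
  have hline (t : ℝ) : HasDerivAt (fun t : ℝ => x + t • e) e t := by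
    simpa using ((hasDerivAt_id t).smul_const e).const_add x
  have hx : x + (0 : ℝ) • e = x := by simp
  have hlim : Tendsto (fun t : ℝ => x + t • e) (𝓝 0) (𝓝 x) := by
    simpa using (hline 0).continuousAt.tendsto
  have hdiff : ∀ᶠ y in 𝓝 x, DifferentiableAt ℝ u y := by
    filter_upwards [hu.eventually (by simp)] with y hy using hy.differentiableAt (by simp)
  have hpd : DifferentiableAt ℝ (fun y => pd u y i) x :=
    ((hu.fderiv_right (m := 1) (by norm_num)).differentiableAt (by simp)).clm_apply
      (differentiableAt_const e)
  have hfirst : ∀ᶠ t : ℝ in 𝓝 0,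
      HasDerivAt (fun t : ℝ => L (u (x + t • e))) (L (pd u (x + t • e) i)) t := by
    filter_upwards [hlim.eventually hdiff] with t ht
    exact L.hasFDerivAt.comp_hasDerivAt t (ht.hasFDerivAt.comp_hasDerivAt t (hline t))
  have hsecond : HasDerivAt (fun t : ℝ => L (pd u (x + t • e) i))
      (L (fderiv ℝ (fun y => pd u y i) x e)) 0 := by
    have hpd' : HasFDerivAt (fun y => pd u y i) (fderiv ℝ (fun y => pd u y i) x)
        (x + (0 : ℝ) • e) := by
      rw [hx]
      exact hpd.hasFDerivAt
    have hcomp := hpd'.comp_hasDerivAt (0 : ℝ) (hline 0)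
    exact L.hasFDerivAt.comp_hasDerivAt 0 hcomp
  have hmax : IsLocalMax (fun t : ℝ => L (u (x + t • e))) 0 := by
    have := hlim.eventually h
    simpa only [IsLocalMax, IsMaxFilter, hx] using this
  have hderiv : deriv (fun t : ℝ => L (u (x + t • e))) =ᶠ[𝓝 0]
      fun t => L (pd u (x + t • e) i) := hfirst.mono fun t ht => ht.deriv
  rw [← hsecond.deriv, ← hderiv.deriv_eq]
  exact hmax.deriv_deriv_nonpos hfirst.self_of_nhds.continuousAt

/-- At a local maximum of `‖u‖`, the Laplacian of `u` has nonpositive inner product with `u`. -/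
lemma IsLocalMax.inner_lap_nonpos {u : Pt → ℂ} {x : Pt} (hu : ContDiffAt ℝ 2 u x)
    (h : IsLocalMax (fun y => ‖u y‖) x) : inner ℝ (u x) (lap u x) ≤ 0 := by
  have hmax : IsLocalMax (fun y => innerSL ℝ (u x) (u y)) x := by
    filter_upwards [h] with y hy
    simp only [innerSL_apply_apply, real_inner_self_eq_norm_mul_norm]
    exact (real_inner_le_norm _ _).trans (mul_le_mul_of_nonneg_left hy (norm_nonneg _))
  rw [lap, inner_sum]
  exact Finset.sum_nonpos fun i _ => hmax.clm_fderiv_pd_nonpos _ hu i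

/-- The maximum-principle bound (1.5): a solution of the Ginzburg–Landau equation with
`|u| = 1` on `∂Ω` satisfies `|u| ≤ 1` on the closure of `Ω`. -/
theorem stmt17
    (Ω : Set Pt) (hΩo : IsOpen Ω) (hΩne : Ω.Nonempty) (hΩconn : IsConnected Ω)
    (hΩbdd : Bornology.IsBounded Ω)
    (ε : ℝ) (hε : 0 < ε) (u : Pt → ℂ)
    (hu1 : ContDiffOn ℝ 1 u (closure Ω)) (hu2 : ContDiffOn ℝ 2 u Ω)
    (hGL : ∀ x ∈ Ω,
      -(lap u x) = ((ε ^ 2 : ℝ) : ℂ)⁻¹ * u x * ((1 - ‖u x‖ ^ 2 : ℝ) : ℂ))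
    (hub : ∀ x ∈ frontier Ω, ‖u x‖ = 1) :
    ∀ x ∈ closure Ω, ‖u x‖ ≤ 1 := by
  obtain ⟨x₀, hx₀, hmax⟩ := hΩbdd.isCompact_closure.exists_isMaxOn hΩne.closure
    hu1.continuousOn.norm
  suffices hle : ‖u x₀‖ ≤ 1 from fun x hx => (hmax hx).trans hle
  by_contra! hlt
  have hmem : x₀ ∈ Ω := by
    by_contra hnot
    exact hlt.ne' (hub x₀ ⟨hx₀, by rwa [hΩo.interior_eq]⟩)
  have hnhds : Ω ∈ 𝓝 x₀ := hΩo.mem_nhds hmem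
  have hlap := IsLocalMax.inner_lap_nonpos (hu2.contDiffAt hnhds)
    (hmax.isLocalMax (mem_of_superset hnhds subset_closure))
  have hL : lap u x₀ = ((ε ^ 2)⁻¹ * (‖u x₀‖ ^ 2 - 1)) • u x₀ := by
    rw [← neg_neg (lap u x₀), hGL x₀ hmem, Complex.real_smul]
    push_cast
    ring
  rw [hL, inner_smul_right, real_inner_self_eq_norm_sq] at hlap
  have hsq : 0 < ‖u x₀‖ ^ 2 - 1 := by nlinarith
  have hpos : 0 < (ε ^ 2)⁻¹ * (‖u x₀‖ ^ 2 - 1) * ‖u x₀‖ ^ 2 := by positivity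
  exact hlap.not_gt hpos
end
end
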